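/- Set W̃ = Q̃_φ − b^{1/2}(Q̃)Q̃_ψ and Z̃ = −Q̃_φ − b^{1/2}(Q̃)Q̃_ψ, and assume that for some constant c₀ > 0 one has −c₀/φ ≤ (1/4)b(Q̃)⁻¹p(Q̃)W̃(φ,ψ) ≤ 0 and 0 ≤ (1/4)b(Q̃)⁻¹p(Q̃)Z̃(φ,ψ) ≤ c₀/φ on (0,ζ)×(0,m). Let w, z ∈ L^∞((0,ζ)×(0,m)) satisfy max(|w(φ,ψ)|, |z(φ,ψ)|) ≤ κφ^{5λ/4+1/2} for some κ > 0. Then the system W_φ + b^{1/2}(Q̃)W_ψ = (1/4)b(Q̃)⁻¹p(Q̃)W̃·(W + z), Z_φ − b^{1/2}(Q̃)Z_ψ = −(1/4)b(Q̃)⁻¹p(Q̃)Z̃·(w + Z) on (0,ζ)×(0,m), with W(0,·) = Z(0,·) = 0 and homogeneous boundary conditions W + Z = 0 on {ψ = 0} and on {ψ = m}, admits a unique weak solution (W,Z) ∈ L^∞((0,ζ)×(0,m))² satisfying lim_{φ→0⁺} ess sup_{ψ∈(0,m)} max(|W(φ,ψ)|, |Z(φ,ψ)|) = 0; moreover, for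 a.e. (φ,ψ) ∈ (0,ζ)×(0,m), max(|W(φ,ψ)|, |Z(φ,ψ)|) ≤ (4c₀/(5λ + 2 + 4c₀))·κ·φ^{5λ/4+1/2}. -/

import Mathlib

open Real Set MeasureTheory Filter

noncomputable section

/-- The density function `ρ(t) = (1 − ((γ−1)/2) t)^{1/(γ−1)}`. -/
def rhoF (γ t : ℝ) : ℝ := (1 - (γ - 1) / 2 * t) ^ ((1 : ℝ) / (γ - 1))

/-- The critical (sonic) speed `c_* = (2/(γ+1))^{1/2}`. -/
def cstar (γ : ℝ) : ℝ := Real.sqrt (2 / (γ + 1))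

/-- The maximal speed `q_max = (2/(γ−1))^{1/2}`. -/
def qmaxF (γ : ℝ) : ℝ := Real.sqrt (2 / (γ - 1))

/-- `A(q) = ∫_{c_*}^q (ρ(s²)+2s²ρ'(s²))/(s ρ(s²)²) ds`. -/
def Afun (γ q : ℝ) : ℝ :=
  ∫ s in (cstar γ)..q,
    (rhoF γ (s ^ 2) + 2 * s ^ 2 * deriv (rhoF γ) (s ^ 2)) / (s * (rhoF γ (s ^ 2)) ^ 2)

/-- `B(q) = ∫_{c_*}^q ρ(s²)/s ds`. -/
def Bfun (γ q : ℝ) : ℝ := ∫ s in (cstar γ)..q, rhoF γ (s ^ 2) / s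

/-- Inverse of `A` restricted to `[c_*, q_max)`. -/
def AplusInv (γ : ℝ) : ℝ → ℝ := Function.invFunOn (Afun γ) (Ico (cstar γ) (qmaxF γ))

/-- `K(s) = B(A₊⁻¹(s))`. -/
def Kfun (γ s : ℝ) : ℝ := Bfun γ (AplusInv γ s)

/-- `b(s) = −K'(s)`. -/
def bfun (γ s : ℝ) : ℝ := -deriv (Kfun γ) s

/-- `p(s) = −K''(s)`. -/
def pfun (γ s : ℝ) : ℝ := -deriv (deriv (Kfun γ)) s

/-- Partial derivative in the first (potential) variable. -/
def pdx (u : ℝ × ℝ → ℝ) (p : ℝ × ℝ) : ℝ := deriv (fun x => u (x, p.2)) p.1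

/-- Partial derivative in the second (stream) variable. -/
def pdy (u : ℝ × ℝ → ℝ) (p : ℝ × ℝ) : ℝ := deriv (fun y => u (p.1, y)) p.2

/-- The Chaplygin equation (⋆) at a point. -/
def chap (γ : ℝ) (q : ℝ × ℝ → ℝ) (p : ℝ × ℝ) : Prop :=
  pdx (pdx fun z => Afun γ (q z)) p + pdy (pdy fun z => Bfun γ (q z)) p = 0

/-- `W̃ = Q̃_φ − b^{1/2}(Q̃) Q̃_ψ`. -/
def Wtil (γ : ℝ) (Qt : ℝ × ℝ → ℝ) (p : ℝ × ℝ) : ℝ :=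
  pdx Qt p - Real.sqrt (bfun γ (Qt p)) * pdy Qt p

/-- `Z̃ = −Q̃_φ − b^{1/2}(Q̃) Q̃_ψ`. -/
def Ztil (γ : ℝ) (Qt : ℝ × ℝ → ℝ) (p : ℝ × ℝ) : ℝ :=
  -pdx Qt p - Real.sqrt (bfun γ (Qt p)) * pdy Qt p

/-- The structural hypotheses on the background state `Q̃` on `(0,ζ)×(0,m)`. -/
def QtOK (γ lam ζ m μ1 μ2 β1 β2 β3 : ℝ) (Qt : ℝ × ℝ → ℝ) : Prop :=
  (∃ L : NNReal, LipschitzOnWith L Qt (Icc 0 ζ ×ˢ Icc 0 m)) ∧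
  (∀ p ∈ Ioo (0 : ℝ) ζ ×ˢ Ioo (0 : ℝ) m,
    -μ2 * p.1 ^ (lam + 2) ≤ Qt p ∧ Qt p ≤ -μ1 * p.1 ^ (lam + 2)) ∧
  (∀ᵐ p ∂(volume.restrict (Ioo (0 : ℝ) ζ ×ˢ Ioo (0 : ℝ) m)),
    (-β2 * p.1 ^ (lam + 1) ≤ pdx Qt p ∧ pdx Qt p ≤ -β1 * p.1 ^ (lam + 1)) ∧
    |pdy Qt p| ≤ β3 * p.1 ^ (3 * lam / 2 + 1))

/-- Weak solution of the characteristic system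
`W_φ + b^{1/2}(Q̃) W_ψ = F`, `Z_φ − b^{1/2}(Q̃) Z_ψ = G` with `W(0,·) = Z(0,·) = 0`,
`W + Z = 0` on `{ψ = 0}`, and `W + Z = h̃` on `{ψ = m}` (`h̃ = 0` for homogeneous
boundary data), in the sense of the paper. -/
def HypWeakSol (γ ζ m : ℝ) (Qt : ℝ × ℝ → ℝ) (F G : ℝ × ℝ → ℝ) (hb : ℝ → ℝ)
    (W Z : ℝ × ℝ → ℝ) : Prop :=
  ∀ ξ η : ℝ × ℝ → ℝ, ContDiff ℝ 1 ξ → ContDiff ℝ 1 η →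
    (∀ ψ ∈ Icc (0 : ℝ) m, ξ (ζ, ψ) = 0 ∧ η (ζ, ψ) = 0) →
    (∀ φ ∈ Icc (0 : ℝ) ζ, ξ (φ, 0) = -η (φ, 0) ∧ ξ (φ, m) = -η (φ, m)) →
    (∫ p in Ioo (0 : ℝ) ζ ×ˢ Ioo (0 : ℝ) m,
        (W p * pdx ξ p + Real.sqrt (bfun γ (Qt p)) * W p * pdy ξ p
          + 1 / 2 * (Real.sqrt (bfun γ (Qt p)))⁻¹ * pfun γ (Qt p) * pdy Qt p * W p * ξ p
          + F p * ξ p))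
    + (∫ p in Ioo (0 : ℝ) ζ ×ˢ Ioo (0 : ℝ) m,
        (Z p * pdx η p - Real.sqrt (bfun γ (Qt p)) * Z p * pdy η p
          - 1 / 2 * (Real.sqrt (bfun γ (Qt p)))⁻¹ * pfun γ (Qt p) * pdy Qt p * Z p * η p
          + G p * η p))
    - (∫ φ in Ioo (0 : ℝ) ζ, Real.sqrt (bfun γ (Qt (φ, m))) * hb φ * ξ (φ, m)) = 0

/-- `ess sup_{ψ} max(|W|,|Z|)(φ,·) → 0` as `φ → 0⁺`. -/
def VanishAtSonic (ζ m : ℝ) (W Z : ℝ × ℝ → ℝ) : Prop :=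
  ∀ η > 0, ∃ φ0 > 0,
    ∀ᵐ p ∂(volume.restrict (Ioo (0 : ℝ) (min φ0 ζ) ×ˢ Ioo (0 : ℝ) m)),
      |W p| ≤ η ∧ |Z p| ≤ η

/-! ### Gas dynamics: the function `b` near the sonic value -/

/-- The base `1 - (γ-1)/2 q²`. -/
def gbase (γ q : ℝ) : ℝ := 1 - (γ - 1) / 2 * q ^ 2

/-- `H = 1/b` expressed in the speed. -/
def Hq (γ q : ℝ) : ℝ := ((γ + 1) / 2 * q ^ 2 - 1) * (gbase γ q) ^ (-((γ + 1) / (γ - 1)))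

lemma gbase_pos {γ q : ℝ} (hγ : 1 < γ) (h0 : 0 < q) (h1 : q < qmaxF γ) : 0 < gbase γ q := by
  unfold qmaxF at h1
  have h2 : q ^ 2 < 2 / (γ - 1) := (Real.lt_sqrt h0.le).1 h1
  have h3 : 0 < γ - 1 := by linarith
  rw [lt_div_iff₀ h3] at h2
  unfold gbase; nlinarith

lemma cstar_pos {γ : ℝ} (hγ : 1 < γ) : 0 < cstar γ := by
  unfold cstar; apply Real.sqrt_pos.2; apply div_pos <;> linarith

lemma cstar_sq {γ : ℝ} (hγ : 1 < γ) : (cstar γ) ^ 2 = 2 / (γ + 1) := by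
  unfold cstar; apply Real.sq_sqrt; apply div_nonneg <;> linarith

lemma cstar_lt_qmax {γ : ℝ} (hγ : 1 < γ) : cstar γ < qmaxF γ := by
  unfold cstar qmaxF
  apply Real.sqrt_lt_sqrt
  · apply div_nonneg <;> linarith
  · apply div_lt_div_of_pos_left <;> linarith

lemma hasDerivAt_gbase (γ q : ℝ) : HasDerivAt (gbase γ) (-((γ - 1) * q)) q := by
  unfold gbase
  have := (((hasDerivAt_id q).pow 2).const_mul ((γ - 1) / 2)).const_sub 1
  refine this.congr_deriv ?_
  simp; ring

lemma rhoF_sq (γ q : ℝ) : rhoF γ (q ^ 2) = gbase γ q ^ ((1 : ℝ) / (γ - 1)) := rfl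

lemma hasDerivAt_Hq {γ q : ℝ} (hγ : 1 < γ) (h0 : 0 < q) (h1 : q < qmaxF γ) :
    HasDerivAt (Hq γ) ((γ + 1) * q ^ 3 * gbase γ q ^ (-((γ + 1) / (γ - 1)) - 1)) q := by
  have hb := gbase_pos hγ h0 h1
  have hg : γ - 1 ≠ 0 := by linarith
  have d1 : HasDerivAt (fun q : ℝ => (γ + 1) / 2 * q ^ 2 - 1) ((γ + 1) * q) q := by
    refine ((((hasDerivAt_id q).pow 2).const_mul ((γ + 1) / 2)).sub_const 1).congr_deriv ?_
    simp; ring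
  have d2 := (hasDerivAt_gbase γ q).rpow_const (p := -((γ + 1) / (γ - 1))) (Or.inl hb.ne')
  refine (d1.mul d2).congr_deriv ?_
  have e1 : gbase γ q ^ (-((γ + 1) / (γ - 1))) =
      gbase γ q ^ (-((γ + 1) / (γ - 1)) - 1) * gbase γ q := by
    rw [Real.rpow_sub_one hb.ne']; field_simp
  rw [e1]
  generalize gbase γ q ^ (-((γ + 1) / (γ - 1)) - 1) = X
  unfold gbase
  field_simp
  ring

lemma hasDerivAt_rhoF {γ t : ℝ} (hγ : 1 < γ) (ht : 0 < 1 - (γ - 1) / 2 * t) :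
    HasDerivAt (rhoF γ) (-(1 / 2) * (1 - (γ - 1) / 2 * t) ^ ((1 : ℝ) / (γ - 1) - 1)) t := by
  unfold rhoF
  have hg : γ - 1 ≠ 0 := by linarith
  have d1 : HasDerivAt (fun t : ℝ => 1 - (γ - 1) / 2 * t) (-((γ - 1) / 2)) t := by
    refine (((hasDerivAt_id t).const_mul ((γ - 1) / 2)).const_sub 1).congr_deriv ?_
    simp
  refine (d1.rpow_const (p := (1 : ℝ) / (γ - 1)) (Or.inl ht.ne')).congr_deriv ?_
  field_simp

lemma rho_pos {γ q : ℝ} (hγ : 1 < γ) (h0 : 0 < q) (h1 : q < qmaxF γ) : 0 < rhoF γ (q ^ 2) :=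
  Real.rpow_pos_of_pos (gbase_pos hγ h0 h1) _

lemma Aint_eq {γ q : ℝ} (hγ : 1 < γ) (h0 : 0 < q) (h1 : q < qmaxF γ) :
    (rhoF γ (q ^ 2) + 2 * q ^ 2 * deriv (rhoF γ) (q ^ 2)) / (q * (rhoF γ (q ^ 2)) ^ 2)
      = -(Hq γ q * rhoF γ (q ^ 2) / q) := by
  have hb := gbase_pos hγ h0 h1
  have hr := rho_pos hγ h0 h1
  have hg : γ - 1 ≠ 0 := by linarith
  rw [(hasDerivAt_rhoF hγ (t := q ^ 2) hb).deriv]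
  have e1 : (1 - (γ - 1) / 2 * q ^ 2) ^ ((1 : ℝ) / (γ - 1) - 1) = rhoF γ (q ^ 2) / gbase γ q := by
    rw [rhoF_sq, ← Real.rpow_sub_one hb.ne']; rfl
  have e2 : gbase γ q ^ (-((γ + 1) / (γ - 1))) = (gbase γ q * rhoF γ (q ^ 2) ^ 2)⁻¹ := by
    rw [rhoF_sq, Real.rpow_neg hb.le, ← Real.rpow_natCast, ← Real.rpow_mul hb.le,
      mul_comm (gbase γ q), ← Real.rpow_add_one hb.ne']
    congr 2
    push_cast
    field_simp
    ring
  rw [e1]; unfold Hq; rw [e2]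
  have : gbase γ q = 1 - (γ - 1) / 2 * q ^ 2 := rfl
  have hb' := hb.ne'
  field_simp
  rw [this]; ring

lemma continuousAt_rho {γ q : ℝ} (hγ : 1 < γ) (h0 : 0 < q) (h1 : q < qmaxF γ) :
    ContinuousAt (fun q => rhoF γ (q ^ 2)) q := by
  have := (hasDerivAt_gbase γ q).rpow_const (p := (1 : ℝ) / (γ - 1))
    (Or.inl (gbase_pos hγ h0 h1).ne')
  exact this.continuousAt

lemma continuousOn_Aint {γ : ℝ} (hγ : 1 < γ) :
    ContinuousOn (fun s => (rhoF γ (s ^ 2) + 2 * s ^ 2 * deriv (rhoF γ) (s ^ 2)) /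
      (s * (rhoF γ (s ^ 2)) ^ 2)) (Ioo 0 (qmaxF γ)) := by
  have : ContinuousOn (fun q => -(Hq γ q * rhoF γ (q ^ 2) / q)) (Ioo 0 (qmaxF γ)) := by
    intro q hq
    apply ContinuousAt.continuousWithinAt
    exact (((hasDerivAt_Hq hγ hq.1 hq.2).continuousAt.mul
      (continuousAt_rho hγ hq.1 hq.2)).div continuousAt_id hq.1.ne').neg
  exact this.congr (fun q hq => Aint_eq hγ hq.1 hq.2)

lemma ftc_aux {f : ℝ → ℝ} {a b q c : ℝ} (hf : ContinuousOn f (Ioo a b)) (hc : c ∈ Ioo a b)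
    (hq : q ∈ Ioo a b) : HasDerivAt (fun u => ∫ s in c..u, f s) (f q) q := by
  apply intervalIntegral.integral_hasDerivAt_right
  · apply ContinuousOn.intervalIntegrable
    apply hf.mono
    intro x hx
    rcases le_total c q with h | h
    · rw [uIcc_of_le h] at hx; exact ⟨hc.1.trans_le hx.1, hx.2.trans_lt hq.2⟩
    · rw [uIcc_of_ge h] at hx; exact ⟨hq.1.trans_le hx.1, hx.2.trans_lt hc.2⟩
  · exact hf.stronglyMeasurableAtFilter isOpen_Ioo _ hq
  · exact hf.continuousAt (isOpen_Ioo.mem_nhds hq)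

lemma hasDerivAt_Afun {γ q : ℝ} (hγ : 1 < γ) (h0 : 0 < q) (h1 : q < qmaxF γ) :
    HasDerivAt (Afun γ) (-(Hq γ q * rhoF γ (q ^ 2) / q)) q := by
  rw [← Aint_eq hγ h0 h1]
  exact ftc_aux (continuousOn_Aint hγ) ⟨cstar_pos hγ, cstar_lt_qmax hγ⟩ ⟨h0, h1⟩

lemma hasDerivAt_Bfun {γ q : ℝ} (hγ : 1 < γ) (h0 : 0 < q) (h1 : q < qmaxF γ) :
    HasDerivAt (Bfun γ) (rhoF γ (q ^ 2) / q) q := by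
  refine ftc_aux (f := fun s => rhoF γ (s ^ 2) / s) (a := 0) (b := qmaxF γ) ?_
    ⟨cstar_pos hγ, cstar_lt_qmax hγ⟩ ⟨h0, h1⟩
  intro x hx
  exact ((continuousAt_rho hγ hx.1 hx.2).div continuousAt_id hx.1.ne').continuousWithinAt

lemma Hq_cstar {γ : ℝ} (hγ : 1 < γ) : Hq γ (cstar γ) = 0 := by
  unfold Hq; rw [cstar_sq hγ]
  have : γ + 1 ≠ 0 := by linarith
  field_simp; simp

lemma Afun_cstar (γ : ℝ) : Afun γ (cstar γ) = 0 := by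
  unfold Afun; simp

lemma Hq_pos {γ q : ℝ} (hγ : 1 < γ) (h0 : cstar γ < q) (h1 : q < qmaxF γ) : 0 < Hq γ q := by
  have hc := cstar_pos hγ
  apply mul_pos _ (Real.rpow_pos_of_pos (gbase_pos hγ (hc.trans h0) h1) _)
  have h2 : cstar γ ^ 2 < q ^ 2 := by nlinarith
  rw [cstar_sq hγ, div_lt_iff₀ (by linarith)] at h2
  nlinarith

lemma Afun_strictAnti {γ : ℝ} (hγ : 1 < γ) : StrictAntiOn (Afun γ) (Ico (cstar γ) (qmaxF γ)) := by
  have hc := cstar_pos hγ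
  apply strictAntiOn_of_deriv_neg (convex_Ico _ _)
  · intro q hq
    exact (hasDerivAt_Afun hγ (hc.trans_le hq.1) hq.2).continuousAt.continuousWithinAt
  · intro q hq
    rw [interior_Ico] at hq
    rw [(hasDerivAt_Afun hγ (hc.trans hq.1) hq.2).deriv]
    have := Hq_pos hγ hq.1 hq.2
    have := rho_pos hγ (hc.trans hq.1) hq.2
    have := hc.trans hq.1
    simp only [Left.neg_neg_iff]
    positivity

/-- `-A ≤ C H²`. -/
lemma negA_le {γ q : ℝ} (hγ : 1 < γ) (hq : q ∈ Ico (cstar γ) (qmaxF γ)) :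
    -Afun γ q ≤ (γ + 1) / 8 * Hq γ q ^ 2 := by
  have hc := cstar_pos hγ
  have hD : ∀ x ∈ Ico (cstar γ) (qmaxF γ), HasDerivAt
      (fun q => (γ + 1) / 8 * Hq γ q ^ 2 + Afun γ q) _ x := fun x hx =>
    ((((hasDerivAt_Hq hγ (hc.trans_le hx.1) hx.2).pow 2).const_mul ((γ + 1) / 8)).add
      (hasDerivAt_Afun hγ (hc.trans_le hx.1) hx.2))
  have hm : MonotoneOn (fun q => (γ + 1) / 8 * Hq γ q ^ 2 + Afun γ q)
      (Ico (cstar γ) (qmaxF γ)) := by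
    apply monotoneOn_of_deriv_nonneg (convex_Ico _ _)
    · intro x hx; exact (hD x hx).continuousAt.continuousWithinAt
    · intro x hx; rw [interior_Ico] at hx
      exact (hD x ⟨hx.1.le, hx.2⟩).differentiableAt.differentiableWithinAt
    · intro x hx; rw [interior_Ico] at hx
      rw [(hD x ⟨hx.1.le, hx.2⟩).deriv]
      have hH := Hq_pos hγ hx.1 hx.2
      have hx0 := hc.trans hx.1
      have hb := gbase_pos hγ hx0 hx.2
      have hb1 : gbase γ x ≤ 1 := by unfold gbase; nlinarith [sq_nonneg x]
      have hr : rhoF γ (x ^ 2) ≤ 1 := by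
        rw [rhoF_sq]; exact Real.rpow_le_one hb.le hb1 (by apply div_nonneg <;> linarith)
      have hX : 1 ≤ gbase γ x ^ (-((γ + 1) / (γ - 1)) - 1) := by
        apply Real.one_le_rpow_of_pos_of_le_one_of_nonpos hb hb1
        have : 0 ≤ (γ + 1) / (γ - 1) := by apply div_nonneg <;> linarith
        linarith
      have h2 : cstar γ ^ 2 < x ^ 2 := pow_lt_pow_left₀ hx.1 hc.le (by norm_num)
      rw [cstar_sq hγ, div_lt_iff₀ (by linarith)] at h2
      set X := gbase γ x ^ (-((γ + 1) / (γ - 1)) - 1)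
      have key : rhoF γ (x ^ 2) / x ≤ (γ + 1) / 4 * ((γ + 1) * x ^ 3 * X) := by
        rw [div_le_iff₀ hx0]
        have : (1:ℝ) ≤ (γ + 1) / 4 * ((γ + 1) * x ^ 3) * x := by nlinarith
        have h3 : (γ + 1) / 4 * ((γ + 1) * x ^ 3) * x * 1 ≤ (γ + 1) / 4 * ((γ + 1) * x ^ 3) * x * X := by
          apply mul_le_mul_of_nonneg_left hX; linarith
        nlinarith
      have := mul_le_mul_of_nonneg_left key hH.le
      simp only [Nat.cast_ofNat]
      calc (0:ℝ) ≤ Hq γ x * ((γ + 1) / 4 * ((γ + 1) * x ^ 3 * X)) - Hq γ x * (rhoF γ (x ^ 2) / x) := by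
            linarith
        _ = _ := by ring
  have := hm ⟨le_rfl, cstar_lt_qmax hγ⟩ hq hq.1
  simp only [Hq_cstar hγ, Afun_cstar] at this
  linarith

lemma Afun_unbdd {γ : ℝ} (hγ : 1 < γ) (s : ℝ) : ∃ q ∈ Ioo (cstar γ) (qmaxF γ), Afun γ q < s := by
  have hc := cstar_pos hγ
  have hg : γ - 1 ≠ 0 := by linarith
  obtain ⟨q1, h1, h1'⟩ := exists_between (cstar_lt_qmax hγ)
  have hq1 := hc.trans h1
  set k : ℝ := (γ + 1) / 2 - 1 / q1 ^ 2 with hk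
  have hkpos : 0 < k := by
    have h2 : cstar γ ^ 2 < q1 ^ 2 := by nlinarith
    rw [cstar_sq hγ, div_lt_iff₀ (by linarith)] at h2
    rw [hk, sub_pos, div_lt_iff₀ (by positivity)]; linarith
  set e : ℝ := -(1 / (γ - 1)) with he
  have hD : ∀ x ∈ Ico q1 (qmaxF γ), HasDerivAt
      (fun q => -Afun γ q - k * gbase γ q ^ e) _ x := fun x hx =>
    (hasDerivAt_Afun hγ (hq1.trans_le hx.1) hx.2).neg.sub
      (((hasDerivAt_gbase γ x).rpow_const (p := e)
        (Or.inl (gbase_pos hγ (hq1.trans_le hx.1) hx.2).ne')).const_mul k)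
  have hm : MonotoneOn (fun q => -Afun γ q - k * gbase γ q ^ e) (Ico q1 (qmaxF γ)) := by
    apply monotoneOn_of_deriv_nonneg (convex_Ico _ _)
    · intro x hx; exact (hD x hx).continuousAt.continuousWithinAt
    · intro x hx; rw [interior_Ico] at hx
      exact (hD x ⟨hx.1.le, hx.2⟩).differentiableAt.differentiableWithinAt
    · intro x hx; rw [interior_Ico] at hx
      rw [(hD x ⟨hx.1.le, hx.2⟩).deriv]
      have hx0 := hq1.trans hx.1
      have hb := gbase_pos hγ hx0 hx.2
      have e1 : gbase γ x ^ (-((γ + 1) / (γ - 1))) * gbase γ x ^ ((1:ℝ) / (γ - 1)) =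
          gbase γ x ^ (e - 1) := by
        rw [← Real.rpow_add hb]; congr 1; rw [he]; field_simp; ring
      have hX : 0 < gbase γ x ^ (e - 1) := Real.rpow_pos_of_pos hb _
      have e2 : Hq γ x * rhoF γ (x ^ 2) = ((γ + 1) / 2 * x ^ 2 - 1) * gbase γ x ^ (e - 1) := by
        rw [← e1, rhoF_sq, Hq]; ring
      rw [e2]
      have e3 : -((γ - 1) * x) * e = x := by rw [he]; field_simp
      rw [e3, neg_neg]
      have : k * x ≤ ((γ + 1) / 2 * x ^ 2 - 1) / x := by
        rw [le_div_iff₀ hx0]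
        have : 1 / x ^ 2 ≤ 1 / q1 ^ 2 := by
          apply one_div_le_one_div_of_le (by positivity)
          nlinarith [hx.1]
        have h4 : 1 / x ^ 2 * x ^ 2 = 1 := by field_simp
        nlinarith [sq_nonneg x]
      have := mul_le_mul_of_nonneg_right this hX.le
      calc (0:ℝ) ≤ ((γ + 1) / 2 * x ^ 2 - 1) / x * gbase γ x ^ (e - 1) - k * x * gbase γ x ^ (e - 1) := by linarith
        _ = _ := by ring
  have ht : Tendsto (fun q => gbase γ q ^ e) (nhdsWithin (qmaxF γ) (Iio (qmaxF γ))) atTop := by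
    have hmax : gbase γ (qmaxF γ) = 0 := by
      unfold gbase qmaxF
      rw [Real.sq_sqrt (by apply div_nonneg <;> linarith)]; field_simp; simp
    have t1 : Tendsto (gbase γ) (nhdsWithin (qmaxF γ) (Iio (qmaxF γ))) (nhdsWithin 0 (Ioi 0)) := by
      apply tendsto_nhdsWithin_of_tendsto_nhds_of_eventually_within
      · have := (hasDerivAt_gbase γ (qmaxF γ)).continuousAt.tendsto
        rw [hmax] at this
        exact this.mono_left nhdsWithin_le_nhds
      · have : Ioo 0 (qmaxF γ) ∈ nhdsWithin (qmaxF γ) (Iio (qmaxF γ)) :=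
          Ioo_mem_nhdsLT (hc.trans (cstar_lt_qmax hγ))
        filter_upwards [this] with x hx
        exact gbase_pos hγ hx.1 hx.2
    have hneg : e < 0 := by rw [he]; simp; linarith
    exact (tendsto_rpow_neg_nhdsGT_zero hneg).comp t1
  have hev := (ht.eventually_gt_atTop ((-s - (-Afun γ q1 - k * gbase γ q1 ^ e)) / k)).and
    (Ioo_mem_nhdsLT h1' : Ioo q1 (qmaxF γ) ∈ nhdsWithin (qmaxF γ) (Iio (qmaxF γ)))
  obtain ⟨q, hq, hq'⟩ := hev.exists
  refine ⟨q, ⟨h1.trans hq'.1, hq'.2⟩, ?_⟩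
  have := hm ⟨le_rfl, h1'⟩ ⟨hq'.1.le, hq'.2⟩ hq'.1.le
  simp only at this
  rw [div_lt_iff₀ hkpos] at hq
  linarith

lemma AplusInv_spec {γ s : ℝ} (hγ : 1 < γ) (hs : s < 0) :
    AplusInv γ s ∈ Ioo (cstar γ) (qmaxF γ) ∧ Afun γ (AplusInv γ s) = s := by
  have hc := cstar_pos hγ
  obtain ⟨q, hq, hqs⟩ := Afun_unbdd hγ s
  have hco : ContinuousOn (Afun γ) (Icc (cstar γ) q) := by
    intro x hx
    exact (hasDerivAt_Afun hγ (hc.trans_le hx.1) (hx.2.trans_lt hq.2)).continuousAt.continuousWithinAt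
  have := intermediate_value_Icc' hq.1.le hco
  have hs' : s ∈ Icc (Afun γ q) (Afun γ (cstar γ)) := by rw [Afun_cstar]; exact ⟨hqs.le, hs.le⟩
  obtain ⟨x, hx, hxs⟩ := this hs'
  have hex : ∃ a ∈ Ico (cstar γ) (qmaxF γ), Afun γ a = s := ⟨x, ⟨hx.1, hx.2.trans_lt hq.2⟩, hxs⟩
  have h1 := Function.invFunOn_mem hex
  have h2 := Function.invFunOn_eq hex
  refine ⟨⟨lt_of_le_of_ne h1.1 ?_, h1.2⟩, h2⟩
  intro h
  have h3 : AplusInv γ s = cstar γ := h.symm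
  change Afun γ (AplusInv γ s) = s at h2
  rw [h3, Afun_cstar] at h2
  linarith

lemma AplusInv_anti {γ : ℝ} (hγ : 1 < γ) : StrictAntiOn (AplusInv γ) (Iio 0) := by
  intro s hs t ht hst
  obtain ⟨h1, h2⟩ := AplusInv_spec hγ hs
  obtain ⟨h3, h4⟩ := AplusInv_spec hγ ht
  by_contra hcon
  have := (Afun_strictAnti hγ).antitoneOn (Ioo_subset_Ico_self h1) (Ioo_subset_Ico_self h3)
    (not_lt.1 hcon)
  linarith

lemma hasDerivAt_AplusInv {γ s : ℝ} (hγ : 1 < γ) (hs : s < 0) :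
    HasDerivAt (AplusInv γ)
      (-(Hq γ (AplusInv γ s) * rhoF γ (AplusInv γ s ^ 2) / AplusInv γ s))⁻¹ s := by
  obtain ⟨h1, h2⟩ := AplusInv_spec hγ hs
  have hc := cstar_pos hγ
  have hq0 := hc.trans h1.1
  have hcont : ContinuousAt (AplusInv γ) s := by
    have hmono : StrictMonoOn (fun s => -AplusInv γ s) (Iio 0) := fun a ha b hb hab =>
      neg_lt_neg (AplusInv_anti hγ ha hb hab)
    have : ContinuousAt (fun s => -AplusInv γ s) s := by
      apply hmono.continuousAt_of_image_mem_nhds (Iio_mem_nhds hs)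
      apply Filter.mem_of_superset (Ioo_mem_nhds (neg_lt_neg h1.2) (neg_lt_neg h1.1))
      intro x hx
      have hx' : -x ∈ Ioo (cstar γ) (qmaxF γ) := ⟨by linarith [hx.2], by linarith [hx.1]⟩
      have hA : Afun γ (-x) < 0 := by
        rw [← Afun_cstar γ]
        exact Afun_strictAnti hγ ⟨le_rfl, cstar_lt_qmax hγ⟩ (Ioo_subset_Ico_self hx') hx'.1
      refine ⟨Afun γ (-x), hA, ?_⟩
      obtain ⟨h3, h4⟩ := AplusInv_spec hγ hA
      have := (Afun_strictAnti hγ).injOn (Ioo_subset_Ico_self h3) (Ioo_subset_Ico_self hx') h4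
      simp [this]
    have h5 := this.neg
    have h6 : (-fun s => -AplusInv γ s) = AplusInv γ := by ext x; simp
    rwa [h6] at h5
  apply HasDerivAt.of_local_left_inverse hcont (hasDerivAt_Afun hγ hq0 h1.2)
  · have := Hq_pos hγ h1.1 h1.2
    have := rho_pos hγ hq0 h1.2
    simp only [ne_eq, neg_eq_zero]
    positivity
  · filter_upwards [Iio_mem_nhds hs] with y hy
    exact (AplusInv_spec hγ hy).2

lemma bfun_eq {γ s : ℝ} (hγ : 1 < γ) (hs : s < 0) : bfun γ s = (Hq γ (AplusInv γ s))⁻¹ := by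
  obtain ⟨h1, h2⟩ := AplusInv_spec hγ hs
  have hc := cstar_pos hγ
  have hq0 := hc.trans h1.1
  have hH := Hq_pos hγ h1.1 h1.2
  have hr := rho_pos hγ hq0 h1.2
  have : HasDerivAt (Kfun γ) _ s :=
    HasDerivAt.comp s (hasDerivAt_Bfun hγ hq0 h1.2) (hasDerivAt_AplusInv hγ hs)
  unfold bfun
  rw [this.deriv]
  field_simp

lemma hasDerivAt_bfun {γ s : ℝ} (hγ : 1 < γ) (hs : s < 0) :
    HasDerivAt (bfun γ) (pfun γ s) s ∧ pfun γ s =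
      (γ + 1) * AplusInv γ s ^ 3 * gbase γ (AplusInv γ s) ^ (-((γ + 1) / (γ - 1)) - 1)
        * AplusInv γ s / (rhoF γ (AplusInv γ s ^ 2) * Hq γ (AplusInv γ s) ^ 3) := by
  obtain ⟨h1, h2⟩ := AplusInv_spec hγ hs
  have hc := cstar_pos hγ
  have hq0 := hc.trans h1.1
  have hH := Hq_pos hγ h1.1 h1.2
  have hr := rho_pos hγ hq0 h1.2
  have d1 := ((hasDerivAt_Hq hγ hq0 h1.2).comp s (hasDerivAt_AplusInv hγ hs)).inv hH.ne'
  have hev : bfun γ =ᶠ[nhds s] (Hq γ ∘ AplusInv γ)⁻¹ := by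
    filter_upwards [Iio_mem_nhds hs] with y hy
    exact bfun_eq hγ hy
  have d2 := d1.congr_of_eventuallyEq hev
  have e : pfun γ s = deriv (bfun γ) s := by
    unfold pfun
    have : bfun γ = -deriv (Kfun γ) := rfl
    rw [this, deriv.neg]
  constructor
  · rw [e]; exact d2.differentiableAt.hasDerivAt
  · rw [e, d2.deriv]
    simp only [Function.comp]
    field_simp

lemma bfun_pos {γ s : ℝ} (hγ : 1 < γ) (hs : s < 0) : 0 < bfun γ s := by
  rw [bfun_eq hγ hs]
  obtain ⟨h1, h2⟩ := AplusInv_spec hγ hs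
  exact inv_pos.2 (Hq_pos hγ h1.1 h1.2)

lemma b_bounds {γ μ : ℝ} (hγ : 1 < γ) (hμ : 0 < μ) : ∃ C : ℝ, 0 < C ∧ ∀ s ∈ Ico (-μ) 0,
    √(bfun γ s) ≤ C * (-s) ^ (-(1 / 4) : ℝ) ∧
    |(√(bfun γ s))⁻¹ * pfun γ s| ≤ C * (-s) ^ (-(5 / 4) : ℝ) := by
  have hc := cstar_pos hγ
  obtain ⟨hq1, hq2⟩ := AplusInv_spec hγ (neg_lt_zero.2 hμ)
  set qb := AplusInv γ (-μ)
  have hcont : ContinuousOn (fun q => (γ + 1) * q ^ 3 * gbase γ q ^ (-((γ + 1) / (γ - 1)) - 1)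
        * q / rhoF γ (q ^ 2)) (Icc (cstar γ) qb) := by
    intro q hq
    have h0 := hc.trans_le hq.1
    have h1 := hq.2.trans_lt hq1.2
    apply ContinuousAt.continuousWithinAt
    have := (hasDerivAt_gbase γ q).rpow_const (p := -((γ + 1) / (γ - 1)) - 1)
      (Or.inl (gbase_pos hγ h0 h1).ne')
    have c1 := this.continuousAt
    have c2 := continuousAt_rho hγ h0 h1
    refine ContinuousAt.div ?_ c2 (rho_pos hγ h0 h1).ne'
    fun_prop
  obtain ⟨C2, hC2⟩ := isCompact_Icc.exists_bound_of_continuousOn hcont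
  set D : ℝ := (γ + 1) / 8 with hD
  have hDpos : 0 < D := by rw [hD]; linarith
  have hHbound : ∀ s ∈ Ico (-μ) 0, ∀ e : ℝ, 0 ≤ e →
      Hq γ (AplusInv γ s) ^ (-e) ≤ D ^ (e / 2) * (-s) ^ (-(e / 2)) := by
    intro s hs e he
    obtain ⟨h1, h2⟩ := AplusInv_spec hγ hs.2
    have hH := Hq_pos hγ h1.1 h1.2
    have h3 := negA_le hγ (Ioo_subset_Ico_self h1)
    rw [h2] at h3
    have hs0 : 0 < -s := by linarith [hs.2]
    have h4 : (-s) ^ (e / 2) ≤ D ^ (e / 2) * Hq γ (AplusInv γ s) ^ e := by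
      calc (-s) ^ (e / 2) ≤ (D * Hq γ (AplusInv γ s) ^ 2) ^ (e / 2) :=
            Real.rpow_le_rpow hs0.le h3 (by linarith)
        _ = _ := by
            rw [Real.mul_rpow hDpos.le (by positivity), ← Real.rpow_natCast, ← Real.rpow_mul hH.le]
            congr 2; push_cast; ring
    rw [Real.rpow_neg hH.le, Real.rpow_neg hs0.le]
    have hHe : 0 < Hq γ (AplusInv γ s) ^ e := Real.rpow_pos_of_pos hH _
    have hse : 0 < (-s) ^ (e / 2) := Real.rpow_pos_of_pos hs0 _
    rw [inv_le_iff_one_le_mul₀ hHe, mul_assoc, ← div_eq_inv_mul, ← mul_div_assoc, le_div_iff₀ hse]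
    linarith
  have hC20 : 0 ≤ C2 := (norm_nonneg _).trans (hC2 (cstar γ) ⟨le_rfl, hq1.1.le⟩)
  refine ⟨D ^ (1 / 4 : ℝ) + C2 * D ^ (5 / 4 : ℝ), by positivity, ?_⟩
  intro s hs
  obtain ⟨h1, h2⟩ := AplusInv_spec hγ hs.2
  have hH := Hq_pos hγ h1.1 h1.2
  have hs0 : 0 < -s := by linarith [hs.2]
  have hsq : √(bfun γ s) = Hq γ (AplusInv γ s) ^ (-(1 / 2) : ℝ) := by
    rw [bfun_eq hγ hs.2, Real.sqrt_eq_rpow, Real.inv_rpow hH.le, ← Real.rpow_neg hH.le]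
  constructor
  · rw [hsq]
    have := hHbound s hs (1 / 2) (by norm_num)
    have e1 : (1 / 2 / 2 : ℝ) = 1 / 4 := by norm_num
    rw [e1] at this
    refine this.trans ?_
    have hp : 0 < (-s) ^ (-(1 / 4) : ℝ) := Real.rpow_pos_of_pos hs0 _
    apply mul_le_mul_of_nonneg_right _ hp.le
    have : 0 ≤ C2 * D ^ (5 / 4 : ℝ) := by positivity
    linarith
  · rw [(hasDerivAt_bfun hγ hs.2).2, hsq]
    have hmem : AplusInv γ s ∈ Icc (cstar γ) qb := by
      refine ⟨h1.1.le, ?_⟩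
      exact (AplusInv_anti hγ).antitoneOn (neg_lt_zero.2 hμ) hs.2 hs.1
    have hb := hC2 _ hmem
    have hr := rho_pos hγ (hc.trans h1.1) h1.2
    set Y := (γ + 1) * AplusInv γ s ^ 3 * gbase γ (AplusInv γ s) ^ (-((γ + 1) / (γ - 1)) - 1)
        * AplusInv γ s with hY
    have e2 : (Hq γ (AplusInv γ s) ^ (-(1 / 2) : ℝ))⁻¹ *
        (Y / (rhoF γ (AplusInv γ s ^ 2) * Hq γ (AplusInv γ s) ^ 3)) =
        Y / rhoF γ (AplusInv γ s ^ 2) * Hq γ (AplusInv γ s) ^ (-(5 / 2) : ℝ) := by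
      have : Hq γ (AplusInv γ s) ^ (-(5 / 2) : ℝ) = (Hq γ (AplusInv γ s) ^ (-(1 / 2) : ℝ))⁻¹ *
          (Hq γ (AplusInv γ s) ^ 3)⁻¹ := by
        rw [← Real.rpow_natCast, ← Real.rpow_neg hH.le, ← Real.rpow_neg hH.le, ← Real.rpow_add hH]
        congr 1; push_cast; norm_num
      rw [this]; field_simp
    rw [e2, abs_mul]
    have h5 := hHbound s hs (5 / 2) (by norm_num)
    have e1 : (5 / 2 / 2 : ℝ) = 5 / 4 := by norm_num
    rw [e1] at h5
    have hHp : 0 < Hq γ (AplusInv γ s) ^ (-(5 / 2) : ℝ) := Real.rpow_pos_of_pos hH _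
    rw [abs_of_pos hHp]
    have hp : 0 < (-s) ^ (-(5 / 4) : ℝ) := Real.rpow_pos_of_pos hs0 _
    calc |Y / rhoF γ (AplusInv γ s ^ 2)| * Hq γ (AplusInv γ s) ^ (-(5 / 2) : ℝ)
        ≤ C2 * (D ^ (5 / 4 : ℝ) * (-s) ^ (-(5 / 4) : ℝ)) := by
          apply mul_le_mul hb h5 hHp.le hC20
      _ ≤ _ := by
          have : 0 ≤ D ^ (1 / 4 : ℝ) * (-s) ^ (-(5 / 4) : ℝ) := by positivity
          nlinarith

/-! ### Duality lemma -/

lemma dual_exists {X : Type*} [MeasurableSpace X] (μ : Measure X) [IsFiniteMeasure μ]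
    {T : Type*} [AddCommGroup T] [Module ℝ T] (Λ : T → X → ℝ)
    (hadd : ∀ s t, Λ (s + t) =ᵐ[μ] Λ s + Λ t) (hsmul : ∀ (c : ℝ) t, Λ (c • t) =ᵐ[μ] c • Λ t)
    (hmem : ∀ t, MemLp (Λ t) 2 μ) (ℓ : T →ₗ[ℝ] ℝ) (C : ℝ) (hC : 0 ≤ C)
    (hb : ∀ t, |ℓ t| ≤ C * ∫ x, |Λ t x| ∂μ) :
    ∃ V : X → ℝ, Measurable V ∧ (∀ x, |V x| ≤ C) ∧ ∀ t, ∫ x, V x * Λ t x ∂μ = ℓ t := by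
  let L : T →ₗ[ℝ] Lp ℝ 2 μ :=
    { toFun := fun t => (hmem t).toLp
      map_add' := by
        intro s t
        rw [← MemLp.toLp_add]
        exact (MemLp.toLp_eq_toLp_iff _ _).2 (hadd s t)
      map_smul' := by
        intro c t
        simp only [RingHom.id_apply]
        rw [← MemLp.toLp_const_smul]
        exact (MemLp.toLp_eq_toLp_iff _ _).2 (hsmul c t) }
  have hL : ∀ t, (L t : X → ℝ) =ᵐ[μ] Λ t := fun t => (hmem t).coeFn_toLp
  obtain ⟨g, hg⟩ := L.rangeRestrict.exists_rightInverse_of_surjective L.range_rangeRestrict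
  have hgL : ∀ y : LinearMap.range L, L (g y) = y := by
    intro y
    have := congrArg (fun f => (f y : LinearMap.range L)) hg
    have := congrArg Subtype.val this
    simpa using this
  have hN : ∀ t, |ℓ t| ≤ C * ∫ x, |L t x| ∂μ := by
    intro t
    refine (hb t).trans (le_of_eq ?_)
    congr 1
    apply integral_congr_ae
    filter_upwards [hL t] with x hx
    rw [hx]
  have hker : ∀ t, L t = 0 → ℓ t = 0 := by
    intro t ht
    have := hN t
    rw [ht] at this
    have h0 : ∫ x, |(0 : Lp ℝ 2 μ) x| ∂μ = 0 := by
      rw [integral_congr_ae (g := fun _ => (0:ℝ))]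
      · simp
      · filter_upwards [Lp.coeFn_zero ℝ 2 μ] with x hx
        rw [hx]; simp
    rw [h0, mul_zero] at this
    exact abs_nonpos_iff.1 this
  have hintg : ∀ u : Lp ℝ 2 μ, Integrable (fun x => u x) μ := fun u =>
    (Lp.memLp u).integrable (by norm_num)
  obtain ⟨G, hG1, hG2⟩ := exists_extension_of_le_sublinear
    (⟨LinearMap.range L, ℓ ∘ₗ g⟩ : Lp ℝ 2 μ →ₗ.[ℝ] ℝ) (fun u => C * ∫ x, |u x| ∂μ)
    (by
      intro c hc u
      have : ∫ x, |(c • u) x| ∂μ = c * ∫ x, |u x| ∂μ := by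
        rw [← integral_const_mul]
        apply integral_congr_ae
        filter_upwards [Lp.coeFn_smul c u] with x hx
        rw [hx]; simp [abs_mul, abs_of_pos hc]
      simp only [this]; ring)
    (by
      intro u v
      rw [← mul_add, ← integral_add (hintg u).abs (hintg v).abs]
      apply mul_le_mul_of_nonneg_left _ hC
      apply integral_mono_ae (hintg _).abs ((hintg u).abs.add (hintg v).abs)
      filter_upwards [Lp.coeFn_add u v] with x hx
      rw [hx]; exact abs_add_le _ _)
    (by
      intro y
      change ℓ (g y) ≤ C * ∫ x, |(y : Lp ℝ 2 μ) x| ∂μ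
      have := hN (g y)
      rw [hgL] at this
      exact (le_abs_self _).trans this)
  have hGL : ∀ t, G (L t) = ℓ t := by
    intro t
    have h1 := hG1 ⟨L t, ⟨t, rfl⟩⟩
    change G (L t) = ℓ (g ⟨L t, ⟨t, rfl⟩⟩) at h1
    rw [h1]
    have h2 : ℓ (g ⟨L t, ⟨t, rfl⟩⟩ - t) = 0 := hker _ (by rw [map_sub, hgL]; simp)
    rw [map_sub] at h2
    linarith
  have hGabs : ∀ u, |G u| ≤ C * ∫ x, |u x| ∂μ := by
    intro u
    rw [abs_le]
    refine ⟨?_, hG2 u⟩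
    have := hG2 (-u)
    have h2 : ∫ x, |(-u : Lp ℝ 2 μ) x| ∂μ = ∫ x, |u x| ∂μ := by
      apply integral_congr_ae
      filter_upwards [Lp.coeFn_neg u] with x hx
      rw [hx]; simp
    rw [map_neg, h2] at this
    linarith
  let one : Lp ℝ 2 μ := indicatorConstLp 2 MeasurableSet.univ (measure_ne_top μ _) (1:ℝ)
  have hL1 : ∀ u : Lp ℝ 2 μ, ∫ x, |u x| ∂μ ≤ ‖one‖ * ‖u‖ := by
    intro u
    have h1 : inner ℝ one |u| = ∫ x, |u| x ∂μ := by
      have := L2.inner_indicatorConstLp_one (𝕜 := ℝ) MeasurableSet.univ (measure_ne_top μ _) |u|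
      rw [setIntegral_univ] at this
      exact this
    have h2 : ∫ x, |u| x ∂μ = ∫ x, |u x| ∂μ := by
      apply integral_congr_ae
      exact Lp.coeFn_abs u
    rw [← h2, ← h1, ← norm_abs_eq_norm u]
    exact real_inner_le_norm _ _
  let Gc : Lp ℝ 2 μ →L[ℝ] ℝ := G.mkContinuous (C * ‖one‖) (by
    intro u
    rw [Real.norm_eq_abs, mul_assoc]
    exact (hGabs u).trans (mul_le_mul_of_nonneg_left (hL1 u) hC))
  let v : Lp ℝ 2 μ := (InnerProductSpace.toDual ℝ (Lp ℝ 2 μ)).symm Gc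
  have hv : ∀ u, inner ℝ v u = G u := by
    intro u
    have := InnerProductSpace.toDual_symm_apply (𝕜 := ℝ) (x := u) (y := Gc)
    exact this
  have hset : ∀ s, MeasurableSet s → |∫ x in s, v x ∂μ| ≤ C * μ.real s := by
    intro s hs
    have h1 := L2.inner_indicatorConstLp_one (𝕜 := ℝ) hs (measure_ne_top μ _) v
    rw [← h1, real_inner_comm, hv]
    refine (hGabs _).trans (le_of_eq ?_)
    congr 1
    have : ∫ x, |(indicatorConstLp 2 hs (measure_ne_top μ s) (1:ℝ) : Lp ℝ 2 μ) x| ∂μ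
        = ∫ x, s.indicator (fun _ => (1:ℝ)) x ∂μ := by
      apply integral_congr_ae
      filter_upwards [indicatorConstLp_coeFn (p := 2) (hs := hs) (hμs := measure_ne_top μ s)
        (c := (1:ℝ))] with x hx
      rw [hx]
      by_cases h : x ∈ s <;> simp [h]
    rw [this, integral_indicator hs]
    simp
  have hle : ∀ᵐ x ∂μ, v x ≤ C := by
    apply ae_le_of_forall_setIntegral_le (hintg v) (integrable_const C)
    intro s hs _
    have := (abs_le.1 (hset s hs)).2
    rw [setIntegral_const, smul_eq_mul, mul_comm]
    exact this
  have hge : ∀ᵐ x ∂μ, -C ≤ v x := by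
    apply ae_le_of_forall_setIntegral_le (integrable_const (-C)) (hintg v)
    intro s hs _
    have := (abs_le.1 (hset s hs)).1
    rw [setIntegral_const, smul_eq_mul, mul_comm]
    linarith
  refine ⟨fun x => max (-C) (min C (v x)), ?_, ?_, ?_⟩
  · exact measurable_const.max (measurable_const.min (Lp.stronglyMeasurable v).measurable)
  · intro x
    rw [abs_le]
    exact ⟨le_max_left _ _, max_le (by linarith) (min_le_left _ _)⟩
  · intro t
    rw [← hGL, ← hv, L2.inner_def]
    apply integral_congr_ae
    filter_upwards [hL t, hle, hge] with x h1 h2 h3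
    rw [min_eq_right h2, max_eq_right h3, h1]
    simp [mul_comm]

/-! ### Calculus helpers -/

/-- a sign function -/
def sg (x : ℝ) : ℝ := x * |x|⁻¹

lemma sg_mul_self (x : ℝ) : sg x * x = |x| := by
  unfold sg
  rcases eq_or_ne x 0 with h | h
  · simp [h]
  · have : |x| ≠ 0 := abs_ne_zero.2 h
    field_simp
    exact (sq_abs x).symm

lemma abs_sg_le (x : ℝ) : |sg x| ≤ 1 := by
  unfold sg
  rw [abs_mul, abs_inv, abs_abs]
  exact mul_inv_le_one

lemma sg_pos_mul {c x : ℝ} (hc : 0 < c) : sg (c * x) = sg x := by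
  unfold sg
  rw [abs_mul, abs_of_pos hc]
  field_simp

lemma measurable_sg : Measurable sg := by unfold sg; fun_prop

lemma deriv_abs_comp {f : ℝ → ℝ} {x : ℝ} (hf : DifferentiableAt ℝ f x) :
    deriv (fun y => |f y|) x = sg (f x) * deriv f x := by
  rcases eq_or_ne (f x) 0 with h | h
  · have : IsLocalMin (fun y => |f y|) x := by
      apply Filter.Eventually.of_forall
      intro y; simp [h]
    rw [this.deriv_eq_zero, h]; simp [sg]
  · rcases lt_or_gt_of_ne h with h' | h'
    · have : (fun y => |f y|) =ᶠ[nhds x] fun y => - f y := by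
        filter_upwards [hf.continuousAt.eventually_lt_const h'] with y hy
        exact abs_of_neg hy
      rw [this.deriv_eq, deriv.fun_neg]
      have : sg (f x) = -1 := by unfold sg; rw [abs_of_neg h']; field_simp
      rw [this]; ring
    · have : (fun y => |f y|) =ᶠ[nhds x] fun y => f y := by
        filter_upwards [hf.continuousAt.eventually_const_lt h'] with y hy
        exact abs_of_pos hy
      rw [this.deriv_eq]
      have : sg (f x) = 1 := by unfold sg; rw [abs_of_pos h']; field_simp
      rw [this]; ring

lemma ac_abs {f : ℝ → ℝ} {a b : ℝ} (hf : AbsolutelyContinuousOnInterval f a b) :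
    AbsolutelyContinuousOnInterval (fun x => |f x|) a b := by
  rw [absolutelyContinuousOnInterval_iff] at hf ⊢
  intro ε hε
  obtain ⟨δ, hδ, h⟩ := hf ε hε
  refine ⟨δ, hδ, fun E hE hE2 => lt_of_le_of_lt ?_ (h E hE hE2)⟩
  apply Finset.sum_le_sum
  intro i _
  rw [Real.dist_eq, Real.dist_eq]
  exact abs_abs_sub_abs_le_abs_sub _ _

lemma abs_ftc {f g : ℝ → ℝ} {a b : ℝ} (hab : a ≤ b) (hf : AbsolutelyContinuousOnInterval f a b)
    (hg : ∀ᵐ x ∂(volume.restrict (Ioo a b)), HasDerivAt f (g x) x) :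
    ∫ x in Ioo a b, sg (f x) * g x = |f b| - |f a| := by
  rw [← (ac_abs hf).integral_deriv_eq_sub, intervalIntegral.integral_of_le hab,
    integral_Ioc_eq_integral_Ioo]
  apply integral_congr_ae
  filter_upwards [hg] with x hx
  rw [deriv_abs_comp hx.differentiableAt, hx.deriv]

lemma pdx_hasDerivAt {ξ : ℝ × ℝ → ℝ} (h : ContDiff ℝ 1 ξ) (p : ℝ × ℝ) :
    HasDerivAt (fun x => ξ (x, p.2)) (pdx ξ p) p.1 := by
  have hd : DifferentiableAt ℝ (fun x => ξ (x, p.2)) p.1 := by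
    have := h.differentiable (by norm_num)
    fun_prop
  exact hd.hasDerivAt

lemma pdy_hasDerivAt {ξ : ℝ × ℝ → ℝ} (h : ContDiff ℝ 1 ξ) (p : ℝ × ℝ) :
    HasDerivAt (fun y => ξ (p.1, y)) (pdy ξ p) p.2 := by
  have hd : DifferentiableAt ℝ (fun y => ξ (p.1, y)) p.2 := by
    have := h.differentiable (by norm_num)
    fun_prop
  exact hd.hasDerivAt

lemma pdx_continuous {ξ : ℝ × ℝ → ℝ} (h : ContDiff ℝ 1 ξ) : Continuous (pdx ξ) := by
  have e : pdx ξ = fun p => fderiv ℝ ξ p (1, 0) := by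
    ext p
    have h1 : HasDerivAt (fun x : ℝ => (x, p.2)) ((1 : ℝ), (0 : ℝ)) p.1 :=
      (hasDerivAt_id p.1).prodMk (hasDerivAt_const _ _)
    have h2 : HasFDerivAt ξ (fderiv ℝ ξ p) (p.1, p.2) :=
      (h.differentiable (by norm_num) p).hasFDerivAt
    exact (h2.comp_hasDerivAt p.1 h1).deriv
  rw [e]
  exact (h.continuous_fderiv (by norm_num)).clm_apply continuous_const

lemma pdy_continuous {ξ : ℝ × ℝ → ℝ} (h : ContDiff ℝ 1 ξ) : Continuous (pdy ξ) := by
  have e : pdy ξ = fun p => fderiv ℝ ξ p (0, 1) := by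
    ext p
    have h1 : HasDerivAt (fun y : ℝ => (p.1, y)) ((0 : ℝ), (1 : ℝ)) p.2 :=
      (hasDerivAt_const _ _).prodMk (hasDerivAt_id p.2)
    have h2 : HasFDerivAt ξ (fderiv ℝ ξ p) (p.1, p.2) :=
      (h.differentiable (by norm_num) p).hasFDerivAt
    exact (h2.comp_hasDerivAt p.2 h1).deriv
  rw [e]
  exact (h.continuous_fderiv (by norm_num)).clm_apply continuous_const

lemma bdd_rect {ξ : ℝ × ℝ → ℝ} (h : Continuous ξ) (ζ m : ℝ) :
    ∃ B, 0 ≤ B ∧ ∀ p ∈ Icc (0 : ℝ) ζ ×ˢ Icc (0 : ℝ) m, |ξ p| ≤ B := by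
  obtain ⟨B, hB⟩ := (isCompact_Icc.prod isCompact_Icc).exists_bound_of_continuousOn
    (h.continuousOn (s := Icc (0 : ℝ) ζ ×ˢ Icc (0 : ℝ) m))
  exact ⟨max B 0, le_max_right _ _, fun p hp => (hB p hp).trans (le_max_left _ _)⟩

lemma restrict_rect (ζ m : ℝ) : (volume.restrict (Ioo (0 : ℝ) ζ ×ˢ Ioo (0 : ℝ) m) : Measure (ℝ × ℝ))
    = (volume.restrict (Ioo (0 : ℝ) ζ)).prod (volume.restrict (Ioo (0 : ℝ) m)) := by
  rw [Measure.prod_restrict]; rfl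

instance finite_rect (ζ m : ℝ) :
    IsFiniteMeasure (volume.restrict (Ioo (0 : ℝ) ζ ×ˢ Ioo (0 : ℝ) m) : Measure (ℝ × ℝ)) := by
  rw [restrict_rect]; infer_instance

lemma int_of_bdd {X : Type*} [MeasurableSpace X] {μ : Measure X} [IsFiniteMeasure μ] {f : X → ℝ}
    (hm : AEMeasurable f μ) (B : ℝ) (hB : ∀ᵐ p ∂μ, |f p| ≤ B) : Integrable f μ :=
  Integrable.of_bound hm.aestronglyMeasurable B hB

/-- The abstract data of the singular characteristic system. -/
structure CharData (ζ m lam c0 C : ℝ) (c d αW αZ : ℝ × ℝ → ℝ) : Prop where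
  hc : AEMeasurable c (volume.restrict (Ioo (0 : ℝ) ζ ×ˢ Ioo (0 : ℝ) m))
  hd : AEMeasurable d (volume.restrict (Ioo (0 : ℝ) ζ ×ˢ Ioo (0 : ℝ) m))
  haW : AEMeasurable αW (volume.restrict (Ioo (0 : ℝ) ζ ×ˢ Ioo (0 : ℝ) m))
  haZ : AEMeasurable αZ (volume.restrict (Ioo (0 : ℝ) ζ ×ˢ Ioo (0 : ℝ) m))
  C0 : 0 < C
  lip : ∀ᵐ φ ∂(volume.restrict (Ioo (0 : ℝ) ζ)), ∀ x ∈ Icc (0 : ℝ) m, ∀ y ∈ Icc (0 : ℝ) m,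
    |c (φ, x) - c (φ, y)| ≤ C * φ ^ (lam / 4 - 3 / 2) * |x - y|
  bd : ∀ φ ∈ Ioo (0 : ℝ) ζ, ∀ x ∈ Icc (0 : ℝ) m,
    0 < c (φ, x) ∧ c (φ, x) ≤ C * φ ^ (-((lam + 2) / 4))
  der : ∀ᵐ p ∂(volume.restrict (Ioo (0 : ℝ) ζ ×ˢ Ioo (0 : ℝ) m)),
    HasDerivAt (fun y => c (p.1, y)) (d p) p.2
  aWb : ∀ᵐ p ∂(volume.restrict (Ioo (0 : ℝ) ζ ×ˢ Ioo (0 : ℝ) m)), 0 ≤ αW p ∧ αW p ≤ c0 / p.1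
  aZb : ∀ᵐ p ∂(volume.restrict (Ioo (0 : ℝ) ζ ×ˢ Ioo (0 : ℝ) m)), 0 ≤ αZ p ∧ αZ p ≤ c0 / p.1

lemma ae_rect {ζ m : ℝ} : ∀ᵐ p ∂(volume.restrict (Ioo (0 : ℝ) ζ ×ˢ Ioo (0 : ℝ) m)),
    p ∈ Ioo (0 : ℝ) ζ ×ˢ Ioo (0 : ℝ) m :=
  ae_restrict_mem (measurableSet_Ioo.prod measurableSet_Ioo)

lemma ae_rect_of_fst {ζ m : ℝ} {P : ℝ → Prop} (h : ∀ᵐ φ ∂(volume.restrict (Ioo (0 : ℝ) ζ)), P φ) :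
    ∀ᵐ p ∂(volume.restrict (Ioo (0 : ℝ) ζ ×ˢ Ioo (0 : ℝ) m)), P p.1 := by
  rw [restrict_rect]
  exact Measure.quasiMeasurePreserving_fst.ae h

lemma ae_ae_rect {ζ m : ℝ} {P : ℝ × ℝ → Prop}
    (h : ∀ᵐ p ∂(volume.restrict (Ioo (0 : ℝ) ζ ×ˢ Ioo (0 : ℝ) m)), P p) :
    ∀ᵐ φ ∂(volume.restrict (Ioo (0 : ℝ) ζ)), ∀ᵐ ψ ∂(volume.restrict (Ioo (0 : ℝ) m)), P (φ, ψ) := by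
  rw [restrict_rect] at h
  exact Measure.ae_ae_of_ae_prod h

lemma abs_deriv_le {f : ℝ → ℝ} {f' x L : ℝ} {s : Set ℝ} (hs : s ∈ nhds x) (hf : HasDerivAt f f' x)
    (hL : ∀ y ∈ s, |f y - f x| ≤ L * |y - x|) (h0 : 0 ≤ L) : |f'| ≤ L := by
  have := hf.hasFDerivAt.le_of_lip' (C := L) h0 (by
    filter_upwards [hs] with y hy
    exact hL y hy)
  simpa using this

lemma CharData.d_le {ζ m lam c0 C : ℝ} {c d αW αZ : ℝ × ℝ → ℝ}
    (D : CharData ζ m lam c0 C c d αW αZ) :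
    ∀ᵐ p ∂(volume.restrict (Ioo (0 : ℝ) ζ ×ˢ Ioo (0 : ℝ) m)),
      |d p| ≤ C * p.1 ^ (lam / 4 - 3 / 2) := by
  filter_upwards [ae_rect, ae_rect_of_fst D.lip, D.der] with p hp h1 h2
  have hC := D.C0
  have h3 : 0 < p.1 ^ (lam / 4 - 3 / 2) := Real.rpow_pos_of_pos hp.1.1 _
  refine abs_deriv_le (Icc_mem_nhds hp.2.1 hp.2.2) h2 (fun y hy => ?_) (by positivity)
  exact h1 y hy p.2 (Ioo_subset_Icc_self hp.2)

/-! ### Existence -/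

/-- Lebesgue measure on the rectangle. -/
abbrev muR (ζ m : ℝ) : Measure (ℝ × ℝ) := volume.restrict (Ioo (0 : ℝ) ζ ×ˢ Ioo (0 : ℝ) m)

lemma int_mul_cont {ζ m : ℝ} {f g : ℝ × ℝ → ℝ} (hf : AEMeasurable f (muR ζ m)) (A : ℝ)
    (hA : ∀ᵐ p ∂(muR ζ m), |f p| ≤ A) (hg : Continuous g) :
    Integrable (fun p => f p * g p) (muR ζ m) := by
  obtain ⟨B, hB0, hB⟩ := bdd_rect hg ζ m
  refine int_of_bdd (hf.mul hg.measurable.aemeasurable) (A * B) ?_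
  filter_upwards [hA, ae_rect] with p h1 h2
  rw [abs_mul]
  have h3 := hB p ⟨Ioo_subset_Icc_self h2.1, Ioo_subset_Icc_self h2.2⟩
  have := abs_nonneg (f p)
  gcongr
  linarith

lemma int_sg_mul {X : Type*} [MeasurableSpace X] {μ : Measure X} {f g : X → ℝ}
    (hf : Measurable f) (hg : Integrable g μ) : Integrable (fun p => sg (f p) * g p) μ := by
  refine hg.bdd_mul (c := 1) (measurable_sg.comp hf).aestronglyMeasurable ?_
  exact Eventually.of_forall fun p => abs_sg_le _

lemma rpow_le_one' {x s : ℝ} (h0 : 0 < x) (h1 : x ≤ 1) (hs : 0 ≤ s) : x ^ s ≤ 1 :=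
  Real.rpow_le_one h0.le h1 hs

lemma est_phi {ζ m σ : ℝ} (hζ : 0 < ζ) (hζ1 : ζ ≤ 1) (hσ : 1 < σ) {ξ : ℝ × ℝ → ℝ}
    (hξ : ContDiff ℝ 1 ξ)
    (h0 : ∀ ψ ∈ Icc (0 : ℝ) m, ξ (ζ, ψ) = 0) :
    ∫ p, sg (ξ p) * (p.1 ^ σ * pdx ξ p) ∂(muR ζ m)
      = - ∫ p, σ * p.1 ^ (σ - 1) * |ξ p| ∂(muR ζ m) := by
  have hms : ∀ s : ℝ, Measurable (fun p : ℝ × ℝ => p.1 ^ s) := fun s => by fun_prop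
  have b1 : ∀ s : ℝ, 0 ≤ s → ∀ᵐ p ∂(muR ζ m), |p.1 ^ s| ≤ 1 := by
    intro s hs
    filter_upwards [ae_rect] with p hp
    rw [abs_of_pos (Real.rpow_pos_of_pos hp.1.1 _)]
    exact rpow_le_one' hp.1.1 (hp.1.2.le.trans hζ1) hs
  have i1 : Integrable (fun p => sg (ξ p) * (p.1 ^ σ * pdx ξ p)) (muR ζ m) :=
    int_sg_mul hξ.continuous.measurable
      (int_mul_cont (hms σ).aemeasurable 1 (b1 σ (by linarith)) (pdx_continuous hξ))
  have i2 : Integrable (fun p => σ * p.1 ^ (σ - 1) * |ξ p|) (muR ζ m) := by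
    have := (int_mul_cont (hms (σ-1)).aemeasurable 1 (b1 (σ-1) (by linarith))
      hξ.continuous.abs).const_mul σ
    simpa only [mul_assoc] using this
  rw [eq_neg_iff_add_eq_zero, ← integral_add i1 i2]
  have i3 := i1.add i2
  have e : ∫ p, (sg (ξ p) * (p.1 ^ σ * pdx ξ p) + σ * p.1 ^ (σ - 1) * |ξ p|) ∂(muR ζ m)
      = ∫ ψ in Ioo 0 m, ∫ φ in Ioo 0 ζ, (sg (ξ (φ, ψ)) * (φ ^ σ * pdx ξ (φ, ψ))
        + σ * φ ^ (σ - 1) * |ξ (φ, ψ)|) := by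
    rw [muR, restrict_rect] at i3 ⊢
    exact integral_prod_symm _ i3
  rw [e]
  apply integral_eq_zero_of_ae
  filter_upwards [ae_restrict_mem measurableSet_Ioo] with ψ hψ
  have hd : ∀ x : ℝ, HasDerivAt (fun x => x ^ σ * ξ (x, ψ))
      (σ * x ^ (σ - 1) * ξ (x, ψ) + x ^ σ * pdx ξ (x, ψ)) x := fun x =>
    (Real.hasDerivAt_rpow_const (Or.inr hσ.le)).mul (pdx_hasDerivAt hξ (x, ψ))
  have hC : ContDiff ℝ 1 (fun x => x ^ σ * ξ (x, ψ)) := by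
    have h1 : ContDiff ℝ 1 (fun x : ℝ => x ^ σ) :=
      Real.contDiff_rpow_const_of_le (by exact_mod_cast hσ.le)
    exact h1.mul (hξ.comp (contDiff_id.prodMk contDiff_const))
  have := abs_ftc hζ.le (hC.contDiffOn.absolutelyContinuousOnInterval)
    (Eventually.of_forall hd)
  rw [h0 ψ (Ioo_subset_Icc_self hψ), Real.zero_rpow (by linarith)] at this
  simp only [mul_zero, zero_mul, abs_zero, sub_zero] at this
  simp only [Pi.zero_apply]
  refine Eq.trans ?_ this
  apply setIntegral_congr_fun measurableSet_Ioo
  intro x hx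
  simp only
  rw [sg_pos_mul (Real.rpow_pos_of_pos hx.1 _), ← sg_mul_self]
  ring

lemma est_psi {ζ m lam c0 C : ℝ} {c d αW αZ : ℝ × ℝ → ℝ} (hm : 0 < m)
    (D : CharData ζ m lam c0 C c d αW αZ) {ξ : ℝ × ℝ → ℝ} (hξ : ContDiff ℝ 1 ξ) :
    ∀ᵐ φ ∂(volume.restrict (Ioo (0 : ℝ) ζ)),
      ∫ ψ in Ioo 0 m, sg (ξ (φ, ψ)) * (c (φ, ψ) * pdy ξ (φ, ψ) + d (φ, ψ) * ξ (φ, ψ))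
        = c (φ, m) * |ξ (φ, m)| - c (φ, 0) * |ξ (φ, 0)| := by
  filter_upwards [D.lip, ae_restrict_mem measurableSet_Ioo, ae_ae_rect D.der] with φ hl hφ hd
  have hC := D.C0
  have h3 : 0 < φ ^ (lam / 4 - 3 / 2) := Real.rpow_pos_of_pos hφ.1 _
  have hL : LipschitzOnWith (Real.toNNReal (C * φ ^ (lam / 4 - 3 / 2))) (fun ψ => c (φ, ψ))
      (uIcc 0 m) := by
    rw [uIcc_of_le hm.le]
    apply LipschitzOnWith.of_dist_le_mul
    intro x hx y hy
    rw [Real.dist_eq, Real.dist_eq, Real.coe_toNNReal _ (by positivity)]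
    exact hl x hx y hy
  have hxi : ContDiff ℝ 1 (fun ψ => ξ (φ, ψ)) := hξ.comp (contDiff_const.prodMk contDiff_id)
  have ac := hL.absolutelyContinuousOnInterval.fun_mul
    (hxi.contDiffOn.absolutelyContinuousOnInterval)
  have hder : ∀ᵐ ψ ∂(volume.restrict (Ioo (0 : ℝ) m)),
      HasDerivAt (fun ψ => c (φ, ψ) * ξ (φ, ψ))
        (d (φ, ψ) * ξ (φ, ψ) + c (φ, ψ) * pdy ξ (φ, ψ)) ψ := by
    filter_upwards [hd] with ψ h
    exact h.mul (pdy_hasDerivAt hξ (φ, ψ))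
  have := abs_ftc hm.le ac hder
  rw [abs_mul, abs_mul, abs_of_pos (D.bd φ hφ m ⟨hm.le, le_rfl⟩).1,
    abs_of_pos (D.bd φ hφ 0 ⟨le_rfl, hm.le⟩).1] at this
  rw [← this]
  apply setIntegral_congr_fun measurableSet_Ioo
  intro ψ hψ
  simp only
  rw [sg_pos_mul (D.bd φ hφ ψ (Ioo_subset_Icc_self hψ)).1]
  ring

/-- weighted coefficient bounds -/
lemma CharData.weights {ζ m lam c0 C : ℝ} {c d αW αZ : ℝ × ℝ → ℝ} (hlam : 2 < lam)
    (hζ1 : ζ ≤ 1) (D : CharData ζ m lam c0 C c d αW αZ) :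
    ∀ᵐ p ∂(muR ζ m), |p.1 ^ (5 * lam / 4 + 1 / 2)| ≤ 1 ∧
      |p.1 ^ (5 * lam / 4 + 1 / 2) * c p| ≤ C ∧ |p.1 ^ (5 * lam / 4 + 1 / 2) * d p| ≤ C ∧
      |p.1 ^ (5 * lam / 4 + 1 / 2) * αW p| ≤ c0 ∧ |p.1 ^ (5 * lam / 4 + 1 / 2) * αZ p| ≤ c0 := by
  filter_upwards [ae_rect, D.d_le, D.aWb, D.aZb] with p hp h1 h2 h3
  obtain ⟨⟨hp0, hp1⟩, hp2⟩ := hp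
  have hp1' : p.1 ≤ 1 := hp1.le.trans hζ1
  have hC := D.C0
  have hP : 0 < p.1 ^ (5 * lam / 4 + 1 / 2) := Real.rpow_pos_of_pos hp0 _
  have hb := D.bd p.1 ⟨hp0, hp1⟩ p.2 (Ioo_subset_Icc_self hp2)
  have hmul : ∀ s : ℝ, 0 ≤ (5 * lam / 4 + 1 / 2) + s →
      p.1 ^ (5 * lam / 4 + 1 / 2) * p.1 ^ s ≤ 1 := by
    intro s hs
    rw [← Real.rpow_add hp0]
    exact rpow_le_one' hp0 hp1' hs
  have hα : ∀ a : ℝ, 0 ≤ a ∧ a ≤ c0 / p.1 → |p.1 ^ (5 * lam / 4 + 1 / 2) * a| ≤ c0 := by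
    intro a ha
    rw [abs_of_nonneg (mul_nonneg hP.le ha.1)]
    have hc0 : 0 ≤ c0 := by
      by_contra hneg
      exact absurd (ha.1.trans ha.2) (not_le.2 (div_neg_of_neg_of_pos (not_le.1 hneg) hp0))
    calc _ ≤ p.1 ^ (5 * lam / 4 + 1 / 2) * (c0 * p.1 ^ (-1 : ℝ)) := by
          rw [Real.rpow_neg_one, ← div_eq_mul_inv]; gcongr; exact ha.2
      _ = c0 * (p.1 ^ (5 * lam / 4 + 1 / 2) * p.1 ^ (-1 : ℝ)) := by ring
      _ ≤ c0 * 1 := by gcongr; exact hmul _ (by linarith)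
      _ = c0 := mul_one _
  refine ⟨?_, ?_, ?_, hα _ h2, hα _ h3⟩
  · rw [abs_of_pos hP]; exact rpow_le_one' hp0 hp1' (by linarith)
  · rw [abs_of_pos (mul_pos hP hb.1)]
    calc _ ≤ p.1 ^ (5 * lam / 4 + 1 / 2) * (C * p.1 ^ (-((lam + 2) / 4))) := by gcongr; exact hb.2
      _ = C * (p.1 ^ (5 * lam / 4 + 1 / 2) * p.1 ^ (-((lam + 2) / 4))) := by ring
      _ ≤ C * 1 := by gcongr; exact hmul _ (by linarith)
      _ = C := mul_one _
  · rw [abs_mul, abs_of_pos hP]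
    calc _ ≤ p.1 ^ (5 * lam / 4 + 1 / 2) * (C * p.1 ^ (lam / 4 - 3 / 2)) := by gcongr
      _ = C * (p.1 ^ (5 * lam / 4 + 1 / 2) * p.1 ^ (lam / 4 - 3 / 2)) := by ring
      _ ≤ C * 1 := by gcongr; exact hmul _ (by linarith)
      _ = C := mul_one _

/-- The space of admissible test pairs. -/
def testPairs (ζ m : ℝ) : Submodule ℝ ((ℝ × ℝ → ℝ) × (ℝ × ℝ → ℝ)) where
  carrier := {t | ContDiff ℝ 1 t.1 ∧ ContDiff ℝ 1 t.2 ∧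
    (∀ ψ ∈ Icc (0 : ℝ) m, t.1 (ζ, ψ) = 0 ∧ t.2 (ζ, ψ) = 0) ∧
    (∀ φ ∈ Icc (0 : ℝ) ζ, t.1 (φ, 0) = -t.2 (φ, 0) ∧ t.1 (φ, m) = -t.2 (φ, m))}
  zero_mem' := by
    refine ⟨contDiff_const, contDiff_const, ?_, ?_⟩ <;> simp
  add_mem' := by
    rintro s t ⟨a1, a2, a3, a4⟩ ⟨b1, b2, b3, b4⟩
    refine ⟨a1.add b1, a2.add b2, fun ψ hψ => ?_, fun φ hφ => ?_⟩
    · simp [a3 ψ hψ, b3 ψ hψ]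
    · simp only [Prod.fst_add, Prod.snd_add, Pi.add_apply, (a4 φ hφ).1, (b4 φ hφ).1,
        (a4 φ hφ).2, (b4 φ hφ).2]
      constructor <;> ring
  smul_mem' := by
    rintro r t ⟨a1, a2, a3, a4⟩
    refine ⟨contDiff_const.smul a1, contDiff_const.smul a2, fun ψ hψ => ?_, fun φ hφ => ?_⟩
    · simp [a3 ψ hψ]
    · simp [(a4 φ hφ).1, (a4 φ hφ).2]

/-- weighted adjoint operators (sign `s = ±1`) -/
def Lw (lam s : ℝ) (c d α : ℝ × ℝ → ℝ) (ξ : ℝ × ℝ → ℝ) (p : ℝ × ℝ) : ℝ :=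
  p.1 ^ (5 * lam / 4 + 1 / 2) * pdx ξ p + s * ((p.1 ^ (5 * lam / 4 + 1 / 2) * c p) * pdy ξ p
    + (p.1 ^ (5 * lam / 4 + 1 / 2) * d p) * ξ p) - (p.1 ^ (5 * lam / 4 + 1 / 2) * α p) * ξ p

section exist
variable {ζ m lam c0 C : ℝ} {c d αW αZ : ℝ × ℝ → ℝ}

lemma CharData.swap (D : CharData ζ m lam c0 C c d αW αZ) : CharData ζ m lam c0 C c d αZ αW :=
  ⟨D.hc, D.hd, D.haZ, D.haW, D.C0, D.lip, D.bd, D.der, D.aZb, D.aWb⟩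

lemma meas_w (s : ℝ) : AEMeasurable (fun p : ℝ × ℝ => p.1 ^ s) (muR ζ m) := by
  have : Measurable (fun p : ℝ × ℝ => p.1 ^ s) := by fun_prop
  exact this.aemeasurable

lemma CharData.ints (hlam : 2 < lam) (hζ1 : ζ ≤ 1) (D : CharData ζ m lam c0 C c d αW αZ)
    {ξ : ℝ × ℝ → ℝ} (hξ : ContDiff ℝ 1 ξ) :
    Integrable (fun p => p.1 ^ (5 * lam / 4 + 1 / 2) * pdx ξ p) (muR ζ m) ∧
    Integrable (fun p => (p.1 ^ (5 * lam / 4 + 1 / 2) * c p) * pdy ξ p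
      + (p.1 ^ (5 * lam / 4 + 1 / 2) * d p) * ξ p) (muR ζ m) ∧
    Integrable (fun p => (p.1 ^ (5 * lam / 4 + 1 / 2) * αW p) * ξ p) (muR ζ m) := by
  have hw := D.weights hlam hζ1
  refine ⟨int_mul_cont (meas_w _) 1 (hw.mono fun p h => h.1) (pdx_continuous hξ),
    (int_mul_cont ((meas_w _).mul D.hc) C (hw.mono fun p h => h.2.1) (pdy_continuous hξ)).add
    (int_mul_cont ((meas_w _).mul D.hd) C (hw.mono fun p h => h.2.2.1) hξ.continuous),
    int_mul_cont ((meas_w _).mul D.haW) c0 (hw.mono fun p h => h.2.2.2.1) hξ.continuous⟩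

lemma CharData.Lw_int (hlam : 2 < lam) (hζ1 : ζ ≤ 1) (D : CharData ζ m lam c0 C c d αW αZ)
    {ξ : ℝ × ℝ → ℝ} (hξ : ContDiff ℝ 1 ξ) (s : ℝ) :
    Integrable (Lw lam s c d αW ξ) (muR ζ m) := by
  obtain ⟨h1, h2, h3⟩ := D.ints hlam hζ1 hξ
  exact (h1.add (h2.const_mul s)).sub h3

lemma CharData.Lw_memLp (hlam : 2 < lam) (hζ1 : ζ ≤ 1) (D : CharData ζ m lam c0 C c d αW αZ)
    {ξ : ℝ × ℝ → ℝ} (hξ : ContDiff ℝ 1 ξ) (s : ℝ) :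
    ∃ B, ∀ᵐ p ∂(muR ζ m), |Lw lam s c d αW ξ p| ≤ B := by
  obtain ⟨B1, hB10, hB1⟩ := bdd_rect (pdx_continuous hξ) ζ m
  obtain ⟨B2, hB20, hB2⟩ := bdd_rect (pdy_continuous hξ) ζ m
  obtain ⟨B3, hB30, hB3⟩ := bdd_rect hξ.continuous ζ m
  refine ⟨1 * B1 + |s| * (C * B2 + C * B3) + c0 * B3, ?_⟩
  have hC := D.C0
  filter_upwards [D.weights hlam hζ1, ae_rect] with p ⟨h1, h2, h3, h4, _⟩ hp
  have hp' : p ∈ Icc (0 : ℝ) ζ ×ˢ Icc (0 : ℝ) m :=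
    ⟨Ioo_subset_Icc_self hp.1, Ioo_subset_Icc_self hp.2⟩
  have hc0 : 0 ≤ c0 := (abs_nonneg _).trans h4
  unfold Lw
  refine (abs_sub _ _).trans (add_le_add ((abs_add_le _ _).trans (add_le_add ?_ ?_)) ?_)
  · rw [abs_mul]; gcongr; exact hB1 p hp'
  · rw [abs_mul]; gcongr
    refine (abs_add_le _ _).trans (add_le_add ?_ ?_)
    · rw [abs_mul]; gcongr; exact hB2 p hp'
    · rw [abs_mul]; gcongr; exact hB3 p hp'
  · rw [abs_mul]; gcongr; exact hB3 p hp'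

lemma CharData.low (hlam : 2 < lam) (hζ : 0 < ζ) (hζ1 : ζ ≤ 1) (hc0 : 0 < c0)
    (D : CharData ζ m lam c0 C c d αW αZ)
    {ξ : ℝ × ℝ → ℝ} (hξ : ContDiff ℝ 1 ξ) (h0 : ∀ ψ ∈ Icc (0 : ℝ) m, ξ (ζ, ψ) = 0) (s : ℝ) :
    ∫ p, (p.1 ^ (5 * lam / 4 + 1 / 2) * αW p) * |ξ p| ∂(muR ζ m)
      ≤ 4 * c0 / (5 * lam + 2 + 4 * c0) * ((∫ p, |Lw lam s c d αW ξ p| ∂(muR ζ m)) +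
        s * ∫ p, sg (ξ p) * ((p.1 ^ (5 * lam / 4 + 1 / 2) * c p) * pdy ξ p
          + (p.1 ^ (5 * lam / 4 + 1 / 2) * d p) * ξ p) ∂(muR ζ m)) := by
  obtain ⟨h1, h2, h3⟩ := D.ints hlam hζ1 hξ
  set σ := 5 * lam / 4 + 1 / 2 with hσ
  have hmξ := hξ.continuous.measurable
  have j1 := int_sg_mul hmξ h1
  have j2 := int_sg_mul hmξ h2
  have j3 : Integrable (fun p => (p.1 ^ σ * αW p) * |ξ p|) (muR ζ m) :=
    int_mul_cont ((meas_w _).mul D.haW) c0 ((D.weights hlam hζ1).mono fun p h => h.2.2.2.1)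
      hξ.continuous.abs
  have j4 : Integrable (fun p => σ * p.1 ^ (σ - 1) * |ξ p|) (muR ζ m) := by
    have : Integrable (fun p => p.1 ^ (σ - 1) * |ξ p|) (muR ζ m) := by
      refine int_mul_cont (meas_w _) 1 ?_ hξ.continuous.abs
      filter_upwards [ae_rect] with p hp
      rw [abs_of_pos (Real.rpow_pos_of_pos hp.1.1 _)]
      exact rpow_le_one' hp.1.1 (hp.1.2.le.trans hζ1) (by rw [hσ]; linarith)
    simpa only [mul_assoc] using this.const_mul σ
  have e1 := est_phi (m := m) hζ hζ1 (σ := σ) (by rw [hσ]; linarith) hξ h0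
  -- lower bound
  have l1 : ∫ p, (σ * p.1 ^ (σ - 1) * |ξ p| + (p.1 ^ σ * αW p) * |ξ p|) ∂(muR ζ m)
      ≤ (∫ p, |Lw lam s c d αW ξ p| ∂(muR ζ m)) +
        s * ∫ p, sg (ξ p) * ((p.1 ^ σ * c p) * pdy ξ p + (p.1 ^ σ * d p) * ξ p) ∂(muR ζ m) := by
    suffices q : ∫ p, ((-(sg (ξ p) * (p.1 ^ σ * pdx ξ p)) + (p.1 ^ σ * αW p) * |ξ p|)
        - s * (sg (ξ p) * ((p.1 ^ σ * c p) * pdy ξ p + (p.1 ^ σ * d p) * ξ p))) ∂(muR ζ m)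
        ≤ ∫ p, |Lw lam s c d αW ξ p| ∂(muR ζ m) by
      have q1 := integral_sub (j1.neg.add j3) (j2.const_mul s)
      have q2 := integral_add j1.neg j3
      simp only [Pi.add_apply, Pi.neg_apply] at q1 q2
      rw [q1, q2, integral_neg, e1, neg_neg, integral_const_mul] at q
      rw [integral_add j4 j3]
      linarith
    refine integral_mono ((j1.neg.add j3).sub (j2.const_mul s)) (D.Lw_int hlam hζ1 hξ s).abs ?_
    intro p
    have : -(sg (ξ p) * Lw lam s c d αW ξ p) ≤ |Lw lam s c d αW ξ p| := by
      refine (neg_le_abs _).trans ?_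
      rw [abs_mul]
      exact mul_le_of_le_one_left (abs_nonneg _) (abs_sg_le _)
    refine le_trans (le_of_eq ?_) this
    simp only [Lw, ← sg_mul_self]
    ring
  refine le_trans ?_ (mul_le_mul_of_nonneg_left l1 (by positivity))
  rw [← integral_const_mul]
  refine integral_mono_ae j3 ((j4.add j3).const_mul _) ?_
  filter_upwards [D.aWb, ae_rect] with p hp hr
  have hp0 := hr.1.1
  have : p.1 ^ σ = p.1 ^ (σ - 1) * p.1 := by
    rw [← Real.rpow_add_one hp0.ne']; congr 1; ring
  rw [this, ← add_mul, ← mul_assoc]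
  refine mul_le_mul_of_nonneg_right ?_ (abs_nonneg _)
  have hP : 0 < p.1 ^ (σ - 1) := Real.rpow_pos_of_pos hp0 _
  have ha : αW p * p.1 ≤ c0 := by
    have := hp.2; rwa [le_div_iff₀ hp0] at this
  have hden : 0 < 5 * lam + 2 + 4 * c0 := by positivity
  rw [div_mul_eq_mul_div, le_div_iff₀ hden]
  have : σ * 4 = 5 * lam + 2 := by rw [hσ]; ring
  have e2 := mul_le_mul_of_nonneg_left ha (mul_nonneg hP.le (by linarith : (0:ℝ) ≤ 5 * lam + 2))
  have e3 : c0 * (σ * 4) * p.1 ^ (σ - 1) = c0 * (5 * lam + 2) * p.1 ^ (σ - 1) := by rw [this]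
  linarith

lemma CharData.bal (hlam : 2 < lam) (hm : 0 < m) (hζ1 : ζ ≤ 1)
    (D : CharData ζ m lam c0 C c d αW αZ) {ξ η : ℝ × ℝ → ℝ} (hξ : ContDiff ℝ 1 ξ)
    (hη : ContDiff ℝ 1 η)
    (hb : ∀ φ ∈ Icc (0 : ℝ) ζ, ξ (φ, 0) = -η (φ, 0) ∧ ξ (φ, m) = -η (φ, m)) :
    ∫ p, sg (ξ p) * ((p.1 ^ (5 * lam / 4 + 1 / 2) * c p) * pdy ξ p
          + (p.1 ^ (5 * lam / 4 + 1 / 2) * d p) * ξ p) ∂(muR ζ m) =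
    ∫ p, sg (η p) * ((p.1 ^ (5 * lam / 4 + 1 / 2) * c p) * pdy η p
          + (p.1 ^ (5 * lam / 4 + 1 / 2) * d p) * η p) ∂(muR ζ m) := by
  have key : ∀ {ξ : ℝ × ℝ → ℝ}, ContDiff ℝ 1 ξ →
      ∫ p, sg (ξ p) * ((p.1 ^ (5 * lam / 4 + 1 / 2) * c p) * pdy ξ p
          + (p.1 ^ (5 * lam / 4 + 1 / 2) * d p) * ξ p) ∂(muR ζ m) =
      ∫ φ in Ioo 0 ζ, φ ^ (5 * lam / 4 + 1 / 2) *
        (c (φ, m) * |ξ (φ, m)| - c (φ, 0) * |ξ (φ, 0)|) := by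
    intro ξ hξ
    have j2 := int_sg_mul hξ.continuous.measurable (D.ints hlam hζ1 hξ).2.1
    rw [muR, restrict_rect] at j2 ⊢
    rw [integral_prod _ j2]
    apply integral_congr_ae
    filter_upwards [est_psi hm D hξ] with φ h
    rw [← h, ← integral_const_mul]
    congr 1
    ext ψ
    ring
  rw [key hξ, key hη]
  apply setIntegral_congr_fun measurableSet_Ioo
  intro φ hφ
  simp only
  rw [(hb φ (Ioo_subset_Icc_self hφ)).1, (hb φ (Ioo_subset_Icc_self hφ)).2, abs_neg, abs_neg]

end exist
section exist2
variable {ζ m lam c0 C : ℝ} {c d αW αZ : ℝ × ℝ → ℝ}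

lemma pdx_add {ξ η : ℝ × ℝ → ℝ} (hξ : ContDiff ℝ 1 ξ) (hη : ContDiff ℝ 1 η) (p : ℝ × ℝ) :
    pdx (ξ + η) p = pdx ξ p + pdx η p :=
  ((pdx_hasDerivAt hξ p).add (pdx_hasDerivAt hη p)).deriv

lemma pdy_add {ξ η : ℝ × ℝ → ℝ} (hξ : ContDiff ℝ 1 ξ) (hη : ContDiff ℝ 1 η) (p : ℝ × ℝ) :
    pdy (ξ + η) p = pdy ξ p + pdy η p :=
  ((pdy_hasDerivAt hξ p).add (pdy_hasDerivAt hη p)).deriv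

lemma pdx_smul {ξ : ℝ × ℝ → ℝ} (hξ : ContDiff ℝ 1 ξ) (r : ℝ) (p : ℝ × ℝ) :
    pdx (r • ξ) p = r * pdx ξ p :=
  ((pdx_hasDerivAt hξ p).const_mul r).deriv

lemma pdy_smul {ξ : ℝ × ℝ → ℝ} (hξ : ContDiff ℝ 1 ξ) (r : ℝ) (p : ℝ × ℝ) :
    pdy (r • ξ) p = r * pdy ξ p :=
  ((pdy_hasDerivAt hξ p).const_mul r).deriv

lemma memb_inl : MeasurableEmbedding (Sum.inl : ℝ × ℝ → (ℝ × ℝ) ⊕ (ℝ × ℝ)) :=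
  ⟨Sum.inl_injective, measurable_inl, fun _ h => measurableSet_inl_image.2 h⟩

lemma memb_inr : MeasurableEmbedding (Sum.inr : ℝ × ℝ → (ℝ × ℝ) ⊕ (ℝ × ℝ)) :=
  ⟨Sum.inr_injective, measurable_inr, fun _ h => measurableSet_inr_image.2 h⟩

/-- two copies of the rectangle -/
def nuR (ζ m : ℝ) : Measure ((ℝ × ℝ) ⊕ (ℝ × ℝ)) :=
  (muR ζ m).map Sum.inl + (muR ζ m).map Sum.inr

instance (ζ m : ℝ) : IsFiniteMeasure (nuR ζ m) := by unfold nuR; infer_instance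

lemma nuR_integrable {ζ m : ℝ} {f g : ℝ × ℝ → ℝ} (hf : Integrable f (muR ζ m))
    (hg : Integrable g (muR ζ m)) : Integrable (Sum.elim f g) (nuR ζ m) := by
  unfold nuR
  refine Integrable.add_measure ?_ ?_
  · rw [memb_inl.integrable_map_iff]; exact hf
  · rw [memb_inr.integrable_map_iff]; exact hg

lemma nuR_integral {ζ m : ℝ} {f g : ℝ × ℝ → ℝ} (hf : Integrable f (muR ζ m))
    (hg : Integrable g (muR ζ m)) : ∫ x, Sum.elim f g x ∂(nuR ζ m)
      = ∫ p, f p ∂(muR ζ m) + ∫ p, g p ∂(muR ζ m) := by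
  have h := nuR_integrable hf hg
  unfold nuR at h ⊢
  rw [integral_add_measure h.left_of_add_measure h.right_of_add_measure,
    memb_inl.integral_map, memb_inr.integral_map]
  rfl

lemma nuR_ae {ζ m : ℝ} {P : (ℝ × ℝ) ⊕ (ℝ × ℝ) → Prop} (hf : ∀ᵐ p ∂(muR ζ m), P (Sum.inl p))
    (hg : ∀ᵐ p ∂(muR ζ m), P (Sum.inr p)) : ∀ᵐ x ∂(nuR ζ m), P x := by
  unfold nuR
  rw [ae_add_measure_iff]
  exact ⟨(memb_inl.ae_map_iff).2 hf, (memb_inr.ae_map_iff).2 hg⟩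

lemma CharData.exist (hlam : 2 < lam) (hζ : 0 < ζ) (hζ1 : ζ ≤ 1) (hm : 0 < m) (hc0 : 0 < c0)
    (D : CharData ζ m lam c0 C c d αW αZ) {w z : ℝ × ℝ → ℝ} (hw : Measurable w)
    (hz : Measurable z) {κ : ℝ} (hκ : 0 < κ)
    (hwz : ∀ᵐ p ∂(muR ζ m),
      |w p| ≤ κ * p.1 ^ (5 * lam / 4 + 1 / 2) ∧ |z p| ≤ κ * p.1 ^ (5 * lam / 4 + 1 / 2)) :
    ∃ W Z : ℝ × ℝ → ℝ, Measurable W ∧ Measurable Z ∧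
      (∀ p ∈ Ioo (0 : ℝ) ζ ×ˢ Ioo (0 : ℝ) m,
        |W p| ≤ 4 * c0 / (5 * lam + 2 + 4 * c0) * κ * p.1 ^ (5 * lam / 4 + 1 / 2) ∧
        |Z p| ≤ 4 * c0 / (5 * lam + 2 + 4 * c0) * κ * p.1 ^ (5 * lam / 4 + 1 / 2)) ∧
      ∀ t ∈ testPairs ζ m,
        ∫ p, (W p * pdx t.1 p + c p * W p * pdy t.1 p + d p * W p * t.1 p
          + (-αW p * (W p + z p)) * t.1 p) ∂(muR ζ m)
        + ∫ p, (Z p * pdx t.2 p - c p * Z p * pdy t.2 p - d p * Z p * t.2 p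
          + (-αZ p * (w p + Z p)) * t.2 p) ∂(muR ζ m) = 0 := by
  set K := 4 * c0 / (5 * lam + 2 + 4 * c0) with hK
  have hK0 : 0 ≤ K := by rw [hK]; positivity
  have iz : ∀ {ξ : ℝ × ℝ → ℝ}, ContDiff ℝ 1 ξ → Integrable (fun p => αW p * z p * ξ p) (muR ζ m) ∧
      |∫ p, αW p * z p * ξ p ∂(muR ζ m)|
        ≤ κ * ∫ p, (p.1 ^ (5 * lam / 4 + 1 / 2) * αW p) * |ξ p| ∂(muR ζ m) := by
    intro ξ hξ
    constructor
    · refine int_mul_cont (D.haW.mul hz.aemeasurable) (κ * c0) ?_ hξ.continuous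
      filter_upwards [hwz, D.weights hlam hζ1, ae_rect] with p h1 h2 h3
      have hP : 0 < p.1 ^ (5 * lam / 4 + 1 / 2) := Real.rpow_pos_of_pos h3.1.1 _
      calc |αW p * z p| ≤ |αW p| * (κ * p.1 ^ (5 * lam / 4 + 1 / 2)) := by
            rw [abs_mul]; gcongr; exact h1.2
        _ = κ * |p.1 ^ (5 * lam / 4 + 1 / 2) * αW p| := by rw [abs_mul, abs_of_pos hP]; ring
        _ ≤ _ := by gcongr; exact h2.2.2.2.1
    · rw [← integral_const_mul]
      refine (abs_integral_le_integral_abs).trans (integral_mono_of_nonneg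
        (Eventually.of_forall fun _ => abs_nonneg _) (Integrable.const_mul
          (int_mul_cont ((meas_w _).mul D.haW) c0
            ((D.weights hlam hζ1).mono fun p h => h.2.2.2.1) hξ.continuous.abs) κ) ?_)
      filter_upwards [hwz, D.aWb] with p h1 h2
      rw [abs_mul, abs_mul, abs_of_nonneg h2.1]
      calc αW p * |z p| * |ξ p| ≤ αW p * (κ * p.1 ^ (5 * lam / 4 + 1 / 2)) * |ξ p| := by
            have := h2.1
            gcongr; exact h1.2
        _ = _ := by ring
  have iw : ∀ {ξ : ℝ × ℝ → ℝ}, ContDiff ℝ 1 ξ → Integrable (fun p => αZ p * w p * ξ p) (muR ζ m) ∧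
      |∫ p, αZ p * w p * ξ p ∂(muR ζ m)|
        ≤ κ * ∫ p, (p.1 ^ (5 * lam / 4 + 1 / 2) * αZ p) * |ξ p| ∂(muR ζ m) := by
    intro ξ hξ
    constructor
    · refine int_mul_cont (D.haZ.mul hw.aemeasurable) (κ * c0) ?_ hξ.continuous
      filter_upwards [hwz, D.weights hlam hζ1, ae_rect] with p h1 h2 h3
      have hP : 0 < p.1 ^ (5 * lam / 4 + 1 / 2) := Real.rpow_pos_of_pos h3.1.1 _
      calc |αZ p * w p| ≤ |αZ p| * (κ * p.1 ^ (5 * lam / 4 + 1 / 2)) := by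
            rw [abs_mul]; gcongr; exact h1.1
        _ = κ * |p.1 ^ (5 * lam / 4 + 1 / 2) * αZ p| := by rw [abs_mul, abs_of_pos hP]; ring
        _ ≤ _ := by gcongr; exact h2.2.2.2.2
    · rw [← integral_const_mul]
      refine (abs_integral_le_integral_abs).trans (integral_mono_of_nonneg
        (Eventually.of_forall fun _ => abs_nonneg _) (Integrable.const_mul
          (int_mul_cont ((meas_w _).mul D.haZ) c0
            ((D.weights hlam hζ1).mono fun p h => h.2.2.2.2) hξ.continuous.abs) κ) ?_)
      filter_upwards [hwz, D.aZb] with p h1 h2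
      rw [abs_mul, abs_mul, abs_of_nonneg h2.1]
      calc αZ p * |w p| * |ξ p| ≤ αZ p * (κ * p.1 ^ (5 * lam / 4 + 1 / 2)) * |ξ p| := by
            have := h2.1
            gcongr; exact h1.1
        _ = _ := by ring
  let Λ : testPairs ζ m → (ℝ × ℝ) ⊕ (ℝ × ℝ) → ℝ := fun t =>
    Sum.elim (Lw lam 1 c d αW t.1.1) (Lw lam (-1) c d αZ t.1.2)
  let ℓ : testPairs ζ m →ₗ[ℝ] ℝ :=
    { toFun := fun t => ∫ p, αW p * z p * t.1.1 p ∂(muR ζ m) + ∫ p, αZ p * w p * t.1.2 p ∂(muR ζ m)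
      map_add' := by
        intro s t
        simp only [Submodule.coe_add, Prod.fst_add, Prod.snd_add, Pi.add_apply, mul_add]
        rw [integral_add (iz s.2.1).1 (iz t.2.1).1, integral_add (iw s.2.2.1).1 (iw t.2.2.1).1]
        ring
      map_smul' := by
        intro r t
        simp only [Submodule.coe_smul, Prod.smul_fst, Prod.smul_snd, Pi.smul_apply, smul_eq_mul,
          RingHom.id_apply, mul_add, mul_left_comm _ r]
        rw [integral_const_mul, integral_const_mul] }
  obtain ⟨V, hVm, hVb, hV⟩ := dual_exists (nuR ζ m) Λ (by
      intro s t
      refine Eventually.of_forall ?_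
      rintro (p | p)
      · simp only [Λ, Sum.elim_inl, Lw, Pi.add_apply, Submodule.coe_add, Prod.fst_add,
          pdx_add s.2.1 t.2.1, pdy_add s.2.1 t.2.1]
        ring
      · simp only [Λ, Sum.elim_inr, Lw, Pi.add_apply, Submodule.coe_add, Prod.snd_add,
          pdx_add s.2.2.1 t.2.2.1, pdy_add s.2.2.1 t.2.2.1]
        ring) (by
      intro r t
      refine Eventually.of_forall ?_
      rintro (p | p)
      · simp only [Λ, Sum.elim_inl, Lw, Pi.smul_apply, Submodule.coe_smul, Prod.smul_fst,
          pdx_smul t.2.1, pdy_smul t.2.1, smul_eq_mul]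
        ring
      · simp only [Λ, Sum.elim_inr, Lw, Pi.smul_apply, Submodule.coe_smul, Prod.smul_snd,
          pdx_smul t.2.2.1, pdy_smul t.2.2.1, smul_eq_mul]
        ring) (by
      intro t
      obtain ⟨B1, hB1⟩ := D.Lw_memLp hlam hζ1 t.2.1 1
      obtain ⟨B2, hB2⟩ := D.swap.Lw_memLp hlam hζ1 t.2.2.1 (-1)
      refine MemLp.of_bound (nuR_integrable (D.Lw_int hlam hζ1 t.2.1 1)
        (D.swap.Lw_int hlam hζ1 t.2.2.1 (-1))).aestronglyMeasurable (max B1 B2) ?_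
      exact nuR_ae (hB1.mono fun p h => h.trans (le_max_left _ _))
        (hB2.mono fun p h => h.trans (le_max_right _ _))) ℓ (K * κ) (by positivity) (by
      intro t
      have e : ∀ x, |Λ t x| = Sum.elim (fun p => |Lw lam 1 c d αW t.1.1 p|)
          (fun p => |Lw lam (-1) c d αZ t.1.2 p|) x := by rintro (p | p) <;> rfl
      simp only [e]
      rw [nuR_integral (D.Lw_int hlam hζ1 t.2.1 1).abs (D.swap.Lw_int hlam hζ1 t.2.2.1 (-1)).abs]
      have l1 := D.low hlam hζ hζ1 hc0 t.2.1 (fun ψ hψ => (t.2.2.2.1 ψ hψ).1) 1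
      have l2 := D.swap.low hlam hζ hζ1 hc0 t.2.2.1 (fun ψ hψ => (t.2.2.2.1 ψ hψ).2) (-1)
      have l3 := D.bal hlam hm hζ1 t.2.1 t.2.2.1 t.2.2.2.2
      rw [l3, ← hK] at l1
      rw [← hK] at l2
      refine (abs_add_le _ _).trans ((add_le_add (iz t.2.1).2 (iw t.2.2.1).2).trans ?_)
      rw [← mul_add]
      refine (mul_le_mul_of_nonneg_left (add_le_add l1 l2) hκ.le).trans (le_of_eq ?_)
      ring)
  refine ⟨fun p => V (Sum.inl p) * p.1 ^ (5 * lam / 4 + 1 / 2),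
    fun p => V (Sum.inr p) * p.1 ^ (5 * lam / 4 + 1 / 2),
    (hVm.comp measurable_inl).mul (by fun_prop),
    (hVm.comp measurable_inr).mul (by fun_prop), ?_, ?_⟩
  · intro p hp
    have hP : 0 < p.1 ^ (5 * lam / 4 + 1 / 2) := Real.rpow_pos_of_pos hp.1.1 _
    constructor
    · rw [abs_mul, abs_of_pos hP]; gcongr; exact hVb _
    · rw [abs_mul, abs_of_pos hP]; gcongr; exact hVb _
  · intro t ht
    have h := hV ⟨t, ht⟩
    have e : ∀ x, V x * Λ ⟨t, ht⟩ x = Sum.elim (fun p => V (Sum.inl p) * Lw lam 1 c d αW t.1 p)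
          (fun p => V (Sum.inr p) * Lw lam (-1) c d αZ t.2 p) x := by rintro (p | p) <;> rfl
    have k1 : Integrable (fun p => V (Sum.inl p) * Lw lam 1 c d αW t.1 p) (muR ζ m) :=
      (D.Lw_int hlam hζ1 ht.1 1).bdd_mul (c := K * κ)
        (hVm.comp measurable_inl).aestronglyMeasurable (Eventually.of_forall fun _ => hVb _)
    have k2 : Integrable (fun p => V (Sum.inr p) * Lw lam (-1) c d αZ t.2 p) (muR ζ m) :=
      (D.swap.Lw_int hlam hζ1 ht.2.1 (-1)).bdd_mul (c := K * κ)
        (hVm.comp measurable_inr).aestronglyMeasurable (Eventually.of_forall fun _ => hVb _)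
    simp only [e] at h
    rw [nuR_integral k1 k2] at h
    change _ = ∫ p, αW p * z p * t.1 p ∂(muR ζ m) + ∫ p, αZ p * w p * t.2 p ∂(muR ζ m) at h
    have g1 := integral_sub k1 (iz ht.1).1
    have g2 := integral_sub k2 (iw ht.2.1).1
    have : ∀ a b c' d' : ℝ, a + b = c' + d' → (a - c') + (b - d') = 0 := by intros; linarith
    have h2 := this _ _ _ _ h
    rw [← g1, ← g2] at h2
    refine Eq.trans ?_ h2
    congr 1
    · congr 1; ext p; simp only [Lw]; ring
    · congr 1; ext p; simp only [Lw]; ring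

end exist2

/-! ### Uniqueness: Gronwall -/

lemma gron {ζ a B M0 : ℝ} (ha : 0 < a) (hB : 0 ≤ B) (hM0 : 0 ≤ M0) {N : ℝ → ℝ}
    (hN0 : ∀ x, 0 ≤ N x)
    (hM : ∀ᵐ φ ∂(volume.restrict (Ioo (0 : ℝ) ζ)), N φ ≤ M0)
    (h : ∀ᵐ φ ∂(volume.restrict (Ioo (0 : ℝ) ζ)),
      N φ ≤ ∫ s in Ioo 0 φ, B * s ^ (a - 1) * N s) :
    ∀ᵐ φ ∂(volume.restrict (Ioo (0 : ℝ) ζ)), N φ = 0 := by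
  have key : ∀ j : ℕ, ∀ᵐ φ ∂(volume.restrict (Ioo (0 : ℝ) ζ)),
      N φ ≤ M0 * ((B / a) ^ j / j.factorial) * φ ^ (j * a) := by
    intro j
    induction j with
    | zero => simpa using hM
    | succ j ih =>
      filter_upwards [h, ae_restrict_mem measurableSet_Ioo] with φ h1 hφ
      refine h1.trans ?_
      have ih' : ∀ᵐ s ∂(volume.restrict (Ioo (0 : ℝ) φ)),
          N s ≤ M0 * ((B / a) ^ j / j.factorial) * s ^ (j * a) :=
        ae_restrict_of_ae_restrict_of_subset (Ioo_subset_Ioo_right hφ.2.le) ih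
      have hi : IntervalIntegrable (fun s : ℝ => s ^ ((j + 1) * a - 1)) volume 0 φ :=
        intervalIntegral.intervalIntegrable_rpow' (by nlinarith [(Nat.cast_nonneg j : (0:ℝ) ≤ j)])
      have hi' : IntegrableOn (fun s : ℝ => s ^ ((j + 1) * a - 1)) (Ioo 0 φ) := by
        rw [intervalIntegrable_iff_integrableOn_Ioc_of_le hφ.1.le] at hi
        exact hi.mono_set Ioo_subset_Ioc_self
      have : ∫ s in Ioo 0 φ, B * s ^ (a - 1) * N s ≤
          ∫ s in Ioo 0 φ, (B * (M0 * ((B / a) ^ j / j.factorial))) * s ^ ((j + 1) * a - 1) := by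
        refine integral_mono_of_nonneg ?_ (hi'.const_mul _) ?_
        · filter_upwards [ae_restrict_mem measurableSet_Ioo] with s hs
          have := hN0 s
          have := hs.1
          simp only [Pi.zero_apply]
          positivity
        · filter_upwards [ih', ae_restrict_mem measurableSet_Ioo] with s h2 hs
          have hs0 := hs.1
          have e : s ^ ((j + 1) * a - 1) = s ^ (a - 1) * s ^ (j * a) := by
            rw [← Real.rpow_add hs0]; congr 1; ring
          rw [e]
          calc B * s ^ (a - 1) * N s
              ≤ B * s ^ (a - 1) * (M0 * ((B / a) ^ j / j.factorial) * s ^ (j * a)) := by gcongr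
            _ = _ := by ring
      refine this.trans (le_of_eq ?_)
      rw [integral_const_mul, ← integral_Ioc_eq_integral_Ioo,
        ← intervalIntegral.integral_of_le hφ.1.le, integral_rpow (Or.inl (by
          nlinarith [(Nat.cast_nonneg j : (0:ℝ) ≤ j)]))]
      have hj : ((j : ℝ) + 1) ≠ 0 := by positivity
      rw [sub_add_cancel, Real.zero_rpow (by positivity), Nat.factorial_succ]
      push_cast
      have : (j.factorial : ℝ) ≠ 0 := by positivity
      rw [pow_succ]
      generalize (B / a) ^ j = r
      generalize φ ^ ((↑j + 1) * a) = r'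
      field_simp
      ring
  have := ae_all_iff.2 key
  filter_upwards [this, ae_restrict_mem measurableSet_Ioo] with φ h1 hφ
  refine le_antisymm ?_ (hN0 φ)
  have ht : Tendsto (fun j : ℕ => M0 * ((B / a * φ ^ a) ^ j / j.factorial)) atTop (nhds (M0 * 0)) :=
    (FloorSemiring.tendsto_pow_div_factorial_atTop _).const_mul _
  rw [mul_zero] at ht
  refine ge_of_tendsto' ht fun j => (h1 j).trans (le_of_eq ?_)
  rw [mul_pow, ← Real.rpow_mul_natCast hφ.1.le, mul_comm a]
  ring

/-! ### Uniqueness: du Bois-Reymond -/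

lemma dbr_const {ζ : ℝ} (hζ : 0 < ζ) {H : ℝ → ℝ} (hH : LocallyIntegrableOn H (Ioo 0 ζ))
    (h : ∀ a : ℝ → ℝ, ContDiff ℝ (⊤ : ℕ∞) a → HasCompactSupport a → tsupport a ⊆ Ioo 0 ζ →
      ∫ x, deriv a x * H x = 0) :
    ∃ k, ∀ᵐ x ∂(volume.restrict (Ioo (0 : ℝ) ζ)), H x = k := by
  -- a fixed bump
  let f : ContDiffBump (ζ / 2) := ⟨ζ / 8, ζ / 4, by positivity, by linarith⟩
  have hfs : tsupport (f.normed volume) ⊆ Ioo 0 ζ := by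
    rw [f.tsupport_normed_eq, Real.closedBall_eq_Icc]
    intro x hx
    simp only [f] at hx
    exact ⟨by linarith [hx.1], by linarith [hx.2]⟩
  set a0 : ℝ → ℝ := f.normed volume with ha0
  have ha0c : HasCompactSupport a0 := f.hasCompactSupport_normed
  have ha0s : ContDiff ℝ (⊤ : ℕ∞) a0 := f.contDiff_normed
  have ha01 : ∫ x, a0 x = 1 := f.integral_normed
  have hintg : ∀ b : ℝ → ℝ, Continuous b → HasCompactSupport b → tsupport b ⊆ Ioo 0 ζ →
      Integrable (fun x => b x * H x) := by
    intro b hb hbc hbs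
    have h1 : IntegrableOn H (tsupport b) := hH.integrableOn_compact_subset hbs hbc
    have h2 : IntegrableOn (fun x => b x * H x) (tsupport b) :=
      h1.continuousOn_mul hb.continuousOn hbc
    rwa [integrableOn_iff_integrable_of_support_subset] at h2
    intro x hx
    apply subset_tsupport
    intro h0
    apply hx
    simp [h0]
  set k := ∫ x, a0 x * H x with hk
  refine ⟨k, ?_⟩
  have key := isOpen_Ioo.ae_eq_zero_of_integral_contDiff_smul_eq_zero (μ := volume)
    (f := fun x => H x - k) (U := Ioo 0 ζ) (hH.sub ((locallyIntegrable_const k).locallyIntegrableOn _)) ?_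
  · rw [ae_restrict_iff' measurableSet_Ioo]
    filter_upwards [key] with x hx hx2
    linarith [hx hx2]
  intro b hb hbc hbs
  set I := ∫ x, b x with hI
  let b' : ℝ → ℝ := fun x => b x - I * a0 x
  have hb'c : HasCompactSupport b' := hbc.sub ha0c.mul_left
  have hb's : ContDiff ℝ (⊤ : ℕ∞) b' := hb.sub (contDiff_const.mul ha0s)
  have hb'i : Integrable b' := hb's.continuous.integrable_of_hasCompactSupport hb'c
  have hb'0 : ∫ x, b' x = 0 := by
    have : ∫ x, b' x = (∫ x, b x) - ∫ x, I * a0 x := integral_sub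
      (hb.continuous.integrable_of_hasCompactSupport hbc)
      ((ha0s.continuous.integrable_of_hasCompactSupport ha0c).const_mul I)
    rw [this, integral_const_mul, ha01]; ring
  -- support of b' in a compact interval
  obtain ⟨l, r, hl, hr, hlr, hsub⟩ : ∃ l r, 0 < l ∧ r < ζ ∧ l ≤ r ∧
      ∀ x, x ∉ Icc l r → b' x = 0 := by
    have hcpt : IsCompact (tsupport b ∪ tsupport a0) := hbc.isCompact.union ha0c.isCompact
    have hne : (tsupport b ∪ tsupport a0).Nonempty := by
      refine Set.Nonempty.inr ?_
      by_contra hcon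
      rw [Set.not_nonempty_iff_eq_empty, tsupport_eq_empty_iff] at hcon
      rw [hcon] at ha01
      simp at ha01
    obtain ⟨l, hl1, hl2⟩ := hcpt.exists_isLeast hne
    obtain ⟨r, hr1, hr2⟩ := hcpt.exists_isGreatest hne
    have hss := union_subset hbs hfs
    refine ⟨l, r, (hss hl1).1, (hss hr1).2, hl2 hr1, fun x hx => ?_⟩
    have hx' : x ∉ tsupport b ∪ tsupport a0 := fun hx' => hx ⟨hl2 hx', hr2 hx'⟩
    simp only [mem_union, not_or] at hx'
    simp [b', image_eq_zero_of_notMem_tsupport hx'.1, image_eq_zero_of_notMem_tsupport hx'.2]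
  let a : ℝ → ℝ := fun x => ∫ y in (0:ℝ)..x, b' y
  have had : ∀ x, HasDerivAt a (b' x) x := fun x =>
    intervalIntegral.integral_hasDerivAt_right (hb's.continuous.intervalIntegrable _ _)
      (hb's.continuous.stronglyMeasurableAtFilter _ _) hb's.continuous.continuousAt
  have hade : deriv a = b' := funext fun x => (had x).deriv
  have has : ContDiff ℝ (⊤ : ℕ∞) a := by
    rw [contDiff_infty_iff_deriv, hade]
    exact ⟨fun x => (had x).differentiableAt, hb's⟩
  have ha_out : ∀ x, x ∉ Icc l r → a x = 0 := by
    intro x hx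
    rw [mem_Icc, not_and_or, not_le, not_le] at hx
    rcases hx with hx | hx
    · apply intervalIntegral.integral_zero_ae
      refine Eventually.of_forall fun y hy => hsub y fun hy2 => ?_
      have : y ≤ max 0 x := hy.2
      have := max_lt hl hx
      linarith [hy2.1]
    · have e1 : a x = ∫ y, b' y := by
        simp only [a]
        rw [intervalIntegral.integral_of_le (by linarith)]
        apply setIntegral_eq_integral_of_forall_compl_eq_zero
        intro y hy
        apply hsub
        intro hy2
        exact hy ⟨by linarith [hy2.1], by linarith [hy2.2]⟩
      rw [e1, hb'0]
  have hac : HasCompactSupport a := HasCompactSupport.intro isCompact_Icc ha_out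
  have hats : tsupport a ⊆ Ioo 0 ζ := by
    have : tsupport a ⊆ Icc l r := closure_minimal (fun x hx => by
      by_contra hcon; exact hx (ha_out x hcon)) isClosed_Icc
    exact this.trans fun x hx => ⟨by linarith [hx.1], by linarith [hx.2]⟩
  have := h a has hac hats
  rw [hade] at this
  have i1 := hintg b hb.continuous hbc hbs
  have i2 := hintg a0 ha0s.continuous ha0c hfs
  have e2 : ∫ x, b' x * H x = (∫ x, b x * H x) - I * k := by
    rw [hk, ← integral_const_mul, ← integral_sub i1 (i2.const_mul I)]
    congr 1; ext x; simp only [b']; ring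
  have e3 : ∫ x, b x • (H x - k) = (∫ x, b x * H x) - I * k := by
    rw [hI, ← integral_mul_const, ← integral_sub i1
      ((hb.continuous.integrable_of_hasCompactSupport hbc).mul_const k)]
    congr 1; ext x; simp only [smul_eq_mul]; ring
  rw [e3, ← e2, this]

lemma dbr_sq {ζ : ℝ} (hζ : 0 < ζ) {v g : ℝ → ℝ} (hv : LocallyIntegrableOn v (Ioo 0 ζ))
    (hg : LocallyIntegrableOn g (Ioo 0 ζ))
    (h : ∀ a : ℝ → ℝ, ContDiff ℝ (⊤ : ℕ∞) a → HasCompactSupport a → tsupport a ⊆ Ioo 0 ζ →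
      ∫ x, (deriv a x * v x + a x * g x) = 0) :
    ∃ S : Set ℝ, (∀ᵐ x ∂(volume.restrict (Ioo (0 : ℝ) ζ)), x ∈ S) ∧
      ∀ x ∈ S, ∀ y ∈ S, 0 < x → x < y → y < ζ →
        v y ^ 2 - v x ^ 2 = ∫ s in x..y, 2 * (v s * g s) := by
  set G : ℝ → ℝ := fun x => ∫ s in (ζ / 2)..x, g s with hG
  have gi : ∀ {x y}, x ∈ Ioo 0 ζ → y ∈ Ioo 0 ζ → IntervalIntegrable g volume x y := by
    intro x y hx hy
    rw [intervalIntegrable_iff']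
    exact hg.integrableOn_compact_subset (ordConnected_Ioo.uIcc_subset hx hy) isCompact_uIcc
  have hmid : ζ / 2 ∈ Ioo 0 ζ := ⟨by linarith, by linarith⟩
  have hac : ∀ {x y}, x ∈ Ioo 0 ζ → y ∈ Ioo 0 ζ → AbsolutelyContinuousOnInterval G x y := by
    intro x y hx hy
    have hl : min (ζ/2) (min x y) ∈ Ioo 0 ζ := by
      rcases min_choice (ζ/2) (min x y) with h | h <;> rw [h]
      · exact hmid
      · rcases min_choice x y with h | h <;> rw [h] <;> assumption
    have hr : max (ζ/2) (max x y) ∈ Ioo 0 ζ := by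
      rcases max_choice (ζ/2) (max x y) with h | h <;> rw [h]
      · exact hmid
      · rcases max_choice x y with h | h <;> rw [h] <;> assumption
    have hle : min (ζ/2) (min x y) ≤ max (ζ/2) (max x y) :=
      (min_le_left _ _).trans (le_max_left _ _)
    refine ((gi hl hr).absolutelyContinuousOnInterval_intervalIntegral (c := ζ/2) ?_).mono ?_
    · rw [uIcc_of_le hle]; exact ⟨min_le_left _ _, le_max_left _ _⟩
    · rw [uIcc_of_le hle, uIcc]
      exact Icc_subset_Icc (min_le_right _ _) (le_max_right _ _)
  have hGc : ContinuousOn G (Ioo 0 ζ) := by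
    intro x hx
    have h1 : x / 2 ∈ Ioo 0 ζ := ⟨by linarith [hx.1], by linarith [hx.1, hx.2]⟩
    have h2 : (x + ζ) / 2 ∈ Ioo 0 ζ := ⟨by linarith [hx.1, hx.2], by linarith [hx.1, hx.2]⟩
    have := (hac h1 h2).continuousOn
    rw [uIcc_of_le (by linarith [hx.1, hx.2])] at this
    exact (this.continuousAt (Icc_mem_nhds (by linarith [hx.1]) (by linarith [hx.2]))).continuousWithinAt
  have hGd : ∀ {x y}, x ∈ Ioo 0 ζ → y ∈ Ioo 0 ζ → ∀ᵐ s, s ∈ uIoc x y → deriv G s = g s := by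
    intro x y hx hy
    have h1 := (gi hx hmid).ae_hasDerivAt_integral
    have h2 := (gi hmid hy).ae_hasDerivAt_integral
    filter_upwards [h1, h2] with s h1 h2 hs
    have hs' : s ∈ uIcc x y := uIoc_subset_uIcc hs
    rcases uIcc_subset_uIcc_union_uIcc (b := ζ / 2) hs' with h3 | h3
    · exact (h1 h3 _ right_mem_uIcc).deriv
    · exact (h2 h3 _ left_mem_uIcc).deriv
  have hGl : LocallyIntegrableOn G (Ioo 0 ζ) :=
    hGc.locallyIntegrableOn measurableSet_Ioo
  obtain ⟨k, hk⟩ := dbr_const hζ (H := fun x => v x - G x) (hv.sub hGl) (by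
    intro a ha hac' has
    obtain ⟨l, r, hl, hr, hlr, hlra⟩ : ∃ l r, l ∈ Ioo 0 ζ ∧ r ∈ Ioo 0 ζ ∧ l ≤ r ∧
        ∀ x, x ∉ Ioo l r → a x = 0 ∧ deriv a x = 0 := by
      rcases (tsupport a).eq_empty_or_nonempty with he | hne
      · rw [tsupport_eq_empty_iff] at he
        exact ⟨ζ/2, ζ/2, hmid, hmid, le_rfl, by simp [he]⟩
      · obtain ⟨l, hl1, hl2⟩ := hac'.isCompact.exists_isLeast hne
        obtain ⟨r, hr1, hr2⟩ := hac'.isCompact.exists_isGreatest hne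
        have hl := has hl1
        have hr := has hr1
        have := hl2 hr1
        refine ⟨l / 2, (r + ζ) / 2, ⟨by linarith [hl.1], by linarith [hl.1, hl.2]⟩,
          ⟨by linarith [hr.1, hr.2], by linarith [hr.2]⟩, by linarith [hr.2, hl.1], fun x hx => ?_⟩
        have hx' : x ∉ tsupport a := fun h => hx
          ⟨by linarith [hl.1, hl2 h], by linarith [hr.2, hr2 h]⟩
        exact ⟨image_eq_zero_of_notMem_tsupport hx',
          image_eq_zero_of_notMem_tsupport fun h => hx' (tsupport_deriv_subset h)⟩
    have haa : AbsolutelyContinuousOnInterval a l r :=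
      ((ha.of_le (by simp) : ContDiff ℝ 1 a).contDiffOn (s := uIcc l r)).absolutelyContinuousOnInterval
    have e1 := haa.integral_deriv_mul_eq_sub (hac hl hr)
    rw [(hlra l (by simp)).1, (hlra r (by simp)).1] at e1
    have gI := gi hl hr
    have hda : Continuous (deriv a) := ha.continuous_deriv (by simp)
    have e2 : ∫ x in l..r, (deriv a x * G x + a x * g x) = 0 := by
      rw [show (0:ℝ) = 0 * G r - 0 * G l by ring, ← e1]
      apply intervalIntegral.integral_congr_ae
      filter_upwards [hGd hl hr] with x hx hx2
      rw [hx hx2]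
    have e3 : ∫ x in l..r, (deriv a x * v x + a x * g x) = 0 := by
      rw [← h a ha hac' has, intervalIntegral.integral_of_le hlr]
      apply setIntegral_eq_integral_of_forall_compl_eq_zero
      intro x hx
      obtain ⟨q1, q2⟩ := hlra x (fun h => hx ⟨h.1, h.2.le⟩)
      rw [q1, q2]; ring
    have vI : IntervalIntegrable v volume l r := by
      rw [intervalIntegrable_iff']
      exact hv.integrableOn_compact_subset (ordConnected_Ioo.uIcc_subset hl hr) isCompact_uIcc
    have GI : IntervalIntegrable G volume l r := (hac hl hr).continuousOn.intervalIntegrable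
    have : ∫ x, deriv a x * (v x - G x) = ∫ x in l..r, deriv a x * (v x - G x) := by
      rw [intervalIntegral.integral_of_le hlr]
      symm
      apply setIntegral_eq_integral_of_forall_compl_eq_zero
      intro x hx
      obtain ⟨q1, q2⟩ := hlra x (fun h => hx ⟨h.1, h.2.le⟩)
      rw [q2]; ring
    rw [this, show (0:ℝ) = 0 - 0 by ring]
    nth_rewrite 1 [← e3]
    rw [← e2, ← intervalIntegral.integral_sub]
    · congr 1; ext x; ring
    · exact (vI.continuousOn_mul hda.continuousOn).add (gI.continuousOn_mul ha.continuous.continuousOn)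
    · exact (GI.continuousOn_mul hda.continuousOn).add (gI.continuousOn_mul ha.continuous.continuousOn))
  refine ⟨{x | v x - G x = k}, hk, fun x hx y hy hx0 hxy hyζ => ?_⟩
  have hxI : x ∈ Ioo 0 ζ := ⟨hx0, hxy.trans hyζ⟩
  have hyI : y ∈ Ioo 0 ζ := ⟨hx0.trans hxy, hyζ⟩
  have hkc : AbsolutelyContinuousOnInterval (fun s => G s + k) x y :=
    (hac hxI hyI).fun_add ((contDiff_const (c := k) : ContDiff ℝ 1 (fun _ : ℝ => k)).contDiffOn
      (s := uIcc x y)).absolutelyContinuousOnInterval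
  have e1 := hkc.integral_deriv_mul_eq_sub hkc
  simp only [mem_setOf_eq] at hx hy
  have : v y ^ 2 - v x ^ 2 = (G y + k) * (G y + k) - (G x + k) * (G x + k) := by
    rw [show v y = G y + k by linarith, show v x = G x + k by linarith]; ring
  rw [this, ← e1]
  apply intervalIntegral.integral_congr_ae
  rw [ae_restrict_iff' measurableSet_Ioo] at hk
  filter_upwards [hGd hxI hyI, hk] with s h1 h2 hs
  have hs' : s ∈ Ioo 0 ζ := ordConnected_Ioo.uIcc_subset hxI hyI (uIoc_subset_uIcc hs)
  rw [deriv_add_const, h1 hs, show v s = G s + k by linarith [h2 hs']]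
  ring
/-! ### Uniqueness: trigonometric kernels -/

/-- base frequency -/
def om (m : ℝ) : ℝ := π / (2 * m)

/-- kernel -/
def kern (m : ℝ) (n : ℕ) (x : ℝ) : ℝ := cos (om m * x) ^ (2 * n)

/-- derivative of the kernel -/
def kern' (m : ℝ) (n : ℕ) (x : ℝ) : ℝ :=
  -((2 * n : ℕ) * cos (om m * x) ^ (2 * n - 1) * (om m * sin (om m * x)))

/-- basic factor -/
def trg (m : ℝ) (i : Fin 2) (x : ℝ) : ℝ := if i = 0 then cos (om m * x) else sin (om m * x)

/-- rank one factors -/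
def uf (m : ℝ) (n : ℕ) (f : Fin (2 * n) → Fin 2) (x : ℝ) : ℝ := ∏ k, trg m (f k) x

abbrev nuJ (m : ℝ) : Measure ℝ := volume.restrict (Ioc (-m) m)

lemma om_mul {m : ℝ} (hm : 0 < m) : om m * m = π / 2 := by
  unfold om; field_simp

lemma om_pos {m : ℝ} (hm : 0 < m) : 0 < om m := by
  unfold om; positivity

lemma trg_contDiff (m : ℝ) (i : Fin 2) : ContDiff ℝ 1 (trg m i) := by
  unfold trg
  split_ifs
  · exact Real.contDiff_cos.comp (contDiff_const.mul contDiff_id)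
  · exact Real.contDiff_sin.comp (contDiff_const.mul contDiff_id)

lemma uf_contDiff (m : ℝ) (n : ℕ) (f : Fin (2 * n) → Fin 2) : ContDiff ℝ 1 (uf m n f) := by
  unfold uf
  exact contDiff_prod fun k _ => trg_contDiff m (f k)

lemma trg_anti {m : ℝ} (hm : 0 < m) (i : Fin 2) (x : ℝ) : trg m i (x + 2 * m) = - trg m i x := by
  have : om m * (x + 2 * m) = om m * x + π := by
    have := om_mul hm; linarith
  unfold trg
  split_ifs <;> simp [this, cos_add_pi, sin_add_pi]

lemma uf_per {m : ℝ} (hm : 0 < m) (n : ℕ) (f : Fin (2 * n) → Fin 2) (x : ℝ) :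
    uf m n f (x + 2 * m) = uf m n f x := by
  unfold uf
  simp only [trg_anti hm]
  rw [Finset.prod_neg]
  simp

lemma uf_end {m : ℝ} (hm : 0 < m) (n : ℕ) (f : Fin (2 * n) → Fin 2) :
    uf m n f m = uf m n f (-m) := by
  rw [← uf_per hm n f (-m)]; congr 1; ring

lemma uf_sum (m : ℝ) (n : ℕ) (x y : ℝ) :
    ∑ f, uf m n f x * uf m n f y = kern m n (x - y) := by
  unfold kern uf
  have : cos (om m * (x - y)) = ∑ i : Fin 2, trg m i x * trg m i y := by
    rw [mul_sub, cos_sub]; simp [trg, Fin.sum_univ_two]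
  rw [this, Fintype.sum_pow]
  simp only [Finset.prod_mul_distrib]

lemma kern_hasDerivAt (m : ℝ) (n : ℕ) (x : ℝ) : HasDerivAt (kern m n) (kern' m n x) x := by
  unfold kern kern'
  have h1 : HasDerivAt (fun x => om m * x) (om m) x := by simpa using (hasDerivAt_id x).const_mul (om m)
  have := (h1.cos).pow (2 * n)
  exact this.congr_deriv (by ring)

lemma uf_sum' (m : ℝ) (n : ℕ) (x y : ℝ) :
    ∑ f, deriv (uf m n f) x * uf m n f y = kern' m n (x - y) := by
  have h1 : HasDerivAt (fun x => ∑ f, uf m n f x * uf m n f y)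
      (∑ f, deriv (uf m n f) x * uf m n f y) x := by
    apply HasDerivAt.fun_sum
    intro f _
    exact (((uf_contDiff m n f).differentiable (by simp)) x).hasDerivAt.mul_const _
  simp only [uf_sum] at h1
  have h2 : HasDerivAt (fun x => kern m n (x - y)) (kern' m n (x - y)) x := by
    simpa using (kern_hasDerivAt m n (x - y)).comp_sub_const x y
  exact h1.unique h2

lemma kern_cont (m : ℝ) (n : ℕ) : Continuous (kern m n) := by unfold kern; fun_prop

lemma kern'_cont (m : ℝ) (n : ℕ) : Continuous (kern' m n) := by unfold kern'; fun_prop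

lemma kern_nonneg (m : ℝ) (n : ℕ) (x : ℝ) : 0 ≤ kern m n x := by
  unfold kern; rw [pow_mul]; positivity

lemma kern_le_one (m : ℝ) (n : ℕ) (x : ℝ) : kern m n x ≤ 1 := by
  unfold kern; rw [pow_mul]
  exact pow_le_one₀ (sq_nonneg _) (cos_sq_le_one _)

lemma kern'_neg (m : ℝ) (n : ℕ) (x : ℝ) : kern' m n (-x) = - kern' m n x := by
  unfold kern'; simp

lemma kern_neg (m : ℝ) (n : ℕ) (x : ℝ) : kern m n (-x) = kern m n x := by
  unfold kern; simp

lemma kern_per {m : ℝ} (hm : 0 < m) (n : ℕ) : Function.Periodic (kern m n) (2 * m) := by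
  intro x
  unfold kern
  have : om m * (x + 2 * m) = om m * x + π := by
    have := om_mul hm; linarith
  rw [this, cos_add_pi, pow_mul, pow_mul, neg_sq]

/-- the integral of the kernel -/
def kI (m : ℝ) (n : ℕ) : ℝ := ∫ x, kern m n x ∂(nuJ m)

lemma int_per {m : ℝ} (hm : 0 < m) {k : ℝ → ℝ} (hk : Function.Periodic k (2 * m)) (x : ℝ) :
    ∫ y, k (y - x) ∂(nuJ m) = ∫ y, k y ∂(nuJ m) := by
  unfold nuJ
  rw [← intervalIntegral.integral_of_le (by linarith), ← intervalIntegral.integral_of_le (by linarith),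
    intervalIntegral.integral_comp_sub_right]
  have := hk.intervalIntegral_add_eq (-m - x) (-m)
  rw [show -m - x + 2 * m = m - x by ring, show -m + 2 * m = m by ring] at this
  exact this

lemma kI_pos {m : ℝ} (hm : 0 < m) (n : ℕ) : 0 < kI m n := by
  unfold kI nuJ
  rw [← intervalIntegral.integral_of_le (by linarith)]
  apply intervalIntegral.intervalIntegral_pos_of_pos_on ((kern_cont m n).intervalIntegrable _ _)
  · intro x hx
    unfold kern
    have := om_mul hm
    have h0 := om_pos hm
    exact pow_pos (cos_pos_of_mem_Ioo ⟨by nlinarith [hx.1], by nlinarith [hx.2]⟩) _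
  · linarith

lemma abs_abs_sub_le {m x y : ℝ} (hm : 0 < m) (hx : x ∈ Icc (-m) m) (hy : y ∈ Icc (-m) m) :
    |(|x| - |y|)| ≤ m * |sin (om m * (x - y))| := by
  have h0 := om_pos hm
  have h1 := om_mul hm
  have jor : ∀ t, 0 ≤ t → t ≤ m → t ≤ m * sin (om m * t) := by
    intro t ht htm
    have := Real.mul_le_sin (x := om m * t) (by positivity) (by nlinarith)
    calc t = m * (2 / π * (om m * t)) := by unfold om; field_simp
      _ ≤ _ := by gcongr
  have e : |sin (om m * (x - y))| = |sin (om m * |x - y|)| := by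
    rcases abs_choice (x - y) with h | h <;> rw [h]
    rw [mul_neg, sin_neg, abs_neg]
  rw [e]
  by_cases hd : |x - y| ≤ m
  · calc _ ≤ |x - y| := abs_abs_sub_abs_le x y
      _ ≤ _ := jor _ (abs_nonneg _) hd
      _ ≤ _ := by gcongr; exact le_abs_self _
  · push Not at hd
    have hd2 : |x - y| ≤ 2 * m := by rw [abs_le]; constructor <;> linarith [hx.1, hx.2, hy.1, hy.2]
    have := jor (2 * m - |x - y|) (by linarith) (by linarith)
    have e2 : sin (om m * (2 * m - |x - y|)) = sin (om m * |x - y|) := by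
      rw [← sin_pi_sub]; congr 1; linarith
    rw [e2] at this
    have h3 : |(|x| - |y|)| ≤ 2 * m - |x - y| := by
      obtain ⟨hx1, hx2⟩ := hx
      obtain ⟨hy1, hy2⟩ := hy
      rcases abs_cases x with ⟨a, _⟩ | ⟨a, _⟩ <;> rcases abs_cases y with ⟨b, _⟩ | ⟨b, _⟩ <;>
      rcases abs_cases (x - y) with ⟨c, _⟩ | ⟨c, _⟩ <;> rw [a, b, abs_le] <;> rw [c] at hd ⊢ <;>
      constructor <;> linarith
    calc _ ≤ _ := h3
      _ ≤ _ := this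
      _ ≤ _ := by gcongr; exact le_abs_self _

/-- The comparison kernel. -/
def kap (m : ℝ) (n : ℕ) (x : ℝ) : ℝ := m * |sin (om m * x)| * |kern' m n x|

lemma kap_cont (m : ℝ) (n : ℕ) : Continuous (kap m n) := by
  unfold kap
  have := kern'_cont m n
  fun_prop

lemma kap_nonneg {m : ℝ} (hm : 0 < m) (n : ℕ) (x : ℝ) : 0 ≤ kap m n x := by unfold kap; positivity

lemma kap_neg (m : ℝ) (n : ℕ) (x : ℝ) : kap m n (-x) = kap m n x := by
  unfold kap; simp [kern'_neg]

lemma kap_per {m : ℝ} (hm : 0 < m) (n : ℕ) : Function.Periodic (kap m n) (2 * m) := by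
  intro x
  unfold kap kern'
  have : om m * (x + 2 * m) = om m * x + π := by
    have := om_mul hm; linarith
  simp [this, cos_add_pi, sin_add_pi, abs_mul, abs_pow]

lemma kap_int {m : ℝ} (hm : 0 < m) (n : ℕ) :
    ∫ x, kap m (n + 1) x ∂(nuJ m) ≤ π / 2 * kI m (n + 1) := by
  have h0 := om_pos hm
  have h1 := om_mul hm
  have hd : ∀ x, HasDerivAt (fun x => cos (om m * x) ^ (2 * (n + 1)) * sin (om m * x))
      (kern' m (n + 1) x * sin (om m * x) + cos (om m * x) ^ (2 * (n + 1)) * (cos (om m * x) * om m)) x := by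
    intro x
    have hl : HasDerivAt (fun x => om m * x) (om m) x := by
      simpa using (hasDerivAt_id x).const_mul (om m)
    exact (kern_hasDerivAt m (n + 1) x).mul hl.sin
  have hintg := intervalIntegral.integral_eq_sub_of_hasDerivAt (a := -m) (b := m)
    (fun x _ => hd x) (Continuous.intervalIntegrable (by
      have := kern'_cont m (n+1)
      fun_prop) _ _)
  have hz : ∀ y, y = m ∨ y = -m → cos (om m * y) = 0 := by
    rintro y (rfl | rfl)
    · rw [h1, cos_pi_div_two]
    · rw [mul_neg, h1, cos_neg, cos_pi_div_two]
  rw [hz m (Or.inl rfl), hz (-m) (Or.inr rfl)] at hintg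
  simp only [ne_eq, Nat.mul_eq_zero, OfNat.ofNat_ne_zero, Nat.add_eq_zero_iff, one_ne_zero, and_false,
    or_self, not_false_eq_true, zero_pow, zero_mul, sub_zero] at hintg
  have c1 : Continuous fun x => kern' m (n+1) x * sin (om m * x) := by
    have := kern'_cont m (n+1)
    fun_prop
  have c2 : Continuous fun x => cos (om m * x) ^ (2 * (n + 1)) * (cos (om m * x) * om m) := by fun_prop
  rw [intervalIntegral.integral_add (c1.intervalIntegrable _ _) (c2.intervalIntegrable _ _)] at hintg
  have e1 : ∫ x, kap m (n + 1) x ∂(nuJ m) = - (m * ∫ x in (-m)..m, kern' m (n+1) x * sin (om m * x)) := by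
    rw [intervalIntegral.integral_of_le (by linarith), ← integral_const_mul, ← integral_neg]
    apply setIntegral_congr_fun measurableSet_Ioc
    intro x hx
    have hc : 0 ≤ cos (om m * x) := cos_nonneg_of_mem_Icc ⟨by nlinarith [hx.1], by nlinarith [hx.2]⟩
    simp only [kap, kern', abs_neg, abs_mul, abs_pow, abs_of_nonneg hc, abs_of_pos h0, Nat.abs_cast]
    nlinarith [abs_mul_abs_self (sin (om m * x)), 
      congrArg (fun t => m * ((2 * (n + 1) : ℕ) * cos (om m * x) ^ (2 * (n + 1) - 1) * om m) * t) (abs_mul_abs_self (sin (om m * x)))]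
  have e2 : ∫ x in (-m)..m, cos (om m * x) ^ (2 * (n + 1)) * (cos (om m * x) * om m) ≤ om m * kI m (n+1) := by
    unfold kI nuJ
    rw [← intervalIntegral.integral_of_le (by linarith), ← intervalIntegral.integral_const_mul]
    apply intervalIntegral.integral_mono_on (by linarith) (c2.intervalIntegrable _ _)
      (((kern_cont m (n+1)).const_mul _).intervalIntegrable _ _)
    intro x hx
    have := kern_nonneg m (n+1) x
    have h3 := cos_le_one (om m * x)
    have : kern m (n+1) x * (cos (om m * x) * om m) ≤ kern m (n+1) x * (1 * om m) := by gcongr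
    unfold kern at *
    linarith
  rw [e1]
  have : -(m * ∫ x in (-m)..m, kern' m (n+1) x * sin (om m * x)) =
    m * ∫ x in (-m)..m, cos (om m * x) ^ (2 * (n + 1)) * (cos (om m * x) * om m) := by
    linear_combination (-m) * hintg
  rw [this]
  calc _ ≤ m * (om m * kI m (n+1)) := by gcongr
    _ = _ := by rw [← h1]; ring
/-! ### Uniqueness: double integrals against the kernels -/

lemma nuJ_mem (m : ℝ) : ∀ᵐ x ∂(nuJ m), x ∈ Ioc (-m) m := ae_restrict_mem measurableSet_Ioc

lemma nuJ_prod_mem (m : ℝ) : ∀ᵐ p ∂((nuJ m).prod (nuJ m)), p.1 ∈ Ioc (-m) m ∧ p.2 ∈ Ioc (-m) m := by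
  have h1 := Measure.quasiMeasurePreserving_fst (μ := nuJ m) (ν := nuJ m) |>.ae (nuJ_mem m)
  have h2 := Measure.quasiMeasurePreserving_snd (μ := nuJ m) (ν := nuJ m) |>.ae (nuJ_mem m)
  filter_upwards [h1, h2] with p a b using ⟨a, b⟩

lemma int_kern {m : ℝ} {F : ℝ × ℝ → ℝ} (hF : Integrable F ((nuJ m).prod (nuJ m))) {k : ℝ → ℝ}
    (hk : Continuous k) : Integrable (fun p => F p * k (p.1 - p.2)) ((nuJ m).prod (nuJ m)) := by
  obtain ⟨C, hC⟩ := (isCompact_Icc (a := -(2 * m)) (b := 2 * m)).exists_bound_of_continuousOn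
    hk.continuousOn
  refine hF.mul_bdd (c := C) (by fun_prop) ?_
  filter_upwards [nuJ_prod_mem m] with p hp
  exact hC _ ⟨by linarith [hp.1.1, hp.2.2], by linarith [hp.1.2, hp.2.1]⟩

lemma int_mul_ct {m : ℝ} {V u : ℝ → ℝ} (hV : Integrable V (nuJ m)) (hu : Continuous u) :
    Integrable (fun x => V x * u x) (nuJ m) := by
  obtain ⟨C, hC⟩ := (isCompact_Icc (a := -m) (b := m)).exists_bound_of_continuousOn
    hu.continuousOn
  refine hV.mul_bdd (c := C) (by fun_prop) ?_
  filter_upwards [nuJ_mem m] with p hp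
  exact hC _ ⟨hp.1.le, hp.2⟩

lemma dsum {m : ℝ} {V h : ℝ → ℝ} (n : ℕ) (hV : Integrable V (nuJ m)) (hh : Integrable h (nuJ m)) :
    ∑ f, (∫ x, h x * uf m n f x ∂(nuJ m)) * (∫ x, V x * uf m n f x ∂(nuJ m)) =
    ∫ p, h p.1 * V p.2 * kern m n (p.1 - p.2) ∂((nuJ m).prod (nuJ m)) := by
  simp_rw [← integral_prod_mul (μ := nuJ m) (ν := nuJ m), ← uf_sum, Finset.mul_sum]
  rw [integral_finsetSum]
  · refine Finset.sum_congr rfl fun f _ => ?_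
    congr 1; ext p; ring
  · intro f _
    have := (int_mul_ct hh (uf_contDiff m n f).continuous).mul_prod
      (int_mul_ct hV (uf_contDiff m n f).continuous)
    exact this.congr (Eventually.of_forall fun p => by simp only; ring)

lemma dsum' {m : ℝ} {V h : ℝ → ℝ} (n : ℕ) (hV : Integrable V (nuJ m)) (hh : Integrable h (nuJ m)) :
    ∑ f, (∫ x, h x * deriv (uf m n f) x ∂(nuJ m)) * (∫ x, V x * uf m n f x ∂(nuJ m)) =
    ∫ p, h p.1 * V p.2 * kern' m n (p.1 - p.2) ∂((nuJ m).prod (nuJ m)) := by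
  simp_rw [← integral_prod_mul (μ := nuJ m) (ν := nuJ m), ← uf_sum', Finset.mul_sum]
  rw [integral_finsetSum]
  · refine Finset.sum_congr rfl fun f _ => ?_
    congr 1; ext p; ring
  · intro f _
    have := (int_mul_ct hh ((uf_contDiff m n f).continuous_deriv (by simp))).mul_prod
      (int_mul_ct hV (uf_contDiff m n f).continuous)
    exact this.congr (Eventually.of_forall fun p => by simp only; ring)

lemma schur1 {m : ℝ} (hm : 0 < m) {g k : ℝ → ℝ} (hg : Integrable g (nuJ m)) (hk : Continuous k)
    (hkp : Function.Periodic k (2 * m)) :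
    ∫ p, g p.2 * k (p.1 - p.2) ∂((nuJ m).prod (nuJ m)) =
      (∫ x, g x ∂(nuJ m)) * ∫ x, k x ∂(nuJ m) := by
  have hi : Integrable (fun p : ℝ × ℝ => g p.2 * k (p.1 - p.2)) ((nuJ m).prod (nuJ m)) :=
    int_kern (F := fun p => g p.2) (hg.comp_snd _) hk
  rw [integral_prod_symm _ hi]
  simp only [integral_const_mul, int_per hm hkp, integral_mul_const]

lemma schur1' {m : ℝ} (hm : 0 < m) {g k : ℝ → ℝ} (hg : Integrable g (nuJ m)) (hk : Continuous k)
    (hkp : Function.Periodic k (2 * m)) (hke : ∀ x, k (-x) = k x) :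
    ∫ p, g p.1 * k (p.1 - p.2) ∂((nuJ m).prod (nuJ m)) =
      (∫ x, g x ∂(nuJ m)) * ∫ x, k x ∂(nuJ m) := by
  rw [← schur1 hm hg hk hkp, ← integral_prod_swap]
  congr 1; ext p
  simp only [Prod.fst_swap, Prod.snd_swap]
  rw [← hke, neg_sub]

/-- The commutator bound. -/
lemma comm_bd {m l M : ℝ} (hm : 0 < m) (hl : 0 ≤ l) {V c : ℝ → ℝ} (n : ℕ)
    (hV : Integrable V (nuJ m)) (hVM : ∀ᵐ x ∂(nuJ m), |V x| ≤ M)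
    (hcV : Integrable (fun x => V x * c x) (nuJ m))
    (hc : ∀ x ∈ Icc (-m) m, ∀ y ∈ Icc (-m) m, |c x - c y| ≤ l * |(|x| - |y|)|) :
    2 * ∫ p, (V p.1 * c p.1) * V p.2 * kern' m (n + 1) (p.1 - p.2) ∂((nuJ m).prod (nuJ m)) ≤
      l * (π / 2) * kI m (n + 1) * ∫ x, V x ^ 2 ∂(nuJ m) := by
  set ν := nuJ m with hν
  have hi1 : Integrable (fun p : ℝ × ℝ => (V p.1 * c p.1) * V p.2 * kern' m (n + 1) (p.1 - p.2))
    (ν.prod ν) := int_kern (hcV.mul_prod hV) (kern'_cont m (n+1))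
  have hi2 : Integrable (fun p : ℝ × ℝ => V p.1 * (V p.2 * c p.2) * kern' m (n + 1) (p.1 - p.2))
    (ν.prod ν) := int_kern (hV.mul_prod hcV) (kern'_cont m (n+1))
  have hsw : ∫ p, (V p.1 * c p.1) * V p.2 * kern' m (n + 1) (p.1 - p.2) ∂(ν.prod ν) =
      - ∫ p, V p.1 * (V p.2 * c p.2) * kern' m (n + 1) (p.1 - p.2) ∂(ν.prod ν) := by
    rw [← integral_prod_swap, ← integral_neg]
    congr 1; ext p
    simp only [Prod.fst_swap, Prod.snd_swap]
    rw [← neg_sub p.1 p.2, kern'_neg]; ring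
  have hV2 : Integrable (fun x => V x ^ 2) ν := by
    refine (hV.mul_bdd hV.aestronglyMeasurable hVM).congr (Eventually.of_forall fun x => ?_)
    simp only; ring
  have hk1 : Integrable (fun p : ℝ × ℝ => V p.1 ^ 2 * kap m (n+1) (p.1 - p.2)) (ν.prod ν) :=
    int_kern (F := fun p => V p.1 ^ 2) (hV2.comp_fst _) (kap_cont m (n+1))
  have hk2 : Integrable (fun p : ℝ × ℝ => V p.2 ^ 2 * kap m (n+1) (p.1 - p.2)) (ν.prod ν) :=
    int_kern (F := fun p => V p.2 ^ 2) (hV2.comp_snd _) (kap_cont m (n+1))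
  have e1 := schur1 hm hV2 (kap_cont m (n+1)) (kap_per hm (n+1))
  have e2 := schur1' hm hV2 (kap_cont m (n+1)) (kap_per hm (n+1)) (kap_neg m (n+1))
  calc 2 * ∫ p, (V p.1 * c p.1) * V p.2 * kern' m (n + 1) (p.1 - p.2) ∂(ν.prod ν)
      = ∫ p, ((V p.1 * c p.1) * V p.2 * kern' m (n + 1) (p.1 - p.2)
          - V p.1 * (V p.2 * c p.2) * kern' m (n + 1) (p.1 - p.2)) ∂(ν.prod ν) := by
        rw [integral_sub hi1 hi2]; linarith
    _ ≤ ∫ p, l / 2 * (V p.1 ^ 2 * kap m (n+1) (p.1 - p.2) + V p.2 ^ 2 * kap m (n+1) (p.1 - p.2))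
          ∂(ν.prod ν) := by
        apply integral_mono_ae (hi1.sub hi2) ((hk1.add hk2).const_mul _)
        filter_upwards [nuJ_prod_mem m] with p hp
        simp only [Pi.sub_apply, Pi.add_apply]
        have h1 := hc p.1 ⟨hp.1.1.le, hp.1.2⟩ p.2 ⟨hp.2.1.le, hp.2.2⟩
        have h2 := abs_abs_sub_le hm (x := p.1) (y := p.2) ⟨hp.1.1.le, hp.1.2⟩ ⟨hp.2.1.le, hp.2.2⟩
        have h3 : |c p.1 - c p.2| * |kern' m (n+1) (p.1 - p.2)| ≤ l * kap m (n+1) (p.1 - p.2) := by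
          unfold kap
          calc _ ≤ (l * (m * |sin (om m * (p.1 - p.2))|)) * |kern' m (n+1) (p.1 - p.2)| := by
                gcongr; exact h1.trans (by gcongr)
            _ = _ := by ring
        have h4 := kap_nonneg hm (n+1) (p.1 - p.2)
        have h5 : |V p.1| * |V p.2| ≤ (V p.1 ^ 2 + V p.2 ^ 2) / 2 := by
          nlinarith [sq_nonneg (|V p.1| - |V p.2|), sq_abs (V p.1), sq_abs (V p.2)]
        calc _ = (V p.1 * V p.2) * ((c p.1 - c p.2) * kern' m (n+1) (p.1 - p.2)) := by ring
          _ ≤ |(V p.1 * V p.2) * ((c p.1 - c p.2) * kern' m (n+1) (p.1 - p.2))| := le_abs_self _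
          _ = (|V p.1| * |V p.2|) * (|c p.1 - c p.2| * |kern' m (n+1) (p.1 - p.2)|) := by
            simp only [abs_mul]
          _ ≤ ((V p.1 ^ 2 + V p.2 ^ 2) / 2) * (l * kap m (n+1) (p.1 - p.2)) := by gcongr
          _ = _ := by ring
    _ = l * ((∫ x, V x ^ 2 ∂ν) * ∫ x, kap m (n+1) x ∂ν) := by
        rw [integral_const_mul, integral_add hk1 hk2, e1, e2]; ring
    _ ≤ l * ((∫ x, V x ^ 2 ∂ν) * (π / 2 * kI m (n + 1))) := by
        gcongr
        exact kap_int hm n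
    _ = _ := by ring

lemma kern_int_shift {m : ℝ} (hm : 0 < m) (n : ℕ) (x : ℝ) :
    ∫ y, kern m n (x - y) ∂(nuJ m) = kI m n := by
  rw [kI, ← int_per hm (kern_per hm n) x]
  congr 1; ext y; rw [← kern_neg, neg_sub]

lemma peak {m : ℝ} (hm : 0 < m) {g : ℝ → ℝ} (hg : Continuous g) {x : ℝ} (hx : x ∈ Ioo (-m) m) :
    Tendsto (fun n => (kI m n)⁻¹ * ∫ y, g y * kern m n (x - y) ∂(nuJ m)) atTop (nhds (g x)) := by
  have h0 := om_pos hm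
  have h1 := om_mul hm
  have key := tendsto_setIntegral_pow_smul_of_unique_maximum_of_isCompact_of_continuousOn
    (μ := volume) (g := g) (x₀ := x) (s := Icc (-m) m) isCompact_Icc
    (c := fun y => cos (om m * (x - y)) ^ 2) (by fun_prop) ?_ ?_ ?_ ?_ hg.continuousOn
  · refine key.congr fun n => ?_
    simp only [smul_eq_mul]
    rw [integral_Icc_eq_integral_Ioc, integral_Icc_eq_integral_Ioc]
    have : ∀ y, (cos (om m * (x - y)) ^ 2) ^ n = kern m n (x - y) := fun y => by
      rw [kern, pow_mul]
    simp only [this]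
    rw [kern_int_shift hm]
    simp only [mul_comm]
  · intro y hy hyx
    simp only [sub_self, mul_zero, cos_zero, one_pow]
    have : 0 < sin (om m * (x - y)) ^ 2 := by
      rw [sq_pos_iff]
      rcases lt_or_gt_of_ne hyx with h | h
      · exact (sin_pos_of_pos_of_lt_pi (by nlinarith) (by nlinarith [hx.2, hy.1])).ne'
      · exact (sin_neg_of_neg_of_neg_pi_lt (by nlinarith) (by nlinarith [hx.1, hy.2])).ne
    linarith [sin_sq_add_cos_sq (om m * (x - y))]
  · intro y _; positivity
  · simp
  · rw [interior_Icc]; exact subset_closure hx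

lemma approx_id {m M : ℝ} (hm : 0 < m) {V h : ℝ → ℝ} (hh : AEStronglyMeasurable h (nuJ m))
    (hhM : ∀ᵐ x ∂(nuJ m), |h x| ≤ M) (hV : Integrable V (nuJ m)) :
    Tendsto (fun n => (kI m n)⁻¹ * ∫ p, h p.1 * V p.2 * kern m n (p.1 - p.2) ∂((nuJ m).prod (nuJ m)))
      atTop (nhds (∫ x, h x * V x ∂(nuJ m))) := by
  set ν := nuJ m with hν
  have hM0 : 0 ≤ |M| := abs_nonneg M
  have hhM' : ∀ᵐ x ∂ν, ‖h x‖ ≤ |M| := by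
    filter_upwards [hhM] with x hx using hx.trans (le_abs_self M)
  have hhi : Integrable h ν := by
    have := Integrable.mul_bdd (f := fun _ => (1:ℝ)) (integrable_const _) hh hhM'
    simpa using this
  have hhp : ∀ᵐ p ∂(ν.prod ν), |h p.1| ≤ |M| :=
    Measure.quasiMeasurePreserving_fst (μ := ν) (ν := ν) |>.ae hhM'
  have hintg : ∀ {g : ℝ → ℝ} (n : ℕ), Integrable g ν →
      Integrable (fun p : ℝ × ℝ => h p.1 * g p.2 * kern m n (p.1 - p.2)) (ν.prod ν) :=
    fun n hg => int_kern (hhi.mul_prod hg) (kern_cont m n)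
  have hig : ∀ {g : ℝ → ℝ}, Integrable g ν → Integrable (fun x => h x * g x) ν := by
    intro g hg
    refine (hg.mul_bdd hh hhM').congr (Eventually.of_forall fun x => ?_)
    simp only; ring
  -- continuous functions
  have hcont : ∀ g : ℝ → ℝ, Continuous g →
      Tendsto (fun n => (kI m n)⁻¹ * ∫ p, h p.1 * g p.2 * kern m n (p.1 - p.2) ∂(ν.prod ν))
      atTop (nhds (∫ x, h x * g x ∂ν)) := by
    intro g hg
    obtain ⟨B, hB⟩ := (isCompact_Icc (a := -m) (b := m)).exists_bound_of_continuousOn hg.continuousOn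
    have hgi : Integrable g ν := by
      have := int_mul_ct (m := m) (V := fun _ => 1) (integrable_const _) hg
      simpa using this
    have hrew : ∀ n, (kI m n)⁻¹ * ∫ p, h p.1 * g p.2 * kern m n (p.1 - p.2) ∂(ν.prod ν) =
        ∫ x, h x * ((kI m n)⁻¹ * ∫ y, g y * kern m n (x - y) ∂ν) ∂ν := by
      intro n
      rw [integral_prod _ (hintg n hgi), ← integral_const_mul]
      congr 1; ext x
      simp only [mul_assoc]
      rw [integral_const_mul]; ring
    simp only [hrew]
    refine tendsto_integral_of_dominated_convergence (fun _ => |M| * B) ?_ (integrable_const _) ?_ ?_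
    · intro n
      have := (hintg n hgi).integral_prod_left.aestronglyMeasurable.const_mul (kI m n)⁻¹
      refine this.congr (Eventually.of_forall fun x => ?_)
      simp only [mul_assoc]
      rw [integral_const_mul]; ring
    · intro n
      filter_upwards [hhM'] with x hx
      rw [norm_mul]
      have hk := kI_pos hm n
      have hB0 : 0 ≤ B := (norm_nonneg _).trans (hB 0 ⟨by linarith, by linarith⟩)
      gcongr
      rw [norm_mul, norm_inv, Real.norm_of_nonneg hk.le, inv_mul_le_iff₀ hk]
      have hki : Integrable (fun y => kern m n (x - y)) ν := by
        have := int_mul_ct (m := m) (V := fun _ => 1) (integrable_const _)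
          ((kern_cont m n).comp (continuous_const.sub continuous_id) : Continuous fun y => kern m n (x - y))
        simpa using this
      calc _ ≤ ∫ y, B * kern m n (x - y) ∂ν := by
            apply norm_integral_le_of_norm_le (hki.const_mul B)
            filter_upwards [nuJ_mem m] with y hy
            rw [norm_mul, Real.norm_of_nonneg (kern_nonneg m n _)]
            have := kern_nonneg m n (x - y)
            gcongr
            exact hB y ⟨hy.1.le, hy.2⟩
        _ = _ := by rw [integral_const_mul, kern_int_shift hm]; ring
    · have hne : ∀ᵐ x ∂ν, x ≠ m := ae_restrict_of_ae (by simp [ae_iff, measure_singleton])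
      filter_upwards [nuJ_mem m, hne] with x hx hxm
      exact (peak hm hg ⟨hx.1, lt_of_le_of_ne hx.2 hxm⟩).const_mul _
  rw [Metric.tendsto_atTop]
  intro ε hε
  obtain ⟨g, -, hg1, hgc, hgi⟩ := hV.exists_hasCompactSupport_integral_sub_le
    (ε := ε / (4 * (|M| + 1))) (by positivity)
  have hsm : |M| * ∫ x, ‖V x - g x‖ ∂ν ≤ ε / 4 := by
    calc _ ≤ (|M| + 1) * (ε / (4 * (|M| + 1))) := by gcongr; linarith
      _ = _ := by field_simp
  obtain ⟨n0, hn0⟩ := Metric.tendsto_atTop.1 (hcont g hgc) (ε / 4) (by positivity)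
  refine ⟨n0, fun n hn => ?_⟩
  have h1 := hn0 n hn
  rw [Real.dist_eq] at h1 ⊢
  have hk := kI_pos hm n
  have hVg : Integrable (fun x => ‖V x - g x‖) ν := (hV.sub hgi).norm
  have h2 : |(kI m n)⁻¹ * (∫ p, h p.1 * V p.2 * kern m n (p.1 - p.2) ∂(ν.prod ν)) -
      (kI m n)⁻¹ * ∫ p, h p.1 * g p.2 * kern m n (p.1 - p.2) ∂(ν.prod ν)| ≤ ε / 4 := by
    rw [← mul_sub, ← integral_sub (hintg n hV) (hintg n hgi), abs_mul, abs_inv, abs_of_pos hk,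
      inv_mul_le_iff₀ hk]
    have hb : Integrable (fun p : ℝ × ℝ => |M| * (‖V p.2 - g p.2‖ * kern m n (p.1 - p.2))) (ν.prod ν) :=
      (int_kern (F := fun p => ‖V p.2 - g p.2‖) (hVg.comp_snd _) (kern_cont m n)).const_mul _
    calc _ ≤ ∫ p, |M| * (‖V p.2 - g p.2‖ * kern m n (p.1 - p.2)) ∂(ν.prod ν) := by
          rw [← Real.norm_eq_abs]
          apply norm_integral_le_of_norm_le hb
          filter_upwards [hhp] with p hp
          have := kern_nonneg m n (p.1 - p.2)
          rw [← sub_mul, ← mul_sub, norm_mul, norm_mul, Real.norm_of_nonneg this, mul_assoc]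
          gcongr
          exact hp
      _ = kI m n * (|M| * ∫ x, ‖V x - g x‖ ∂ν) := by
          rw [integral_const_mul, schur1 hm hVg (kern_cont m n) (kern_per hm n), kI]; ring
      _ ≤ _ := by gcongr
  have h3 : |(∫ x, h x * g x ∂ν) - ∫ x, h x * V x ∂ν| ≤ ε / 4 := by
    rw [← integral_sub (hig hgi) (hig hV)]
    refine le_trans ?_ hsm
    rw [← integral_const_mul, ← Real.norm_eq_abs]
    apply norm_integral_le_of_norm_le (hVg.const_mul _)
    filter_upwards [hhM'] with x hx
    rw [← mul_sub, norm_mul, norm_sub_rev]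
    gcongr
  rw [abs_lt] at h1 ⊢
  rw [abs_le] at h2 h3
  constructor <;> linarith [h1.1, h1.2, h2.1, h2.2, h3.1, h3.2]
/-! ### Uniqueness: pointwise energy inequality -/

lemma bdd_integrable {m M : ℝ} {V : ℝ → ℝ} (hV : AEStronglyMeasurable V (nuJ m))
    (hVM : ∀ᵐ x ∂(nuJ m), |V x| ≤ M) : Integrable V (nuJ m) := by
  have := Integrable.mul_bdd (f := fun _ => (1:ℝ)) (integrable_const _) hV hVM
  simpa using this

lemma pw {m l M B : ℝ} (hm : 0 < m) (hl : 0 ≤ l) {V c e : ℝ → ℝ} (n : ℕ)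
    (hV : AEStronglyMeasurable V (nuJ m)) (hVM : ∀ᵐ x ∂(nuJ m), |V x| ≤ M)
    (hcm : AEStronglyMeasurable c (nuJ m)) (hcB : ∀ᵐ x ∂(nuJ m), |c x| ≤ B)
    (hem : AEStronglyMeasurable e (nuJ m)) (heB : ∀ᵐ x ∂(nuJ m), |e x| ≤ B)
    (hc : ∀ x ∈ Icc (-m) m, ∀ y ∈ Icc (-m) m, |c x - c y| ≤ l * |(|x| - |y|)|) :
    ∑ f, 2 * ((∫ x, V x * uf m (n+1) f x ∂(nuJ m)) *
        ∫ x, V x * (c x * deriv (uf m (n+1) f) x + e x * uf m (n+1) f x) ∂(nuJ m)) ≤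
      l * (π / 2) * kI m (n + 1) * (∫ x, V x ^ 2 ∂(nuJ m)) +
      2 * ∑ f, (∫ x, (V x * e x) * uf m (n+1) f x ∂(nuJ m)) *
        (∫ x, V x * uf m (n+1) f x ∂(nuJ m)) := by
  have hVi := bdd_integrable hV hVM
  have hVc : Integrable (fun x => V x * c x) (nuJ m) := hVi.mul_bdd hcm hcB
  have hVe : Integrable (fun x => V x * e x) (nuJ m) := hVi.mul_bdd hem heB
  have h1 := comm_bd hm hl n hVi hVM hVc hc
  rw [← dsum' (n+1) hVi hVc, Finset.mul_sum] at h1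
  rw [Finset.mul_sum]
  have : ∀ f, 2 * ((∫ x, V x * uf m (n+1) f x ∂(nuJ m)) *
        ∫ x, V x * (c x * deriv (uf m (n+1) f) x + e x * uf m (n+1) f x) ∂(nuJ m)) =
      2 * ((∫ x, (V x * c x) * deriv (uf m (n+1) f) x ∂(nuJ m)) *
        (∫ x, V x * uf m (n+1) f x ∂(nuJ m))) +
      2 * ((∫ x, (V x * e x) * uf m (n+1) f x ∂(nuJ m)) *
        (∫ x, V x * uf m (n+1) f x ∂(nuJ m))) := by
    intro f
    have e1 : ∫ x, V x * (c x * deriv (uf m (n+1) f) x + e x * uf m (n+1) f x) ∂(nuJ m) =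
        (∫ x, (V x * c x) * deriv (uf m (n+1) f) x ∂(nuJ m)) +
        ∫ x, (V x * e x) * uf m (n+1) f x ∂(nuJ m) := by
      rw [← integral_add (int_mul_ct hVc ((uf_contDiff m (n+1) f).continuous_deriv (by simp)))
        (int_mul_ct hVe (uf_contDiff m (n+1) f).continuous)]
      congr 1; ext x; ring
    rw [e1]; ring
  simp only [this, Finset.sum_add_distrib]
  linarith

lemma pwT_bd {m M B : ℝ} (hm : 0 < m) (hB : 0 ≤ B) {V e : ℝ → ℝ} (n : ℕ)
    (hV : AEStronglyMeasurable V (nuJ m)) (hVM : ∀ᵐ x ∂(nuJ m), |V x| ≤ M)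
    (hem : AEStronglyMeasurable e (nuJ m)) (heB : ∀ᵐ x ∂(nuJ m), |e x| ≤ B) :
    |(kI m n)⁻¹ * ∑ f, (∫ x, (V x * e x) * uf m n f x ∂(nuJ m)) *
        (∫ x, V x * uf m n f x ∂(nuJ m))| ≤ 2 * m * (M ^ 2 * B) := by
  have hVi := bdd_integrable hV hVM
  have hVe : Integrable (fun x => V x * e x) (nuJ m) := hVi.mul_bdd hem heB
  have hk := kI_pos hm n
  rw [dsum n hVi hVe, abs_mul, abs_inv, abs_of_pos hk, inv_mul_le_iff₀ hk]
  have hb : ∀ᵐ x ∂(nuJ m), |V x * e x| ≤ M * B := by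
    filter_upwards [hVM, heB] with x h1 h2
    rw [abs_mul]
    have := (abs_nonneg _).trans h1
    gcongr
  have h1 := Measure.quasiMeasurePreserving_fst (μ := nuJ m) (ν := nuJ m) |>.ae hb
  have h2 := Measure.quasiMeasurePreserving_snd (μ := nuJ m) (ν := nuJ m) |>.ae hVM
  have hc1 : Integrable (fun _ : ℝ => M ^ 2 * B) (nuJ m) := integrable_const _
  have hi : Integrable (fun p : ℝ × ℝ => (M^2*B) * kern m n (p.1 - p.2)) ((nuJ m).prod (nuJ m)) :=
    int_kern (F := fun _ => M^2 * B) (integrable_const _) (kern_cont m n)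
  calc _ ≤ ∫ p, (M ^ 2 * B) * kern m n (p.1 - p.2) ∂((nuJ m).prod (nuJ m)) := by
        rw [← Real.norm_eq_abs]
        apply norm_integral_le_of_norm_le hi
        filter_upwards [h1, h2] with p h1 h2
        have := kern_nonneg m n (p.1 - p.2)
        rw [norm_mul, norm_mul, Real.norm_of_nonneg this, Real.norm_eq_abs, Real.norm_eq_abs]
        have := (abs_nonneg _).trans h1
        calc _ ≤ (M * B) * M * kern m n (p.1 - p.2) := by gcongr
          _ = _ := by ring
    _ = (∫ x, M ^ 2 * B ∂(nuJ m)) * kI m n := schur1 hm hc1 (kern_cont m n) (kern_per hm n)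
    _ = _ := by
        rw [integral_const]
        have : (nuJ m).real univ = 2 * m := by
          simp [nuJ, Measure.real, Real.volume_Ioc]
          rw [ENNReal.toReal_ofReal (by linarith)]; ring
        rw [this, smul_eq_mul]; ring

lemma pwT_lim {m M B : ℝ} (hm : 0 < m) {V e : ℝ → ℝ}
    (hV : AEStronglyMeasurable V (nuJ m)) (hVM : ∀ᵐ x ∂(nuJ m), |V x| ≤ M)
    (hem : AEStronglyMeasurable e (nuJ m)) (heB : ∀ᵐ x ∂(nuJ m), |e x| ≤ B) :
    Tendsto (fun n => (kI m n)⁻¹ * ∑ f, (∫ x, (V x * e x) * uf m n f x ∂(nuJ m)) *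
        (∫ x, V x * uf m n f x ∂(nuJ m))) atTop (nhds (∫ x, V x * e x * V x ∂(nuJ m))) := by
  have hVi := bdd_integrable hV hVM
  have hVe : Integrable (fun x => V x * e x) (nuJ m) := hVi.mul_bdd hem heB
  have hb : ∀ᵐ x ∂(nuJ m), |V x * e x| ≤ M * B := by
    filter_upwards [hVM, heB] with x h1 h2
    rw [abs_mul]
    have := (abs_nonneg _).trans h1
    gcongr
  simp only [dsum _ hVi hVe]
  exact approx_id hm hVe.aestronglyMeasurable hb hVi

lemma pwE_lim {m M : ℝ} (hm : 0 < m) {V : ℝ → ℝ}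
    (hV : AEStronglyMeasurable V (nuJ m)) (hVM : ∀ᵐ x ∂(nuJ m), |V x| ≤ M) :
    Tendsto (fun n => (kI m n)⁻¹ * ∑ f, (∫ x, V x * uf m n f x ∂(nuJ m)) ^ 2)
      atTop (nhds (∫ x, V x ^ 2 ∂(nuJ m))) := by
  have hVi := bdd_integrable hV hVM
  simp only [pow_two, dsum _ hVi hVi]
  exact approx_id hm hV hVM hVi
/-! ### Uniqueness: evolution of the energy -/

lemma locInt_of_bdd {ζ : ℝ} {g B : ℝ → ℝ} (hB : AntitoneOn B (Ioi 0))
    (hg : AEStronglyMeasurable g (volume.restrict (Ioo 0 ζ)))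
    (hgB : ∀ᵐ s ∂(volume.restrict (Ioo 0 ζ)), |g s| ≤ B s) : LocallyIntegrableOn g (Ioo 0 ζ) := by
  intro x hx
  have hss : Ioo (x / 2) ζ ⊆ Ioo 0 ζ := Ioo_subset_Ioo_left (by linarith [hx.1])
  refine ⟨Ioo (x / 2) ζ, mem_nhdsWithin_of_mem_nhds
    (Ioo_mem_nhds (by linarith [hx.1]) hx.2), ?_⟩
  refine Integrable.of_bound ?_ (B (x / 2)) ?_
  · exact hg.mono_measure (Measure.restrict_mono hss le_rfl)
  · filter_upwards [ae_restrict_of_ae_restrict_of_subset hss hgB,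
      ae_restrict_mem measurableSet_Ioo] with s hs hs2
    have hx1 := hx.1
    exact hs.trans (hB (by simp; linarith) (by simp; linarith [hs2.1]) hs2.1.le)

lemma nuJ_real {m : ℝ} (hm : 0 < m) : (nuJ m).real univ = 2 * m := by
  simp [nuJ, Measure.real, Real.volume_Ioc]
  rw [ENNReal.toReal_ofReal (by linarith)]; ring

lemma int_nuJ_le {m K : ℝ} (hm : 0 < m) {F : ℝ → ℝ} (hF : ∀ᵐ x ∂(nuJ m), |F x| ≤ K) :
    |∫ x, F x ∂(nuJ m)| ≤ K * (2 * m) := by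
  have := norm_integral_le_of_norm_le_const (show ∀ᵐ x ∂(nuJ m), ‖F x‖ ≤ K from hF)
  rwa [nuJ_real hm] at this

lemma exists_mem_small {ζ δ : ℝ} {P : ℝ → Prop} (hδ : 0 < δ)
    (hδζ : δ ≤ ζ) (h : ∀ᵐ s ∂(volume.restrict (Ioo (0:ℝ) ζ)), P s) : ∃ s ∈ Ioo 0 δ, P s := by
  have h' : ∀ᵐ s ∂(volume.restrict (Ioo (0:ℝ) δ)), P s :=
    ae_restrict_of_ae_restrict_of_subset (Ioo_subset_Ioo_right hδζ) h
  have hne : (ae (volume.restrict (Ioo (0:ℝ) δ))).NeBot := by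
    rw [ae_neBot, Ne, Measure.restrict_eq_zero, Real.volume_Ioo]
    simpa using hδ
  obtain ⟨s, hs⟩ := (h'.and (ae_restrict_mem measurableSet_Ioo)).exists
  exact ⟨s, hs.2, hs.1⟩

lemma evol {ζ m M a L : ℝ} (hζ : 0 < ζ) (hm : 0 < m) (ha : 0 < a) (hL : 0 ≤ L)
    {V c e : ℝ × ℝ → ℝ} {B : ℝ → ℝ} (hB : AntitoneOn B (Ioi 0)) (hB0 : ∀ s, 0 < s → 0 ≤ B s)
    (hV : Measurable V) (hVM : ∀ p, |V p| ≤ M)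
    (hc : AEStronglyMeasurable c ((volume.restrict (Ioo 0 ζ)).prod (nuJ m)))
    (he : AEStronglyMeasurable e ((volume.restrict (Ioo 0 ζ)).prod (nuJ m)))
    (hbd : ∀ᵐ s ∂(volume.restrict (Ioo 0 ζ)), ∀ᵐ x ∂(nuJ m),
      |c (s, x)| ≤ B s ∧ |e (s, x)| ≤ B s ∧ e (s, x) ≤ L * s ^ (a - 1))
    (hlip : ∀ᵐ s ∂(volume.restrict (Ioo 0 ζ)), ∀ x ∈ Icc (-m) m, ∀ y ∈ Icc (-m) m,
      |c (s, x) - c (s, y)| ≤ L * s ^ (a - 1) * |(|x| - |y|)|)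
    (hweak : ∀ n f, ∀ α : ℝ → ℝ, ContDiff ℝ (⊤ : ℕ∞) α → HasCompactSupport α →
      tsupport α ⊆ Ioo 0 ζ →
      ∫ s, (deriv α s * (∫ x, V (s, x) * uf m n f x ∂(nuJ m)) +
        α s * ∫ x, V (s, x) * (c (s, x) * deriv (uf m n f) x + e (s, x) * uf m n f x) ∂(nuJ m)) = 0)
    (hvan : ∀ ε > 0, ∃ δ > 0, ∀ᵐ s ∂(volume.restrict (Ioo 0 (min δ ζ))),
      ∫ x, V (s, x) ^ 2 ∂(nuJ m) ≤ ε) :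
    ∀ᵐ s ∂(volume.restrict (Ioo 0 ζ)), ∫ x, V (s, x) ^ 2 ∂(nuJ m) = 0 := by
  have hM0 : 0 ≤ M := (abs_nonneg _).trans (hVM 0)
  set R1 := volume.restrict (Ioo 0 ζ) with hR1
  have hVae : AEStronglyMeasurable V (R1.prod (nuJ m)) := hV.aestronglyMeasurable
  have hVs : ∀ s, AEStronglyMeasurable (fun x => V (s, x)) (nuJ m) := fun s =>
    (hV.comp measurable_prodMk_left).aestronglyMeasurable
  have hVMs : ∀ s, ∀ᵐ x ∂(nuJ m), |V (s, x)| ≤ M := fun s => Eventually.of_forall fun x => hVM _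
  have hcs := hc.prodMk_left
  have hes := he.prodMk_left
  -- bounds for test functions
  have hU : ∀ n f, ∃ U, 0 ≤ U ∧ ∀ x ∈ Icc (-m) m, |uf m n f x| ≤ U ∧ |deriv (uf m n f) x| ≤ U := by
    intro n f
    obtain ⟨C1, h1⟩ := (isCompact_Icc (a := -m) (b := m)).exists_bound_of_continuousOn
      (uf_contDiff m n f).continuous.continuousOn
    obtain ⟨C2, h2⟩ := (isCompact_Icc (a := -m) (b := m)).exists_bound_of_continuousOn
      ((uf_contDiff m n f).continuous_deriv (by simp)).continuousOn
    refine ⟨max C1 C2, ((norm_nonneg _).trans (h1 m ⟨by linarith, le_rfl⟩)).trans (le_max_left _ _),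
      fun x hx => ⟨(h1 x hx).trans (le_max_left _ _), (h2 x hx).trans (le_max_right _ _)⟩⟩
  have huc := fun n f => (uf_contDiff m n f).continuous
  have hudc := fun n f => (uf_contDiff m n f).continuous_deriv (by simp : (1 : WithTop ℕ∞) ≤ 1)
  set v : ∀ n, (Fin (2 * n) → Fin 2) → ℝ → ℝ := fun n f s => ∫ x, V (s, x) * uf m n f x ∂(nuJ m)
    with hv
  set g : ∀ n, (Fin (2 * n) → Fin 2) → ℝ → ℝ := fun n f s =>
    ∫ x, V (s, x) * (c (s, x) * deriv (uf m n f) x + e (s, x) * uf m n f x) ∂(nuJ m) with hg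
  set w : ∀ n, (Fin (2 * n) → Fin 2) → ℝ → ℝ := fun n f s =>
    ∫ x, (V (s, x) * e (s, x)) * uf m n f x ∂(nuJ m) with hw
  set N : ℝ → ℝ := fun s => ∫ x, V (s, x) ^ 2 ∂(nuJ m) with hN
  have vm : ∀ n f, AEStronglyMeasurable (v n f) R1 := fun n f =>
    AEStronglyMeasurable.integral_prod_right' (f := fun p : ℝ × ℝ => V p * uf m n f p.2)
      (hVae.mul ((huc n f).comp continuous_snd).aestronglyMeasurable)
  have wm : ∀ n f, AEStronglyMeasurable (w n f) R1 := fun n f =>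
    AEStronglyMeasurable.integral_prod_right' (f := fun p : ℝ × ℝ => V p * e p * uf m n f p.2)
      ((hVae.mul he).mul ((huc n f).comp continuous_snd).aestronglyMeasurable)
  have gm : ∀ n f, AEStronglyMeasurable (g n f) R1 := fun n f =>
    AEStronglyMeasurable.integral_prod_right'
      (f := fun p : ℝ × ℝ => V p * (c p * deriv (uf m n f) p.2 + e p * uf m n f p.2))
      (hVae.mul ((hc.mul ((hudc n f).comp continuous_snd).aestronglyMeasurable).add
        (he.mul ((huc n f).comp continuous_snd).aestronglyMeasurable)))
  have Nm : AEStronglyMeasurable N R1 :=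
    AEStronglyMeasurable.integral_prod_right' (f := fun p : ℝ × ℝ => V p ^ 2) (hVae.pow 2)
  have Pm : AEStronglyMeasurable (fun s => ∫ x, V (s, x) * e (s, x) * V (s, x) ∂(nuJ m)) R1 :=
    AEStronglyMeasurable.integral_prod_right' (f := fun p : ℝ × ℝ => V p * e p * V p)
      ((hVae.mul he).mul hVae)
  have N0 : ∀ s, 0 ≤ N s := fun s => integral_nonneg fun x => sq_nonneg _
  have Nb : ∀ s, N s ≤ M ^ 2 * (2 * m) := by
    intro s
    refine (le_abs_self _).trans (int_nuJ_le hm (Eventually.of_forall fun x => ?_))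
    rw [abs_pow]; have := hVM (s, x); gcongr
  have vb : ∀ n f, ∃ K, 0 ≤ K ∧ ∀ s, |v n f s| ≤ K := by
    intro n f
    obtain ⟨U, hU0, hU⟩ := hU n f
    refine ⟨M * U * (2 * m), by positivity, fun s => int_nuJ_le hm ?_⟩
    filter_upwards [nuJ_mem m] with x hx
    rw [abs_mul]
    have := hVM (s, x)
    have := (hU x ⟨hx.1.le, hx.2⟩).1
    gcongr
  have gb : ∀ n f, ∃ K, 0 ≤ K ∧ ∀ᵐ s ∂(R1), |g n f s| ≤ K * B s := by
    intro n f
    obtain ⟨U, hU0, hU⟩ := hU n f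
    refine ⟨M * (2 * U) * (2 * m), by positivity, ?_⟩
    filter_upwards [hbd] with s hs
    rw [show M * (2 * U) * (2 * m) * B s = M * (B s * U + B s * U) * (2 * m) by ring]
    refine int_nuJ_le hm ?_
    filter_upwards [nuJ_mem m, hs] with x hx hs
    obtain ⟨h1, h2⟩ := hU x ⟨hx.1.le, hx.2⟩
    have := hVM (s, x)
    have hBs := (abs_nonneg _).trans hs.1
    rw [abs_mul]
    gcongr
    refine (abs_add_le _ _).trans ?_
    rw [abs_mul, abs_mul]
    gcongr
    · exact hs.1
    · exact hs.2.1
  have cI : ∀ {x y}, 0 < x → x < y → y < ζ → Icc x y ⊆ Ioo 0 ζ := fun h1 h2 h3 s hs =>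
    ⟨h1.trans_le hs.1, hs.2.trans_lt h3⟩
  have vL : ∀ n f, LocallyIntegrableOn (v n f) (Ioo 0 ζ) := by
    intro n f
    obtain ⟨K, hK0, hK⟩ := vb n f
    exact locInt_of_bdd (B := fun _ => K) (fun _ _ _ _ _ => le_rfl) (vm n f) (Eventually.of_forall hK)
  have gL : ∀ n f, LocallyIntegrableOn (g n f) (Ioo 0 ζ) := by
    intro n f
    obtain ⟨K, hK0, hK⟩ := gb n f
    exact locInt_of_bdd (B := fun s => K * B s)
      (fun x hx y hy hxy => mul_le_mul_of_nonneg_left (hB hx hy hxy) hK0) (gm n f) hK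
  choose S hS1 hS2 using fun n f => dbr_sq hζ (vL n f) (gL n f) (hweak n f)
  have hSall : ∀ᵐ s ∂(R1), ∀ n f, s ∈ S n f := by
    rw [ae_all_iff]; intro n; rw [ae_all_iff]; intro f; exact hS1 n f
  -- main inequality
  have main : ∀ x y, (∀ n f, x ∈ S n f) → (∀ n f, y ∈ S n f) → 0 < x → x < y → y < ζ →
      N y - N x ≤ ∫ s in x..y, (π / 2 + 2) * L * s ^ (a - 1) * N s := by
    intro x y hx hy hx0 hxy hyζ
    have hsub := cI hx0 hxy hyζ
    have hrsub : volume.restrict (Ioc x y) ≤ R1 :=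
      Measure.restrict_mono (Ioc_subset_Icc_self.trans hsub) le_rfl
    have toI : ∀ {F : ℝ → ℝ} {K : ℝ}, AEStronglyMeasurable F R1 →
        (∀ᵐ s ∂(volume.restrict (Ioc x y)), |F s| ≤ K) → IntervalIntegrable F volume x y := by
      intro F K hF hK
      rw [intervalIntegrable_iff_integrableOn_Ioc_of_le hxy.le]
      exact Integrable.of_bound (hF.mono_measure hrsub) K hK
    have hBx : ∀ s ∈ Ioc x y, B s ≤ B x := fun s hs =>
      hB (by simpa using hx0) (by simp; linarith [hs.1]) hs.1.le
    have hBx0 := hB0 x hx0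
    have hpc : ContinuousOn (fun s : ℝ => s ^ (a - 1)) (uIcc x y) := by
      rw [uIcc_of_le hxy.le]
      exact fun s hs => (Real.continuousAt_rpow_const _ _
        (Or.inl (by linarith [hs.1]))).continuousWithinAt
    have Nint : IntervalIntegrable N volume x y :=
      toI Nm (K := M ^ 2 * (2 * m)) (Eventually.of_forall fun s => by
        rw [abs_of_nonneg (N0 s)]; exact Nb s)
    have lNint : ∀ C : ℝ, IntervalIntegrable (fun s => C * s ^ (a - 1) * N s) volume x y := by
      intro C
      refine ((Nint.continuousOn_mul hpc).const_mul C).congr ?_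
      intro s _
      simp only
      ring
    have vgint : ∀ n f, IntervalIntegrable (fun s => 2 * (v n f s * g n f s)) volume x y := by
      intro n f
      obtain ⟨K1, hK10, hK1⟩ := vb n f
      obtain ⟨K2, hK20, hK2⟩ := gb n f
      refine toI (K := 2 * (K1 * (K2 * B x))) (((vm n f).mul (gm n f)).const_mul 2) ?_
      filter_upwards [hrsub.absolutelyContinuous.ae_le hK2,
        ae_restrict_mem measurableSet_Ioc] with s hs hsI
      rw [abs_mul, abs_mul, abs_two]
      have := hK1 s
      have := hBx s hsI
      gcongr
      exact hs.trans (by gcongr)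
    set T : ℕ → ℝ → ℝ := fun n s => (kI m n)⁻¹ * ∑ f, w n f s * v n f s with hT
    have Tm : ∀ n, AEStronglyMeasurable (T n) R1 := fun n =>
      (Finset.aestronglyMeasurable_fun_sum _ fun f _ => (wm n f).mul (vm n f)).const_mul _
    have good : ∀ᵐ s ∂(volume.restrict (Ioc x y)),
        (∀ᵐ x ∂(nuJ m), |c (s, x)| ≤ B s ∧ |e (s, x)| ≤ B s ∧ e (s, x) ≤ L * s ^ (a - 1)) ∧
        (∀ x ∈ Icc (-m) m, ∀ y ∈ Icc (-m) m,
          |c (s, x) - c (s, y)| ≤ L * s ^ (a - 1) * |(|x| - |y|)|) ∧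
        AEStronglyMeasurable (fun x => c (s, x)) (nuJ m) ∧
        AEStronglyMeasurable (fun x => e (s, x)) (nuJ m) ∧ s ∈ Ioc x y := by
      filter_upwards [hrsub.absolutelyContinuous.ae_le hbd, hrsub.absolutelyContinuous.ae_le hlip,
        hrsub.absolutelyContinuous.ae_le hcs, hrsub.absolutelyContinuous.ae_le hes,
        ae_restrict_mem measurableSet_Ioc] with s h1 h2 h3 h4 h5 using ⟨h1, h2, h3, h4, h5⟩
    have Tb : ∀ n, ∀ᵐ s ∂(volume.restrict (Ioc x y)), |T n s| ≤ 2 * m * (M ^ 2 * B x) := by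
      intro n
      filter_upwards [good] with s hs
      refine pwT_bd hm hBx0 n (hVs s) (hVMs s) hs.2.2.2.1 ?_
      filter_upwards [hs.1] with x h1 using h1.2.1.trans (hBx s hs.2.2.2.2)
    have Tint : ∀ n, IntervalIntegrable (T n) volume x y := fun n => toI (Tm n) (Tb n)
    set P : ℝ → ℝ := fun s => ∫ x, V (s, x) * e (s, x) * V (s, x) ∂(nuJ m) with hP
    have Plim : ∀ᵐ s ∂(volume.restrict (Ioc x y)), Tendsto (fun n => T n s) atTop (nhds (P s)) := by
      filter_upwards [good] with s hs
      refine pwT_lim (M := M) (B := B s) hm (hVs s) (hVMs s) hs.2.2.2.1 ?_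
      filter_upwards [hs.1] with x h1 using h1.2.1
    have Pb : ∀ᵐ s ∂(volume.restrict (Ioc x y)), |P s| ≤ 2 * m * (M ^ 2 * B x) := by
      filter_upwards [Plim, ae_all_iff.2 Tb] with s h1 h2
      exact le_of_tendsto' h1.abs h2
    have Pint : IntervalIntegrable P volume x y := toI Pm Pb
    have Ple : ∀ᵐ s ∂(volume.restrict (Ioc x y)), P s ≤ L * s ^ (a - 1) * N s := by
      filter_upwards [good] with s hs
      have hV2 : Integrable (fun x => V (s, x) ^ 2) (nuJ m) :=
        bdd_integrable (M := M ^ 2) ((hVs s).pow 2) (Eventually.of_forall fun x => by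
          rw [abs_pow]; have := hVM (s, x); gcongr)
      rw [← integral_const_mul]
      refine integral_mono_ae ?_ (hV2.const_mul _) ?_
      · refine (hV2.mul_bdd hs.2.2.2.1 (c := B s) ?_).congr (Eventually.of_forall fun x => ?_)
        · filter_upwards [hs.1] with x h1 using h1.2.1
        · simp only; ring
      · filter_upwards [hs.1] with x h1
        nlinarith [sq_nonneg (V (s, x)), h1.2.2]
    have step : ∀ n, (kI m (n+1))⁻¹ * (∑ f, v (n+1) f y ^ 2) - (kI m (n+1))⁻¹ * (∑ f, v (n+1) f x ^ 2) ≤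
        ∫ s in x..y, (π / 2 * L * s ^ (a - 1) * N s + 2 * T (n+1) s) := by
      intro n
      have hk := kI_pos hm (n+1)
      rw [← mul_sub, ← Finset.sum_sub_distrib]
      simp only [hS2 (n+1) _ x (hx _ _) y (hy _ _) hx0 hxy hyζ]
      rw [← intervalIntegral.integral_finsetSum fun f _ => vgint (n+1) f,
        ← intervalIntegral.integral_const_mul]
      apply intervalIntegral.integral_mono_ae_restrict hxy.le
      · have := IntervalIntegrable.sum (Finset.univ) (f := fun f s => 2 * (v (n+1) f s * g (n+1) f s))
          (fun f _ => vgint (n+1) f)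
        refine (this.const_mul (kI m (n+1))⁻¹).congr fun s _ => ?_
        simp
      · exact (lNint _).add ((Tint (n+1)).const_mul 2)
      · rw [← restrict_Ioc_eq_restrict_Icc]
        filter_upwards [good] with s hs
        have hs0 : 0 < s := hx0.trans hs.2.2.2.2.1
        have h1 := pw (l := L * s ^ (a - 1)) (M := M) (B := B s) hm (by positivity) n (hVs s) (hVMs s)
          hs.2.2.1 (by filter_upwards [hs.1] with x h1 using h1.1)
          hs.2.2.2.1 (by filter_upwards [hs.1] with x h1 using h1.2.1) hs.2.1
        rw [inv_mul_le_iff₀ hk]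
        refine h1.trans (le_of_eq ?_)
        simp only [hT, hN, hw, hv]
        field_simp
    have lim1 : Tendsto (fun n => (kI m (n+1))⁻¹ * (∑ f, v (n+1) f y ^ 2) -
        (kI m (n+1))⁻¹ * (∑ f, v (n+1) f x ^ 2)) atTop (nhds (N y - N x)) :=
      ((pwE_lim hm (hVs y) (hVMs y)).comp (tendsto_add_atTop_nat 1)).sub
        ((pwE_lim hm (hVs x) (hVMs x)).comp (tendsto_add_atTop_nat 1))
    have lim2 : Tendsto (fun n => ∫ s in x..y, (π / 2 * L * s ^ (a - 1) * N s + 2 * T (n+1) s)) atTop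
        (nhds (∫ s in x..y, (π / 2 * L * s ^ (a - 1) * N s + 2 * P s))) := by
      refine intervalIntegral.tendsto_integral_filter_of_dominated_convergence
        (fun s => |π / 2 * L * s ^ (a - 1) * N s| + 2 * (2 * m * (M ^ 2 * B x))) ?_ ?_ ?_ ?_
      · refine Eventually.of_forall fun n => ?_
        rw [uIoc_of_le hxy.le]
        exact ((lNint _).add ((Tint (n+1)).const_mul 2)).1.aestronglyMeasurable
      · refine Eventually.of_forall fun n => ?_
        rw [uIoc_of_le hxy.le, ← ae_restrict_iff' measurableSet_Ioc]
        filter_upwards [Tb (n+1)] with s hs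
        refine (norm_add_le _ _).trans ?_
        rw [Real.norm_eq_abs, Real.norm_eq_abs, abs_mul 2, abs_two]
        gcongr
      · exact (lNint _).abs.add (by simp)
      · rw [uIoc_of_le hxy.le, ← ae_restrict_iff' measurableSet_Ioc]
        filter_upwards [Plim] with s hs
        exact ((hs.comp (tendsto_add_atTop_nat 1)).const_mul 2).const_add _
    refine (le_of_tendsto_of_tendsto' lim1 lim2 step).trans ?_
    apply intervalIntegral.integral_mono_ae_restrict hxy.le ((lNint _).add (Pint.const_mul 2))
      (lNint _)
    rw [← restrict_Ioc_eq_restrict_Icc]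
    filter_upwards [Ple] with s hs
    nlinarith
  -- conclusion
  refine gron ha (B := (π / 2 + 2) * L) (by positivity) (M0 := M ^ 2 * (2 * m)) (by positivity) N0
    (Eventually.of_forall Nb) ?_
  filter_upwards [hSall, ae_restrict_mem measurableSet_Ioo] with y hy hyI
  have hIi : IntegrableOn (fun s => (π / 2 + 2) * L * s ^ (a - 1) * N s) (Ioo 0 y) := by
    have hi : IntegrableOn (fun s : ℝ => s ^ (a - 1)) (Ioo 0 y) := by
      have := intervalIntegral.intervalIntegrable_rpow' (a := 0) (b := y) (r := a - 1) (by linarith)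
      rw [intervalIntegrable_iff_integrableOn_Ioc_of_le hyI.1.le] at this
      exact this.mono_set Ioo_subset_Ioc_self
    refine (hi.const_mul ((π / 2 + 2) * L)).mul_bdd (c := M ^ 2 * (2 * m))
      (Nm.mono_measure (Measure.restrict_mono (Ioo_subset_Ioo_right hyI.2.le) le_rfl)) ?_
    exact Eventually.of_forall fun s => by
      rw [Real.norm_of_nonneg (N0 s)]; exact Nb s
  refine le_of_forall_pos_le_add fun ε hε => ?_
  obtain ⟨δ, hδ, hδN⟩ := hvan ε hε
  have hSall' : ∀ᵐ s ∂(volume.restrict (Ioo 0 (min δ ζ))), ∀ n f, s ∈ S n f :=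
    ae_restrict_of_ae_restrict_of_subset (Ioo_subset_Ioo_right (min_le_right _ _)) hSall
  have hmin : 0 < min (min δ ζ) y := lt_min (lt_min hδ hζ) hyI.1
  obtain ⟨x, hxI, hx1, hx2⟩ := exists_mem_small hmin (min_le_left _ _) (hδN.and hSall')
  have hxy : x < y := hxI.2.trans_le (min_le_right _ _)
  have := main x y hx2 hy hxI.1 hxy hyI.2
  have hle : ∫ s in x..y, (π / 2 + 2) * L * s ^ (a - 1) * N s ≤
      ∫ s in Ioo 0 y, (π / 2 + 2) * L * s ^ (a - 1) * N s := by
    rw [intervalIntegral.integral_of_le hxy.le, integral_Ioc_eq_integral_Ioo]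
    refine setIntegral_mono_set hIi ?_ (Ioo_subset_Ioo_left hxI.1.le).eventuallyLE
    filter_upwards [ae_restrict_mem measurableSet_Ioo] with s hs
    have := N0 s
    have := hs.1
    positivity
  linarith
/-! ### Unfolding and uniqueness -/

/-- reflection in the second variable -/
def rfl2 (p : ℝ × ℝ) : ℝ × ℝ := (p.1, -p.2)

lemma rfl2_mp : MeasurePreserving rfl2 (volume : Measure (ℝ × ℝ)) volume := by
  exact (MeasurePreserving.id (volume : Measure ℝ)).prod
    (Measure.measurePreserving_neg (volume : Measure ℝ))

lemma rfl2_rfl2 (p : ℝ × ℝ) : rfl2 (rfl2 p) = p := by simp [rfl2]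

lemma rfl2_emb : MeasurableEmbedding rfl2 := by
  apply MeasurableEmbedding.of_measurable_inverse (g := rfl2) rfl2_mp.measurable _ rfl2_mp.measurable
  · exact rfl2_rfl2
  · rw [(Function.Involutive.surjective rfl2_rfl2).range_eq]; exact MeasurableSet.univ

lemma line_null (a : ℝ) : ∀ᵐ p ∂(volume : Measure (ℝ × ℝ)), p.2 ≠ a := by
  have : ∀ᵐ x ∂(volume : Measure ℝ), x ≠ a := by
    simp [ae_iff]
  exact Measure.quasiMeasurePreserving_snd.ae this

lemma prodJ (ζ m : ℝ) : (volume.restrict (Ioo (0 : ℝ) ζ)).prod (nuJ m)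
    = (volume.restrict (Ioo (0 : ℝ) ζ ×ˢ Ioc (-m) m) : Measure (ℝ × ℝ)) := by
  rw [Measure.prod_restrict]; rfl

lemma meas_R (ζ m : ℝ) : MeasurableSet (Ioo (0 : ℝ) ζ ×ˢ Ioo (0 : ℝ) m) :=
  measurableSet_Ioo.prod measurableSet_Ioo

lemma fold_ae {ζ m : ℝ} {P : ℝ × ℝ → Prop} (h1 : ∀ᵐ p ∂(muR ζ m), P p)
    (h2 : ∀ᵐ p ∂(muR ζ m), P (rfl2 p)) :
    ∀ᵐ p ∂((volume.restrict (Ioo (0 : ℝ) ζ)).prod (nuJ m)), P p := by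
  rw [prodJ, ae_restrict_iff' (measurableSet_Ioo.prod measurableSet_Ioc)]
  rw [ae_restrict_iff' (meas_R ζ m)] at h1 h2
  filter_upwards [h1, rfl2_mp.quasiMeasurePreserving.ae h2, line_null 0, line_null m] with p h1 h2 h3 h4 hp
  rw [rfl2_rfl2] at h2
  rcases lt_or_gt_of_ne h3 with h | h
  · exact h2 ⟨hp.1, by simp [rfl2]; exact ⟨h, by linarith [hp.2.1]⟩⟩
  · exact h1 ⟨hp.1, h, lt_of_le_of_ne hp.2.2 h4⟩

lemma unfold_ae {ζ m : ℝ} (hm : 0 < m) {P : ℝ × ℝ → Prop}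
    (h : ∀ᵐ p ∂((volume.restrict (Ioo (0 : ℝ) ζ)).prod (nuJ m)), P p) :
    (∀ᵐ p ∂(muR ζ m), P p) ∧ (∀ᵐ p ∂(muR ζ m), P (rfl2 p)) := by
  rw [prodJ, ae_restrict_iff' (measurableSet_Ioo.prod measurableSet_Ioc)] at h
  rw [ae_restrict_iff' (meas_R ζ m), ae_restrict_iff' (meas_R ζ m)]
  constructor
  · filter_upwards [h] with p h hp
    exact h ⟨hp.1, by linarith [hp.2.1], hp.2.2.le⟩
  · filter_upwards [rfl2_mp.quasiMeasurePreserving.ae h] with p h hp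
    exact h ⟨hp.1, by simp [rfl2]; exact ⟨hp.2.2, by linarith [hp.2.1]⟩⟩

lemma fold_int {ζ m : ℝ} (hm : 0 < m) {G : ℝ × ℝ → ℝ}
    (hG : Integrable G ((volume.restrict (Ioo (0 : ℝ) ζ)).prod (nuJ m))) :
    ∫ p, G p ∂((volume.restrict (Ioo (0 : ℝ) ζ)).prod (nuJ m))
      = ∫ p, G p ∂(muR ζ m) + ∫ p, G (rfl2 p) ∂(muR ζ m) := by
  rw [prodJ] at hG ⊢
  have e : (Ioo (0 : ℝ) ζ ×ˢ Ioc (-m) m : Set (ℝ × ℝ)) =ᵐ[volume]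
      ((Ioo (0 : ℝ) ζ ×ˢ Ioo (0 : ℝ) m) ∪ rfl2 ⁻¹' (Ioo (0 : ℝ) ζ ×ˢ Ioo (0 : ℝ) m) : Set (ℝ × ℝ)) := by
    rw [Filter.eventuallyEq_set]
    filter_upwards [line_null 0, line_null m] with p h3 h4
    constructor
    · intro hp
      rcases lt_or_gt_of_ne h3 with h | h
      · exact Or.inr ⟨hp.1, by simp [rfl2]; exact ⟨h, by linarith [hp.2.1]⟩⟩
      · exact Or.inl ⟨hp.1, h, lt_of_le_of_ne hp.2.2 h4⟩
    · rintro (hp | hp)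
      · exact ⟨hp.1, by linarith [hp.2.1], hp.2.2.le⟩
      · have h1 := hp.2.1
        have h2 := hp.2.2
        simp [rfl2] at h1 h2
        exact ⟨hp.1, by linarith, by linarith⟩
  rw [Measure.restrict_congr_set e] at hG ⊢
  rw [setIntegral_union _ (rfl2_mp.measurable (meas_R ζ m)) (IntegrableOn.left_of_union hG) (IntegrableOn.right_of_union hG)]
  · congr 1
    have := (rfl2_mp.restrict_preimage_emb rfl2_emb (Ioo (0 : ℝ) ζ ×ˢ Ioo (0 : ℝ) m)).integral_comp
      rfl2_emb (fun p => G (rfl2 p))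
    rw [← this]
    simp only [rfl2_rfl2]
  · rw [Set.disjoint_left]
    intro p hp hq
    have h1 := hp.2.1
    have h2 := hq.2.1
    simp [rfl2] at h2
    linarith

lemma fold_meas {ζ m : ℝ} {f g : ℝ × ℝ → ℝ} (hf : AEMeasurable f (muR ζ m))
    (hg : AEMeasurable g (muR ζ m)) :
    AEStronglyMeasurable (fun p : ℝ × ℝ => if 0 < p.2 then f p else g (rfl2 p))
      ((volume.restrict (Ioo (0 : ℝ) ζ)).prod (nuJ m)) := by
  have hm : Measurable (fun p : ℝ × ℝ => if 0 < p.2 then hf.mk f p else hg.mk g (rfl2 p)) :=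
    Measurable.ite (measurableSet_lt measurable_const measurable_snd) hf.measurable_mk
      (hg.measurable_mk.comp rfl2_mp.measurable)
  refine ⟨_, hm.stronglyMeasurable, ?_⟩
  apply fold_ae
  · filter_upwards [ae_rect, hf.ae_eq_mk] with p hp h
    rw [if_pos hp.2.1, if_pos hp.2.1, h]
  · filter_upwards [ae_rect, hg.ae_eq_mk] with p hp h
    have h1 := hp.2.1
    have : ¬ (0 < (rfl2 p).2) := by simp [rfl2]; exact h1.le
    rw [if_neg this, if_neg this, rfl2_rfl2, h]

lemma alpha_low {ζ : ℝ} {α : ℝ → ℝ} (hα : HasCompactSupport α) (hs : tsupport α ⊆ Ioo 0 ζ) :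
    ∃ δ > 0, ∀ s, s < δ → α s = 0 ∧ deriv α s = 0 := by
  rcases (tsupport α).eq_empty_or_nonempty with h | h
  · rw [tsupport_eq_empty_iff] at h
    exact ⟨1, one_pos, fun s _ => by subst h; simp⟩
  · obtain ⟨a, ha, hmin⟩ := hα.isCompact.exists_isMinOn h continuousOn_id
    refine ⟨a, (hs ha).1, fun s hsa => ?_⟩
    have : s ∉ tsupport α := fun h' => absurd (hmin h') (by simpa using hsa)
    exact ⟨image_eq_zero_of_notMem_tsupport this,
      image_eq_zero_of_notMem_tsupport fun h' => this (tsupport_deriv_subset h')⟩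

lemma CharData.uniq {ζ m lam c0 C : ℝ} {c d αW αZ : ℝ × ℝ → ℝ} (hlam : 2 < lam) (hζ : 0 < ζ)
    (hζ1 : ζ ≤ 1) (hm : 0 < m) (hc0 : 0 < c0) (D : CharData ζ m lam c0 C c d αW αZ)
    {W Z : ℝ × ℝ → ℝ} {M : ℝ} (hW : Measurable W) (hZ : Measurable Z)
    (hM : ∀ p ∈ Ioo (0 : ℝ) ζ ×ˢ Ioo (0 : ℝ) m, |W p| ≤ M ∧ |Z p| ≤ M)
    (hvan : VanishAtSonic ζ m W Z)
    (hweak : ∀ ξ η : ℝ × ℝ → ℝ, ContDiff ℝ 1 ξ → ContDiff ℝ 1 η →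
      (∀ ψ ∈ Icc (0 : ℝ) m, ξ (ζ, ψ) = 0 ∧ η (ζ, ψ) = 0) →
      (∀ φ ∈ Icc (0 : ℝ) ζ, ξ (φ, 0) = -η (φ, 0) ∧ ξ (φ, m) = -η (φ, m)) →
      (∃ δ > 0, ∀ p : ℝ × ℝ, p.1 < δ → ξ p = 0 ∧ η p = 0 ∧ pdx ξ p = 0 ∧ pdx η p = 0 ∧
        pdy ξ p = 0 ∧ pdy η p = 0) →
      ∫ p, (W p * pdx ξ p + c p * W p * pdy ξ p + d p * W p * ξ p + (-αW p * W p) * ξ p) ∂(muR ζ m)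
      + ∫ p, (Z p * pdx η p - c p * Z p * pdy η p - d p * Z p * η p + (-αZ p * Z p) * η p) ∂(muR ζ m)
        = 0) :
    ∀ᵐ p ∂(muR ζ m), W p = 0 ∧ Z p = 0 := by
  have hC := D.C0
  set R := Ioo (0 : ℝ) ζ ×ˢ Ioo (0 : ℝ) m with hR
  have hMR : MeasurableSet R := meas_R ζ m
  have hM0 : 0 ≤ M := by
    have := (hM (ζ / 2, m / 2) ⟨⟨by simpa using hζ, by simpa using hζ⟩, by simpa using hm, by simpa using hm⟩).1
    exact (abs_nonneg _).trans this
  let V : ℝ × ℝ → ℝ := fun p => if 0 < p.2 then R.indicator W p else (fun q => - R.indicator Z q) (rfl2 p)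
  let c' : ℝ × ℝ → ℝ := fun p => if 0 < p.2 then c p else c (rfl2 p)
  let e : ℝ × ℝ → ℝ := fun p => if 0 < p.2 then (d p - αW p) else (fun q => - d q - αZ q) (rfl2 p)
  have hVm : Measurable V := Measurable.ite (measurableSet_lt measurable_const measurable_snd)
    (hW.indicator hMR) ((hZ.indicator hMR).neg.comp rfl2_mp.measurable)
  have hVM : ∀ p, |V p| ≤ M := by
    intro p
    simp only [V]
    split_ifs
    · by_cases hp : p ∈ R
      · rw [indicator_of_mem hp]; exact (hM p hp).1
      · rw [indicator_of_notMem hp]; simpa using hM0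
    · rw [abs_neg]
      by_cases hp : rfl2 p ∈ R
      · rw [indicator_of_mem hp]; exact (hM _ hp).2
      · rw [indicator_of_notMem hp]; simpa using hM0
  have rp : ∀ p ∈ R, ¬ (0 < (rfl2 p).2) := by
    intro p hp
    have := hp.2.1
    simp [rfl2]; exact this.le
  have V1 : ∀ p ∈ R, V p = W p := by
    intro p hp
    have := hp.2.1
    simp only [V, if_pos this, indicator_of_mem hp]
  have V2 : ∀ p ∈ R, V (rfl2 p) = - Z p := by
    intro p hp
    simp only [V, if_neg (rp p hp), rfl2_rfl2, indicator_of_mem hp]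
  have c1 : ∀ p ∈ R, c' p = c p := fun p hp => by
    have := hp.2.1
    simp only [c', if_pos this]
  have c2 : ∀ p ∈ R, c' (rfl2 p) = c p := fun p hp => by
    simp only [c', if_neg (rp p hp), rfl2_rfl2]
  have e1 : ∀ p ∈ R, e p = d p - αW p := fun p hp => by
    have := hp.2.1
    simp only [e, if_pos this]
  have e2 : ∀ p ∈ R, e (rfl2 p) = - d p - αZ p := fun p hp => by
    simp only [e, if_neg (rp p hp), rfl2_rfl2]
  have hc'm := fold_meas D.hc D.hc
  have hem := fold_meas (D.hd.sub D.haW) (D.hd.neg.sub D.haZ)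
  let B : ℝ → ℝ := fun s => C * s ^ (-((lam + 2) / 4)) + (C + c0) * s ^ (-1 : ℝ)
  have hBa : AntitoneOn B (Ioi 0) := by
    intro x hx y hy hxy
    simp only [B]
    have h1 := Real.rpow_le_rpow_of_nonpos hx hxy (z := -((lam + 2) / 4)) (by linarith)
    have h2 := Real.rpow_le_rpow_of_nonpos hx hxy (z := -1) (by linarith)
    gcongr
  have hB0 : ∀ s, 0 < s → 0 ≤ B s := fun s hs => by simp only [B]; positivity
  have bnd : ∀ p : ℝ × ℝ, p ∈ R → |d p| ≤ C * p.1 ^ (lam / 4 - 3 / 2) → ∀ α, 0 ≤ α → α ≤ c0 / p.1 →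
      (∀ sgn : ℝ, |sgn| ≤ 1 → |sgn * d p - α| ≤ B p.1 ∧ sgn * d p - α ≤ C * p.1 ^ (lam / 4 - 1 / 2 - 1)) ∧
      |c p| ≤ B p.1 := by
    intro p hp hd α h0 h1
    have hp0 : 0 < p.1 := hp.1.1
    have h2 := D.bd p.1 hp.1 p.2 (Ioo_subset_Icc_self hp.2)
    have h3 : 0 < p.1 ^ (-((lam + 2) / 4)) := Real.rpow_pos_of_pos hp0 _
    have h4 : p.1 ^ (lam / 4 - 3 / 2) ≤ p.1 ^ (-1 : ℝ) :=
      Real.rpow_le_rpow_of_exponent_ge hp0 (hp.1.2.le.trans hζ1) (by linarith)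
    have h5 : 0 < p.1 ^ (-1 : ℝ) := Real.rpow_pos_of_pos hp0 _
    have h6 : c0 / p.1 = c0 * p.1 ^ (-1 : ℝ) := by rw [Real.rpow_neg_one]; rfl
    have h7 : lam / 4 - 1 / 2 - 1 = lam / 4 - 3 / 2 := by ring
    have h8 : 0 < p.1 ^ (lam / 4 - 3 / 2) := Real.rpow_pos_of_pos hp0 _
    have h9 : C * p.1 ^ (lam / 4 - 3 / 2) ≤ C * p.1 ^ (-1 : ℝ) := by gcongr
    have h10 : 0 ≤ C * p.1 ^ (-((lam + 2) / 4)) := by positivity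
    rw [h7]
    simp only [B]
    refine ⟨fun sgn hs => ?_, ?_⟩
    · have h11 : |sgn * d p| ≤ C * p.1 ^ (lam / 4 - 3 / 2) := by
        rw [abs_mul]
        calc |sgn| * |d p| ≤ 1 * (C * p.1 ^ (lam / 4 - 3 / 2)) := by gcongr
          _ = _ := one_mul _
      rw [abs_le] at h11
      refine ⟨?_, by linarith [h11.2]⟩
      rw [abs_le]
      constructor <;> nlinarith [h11.1, h11.2]
    · have h12 : |c p| ≤ C * p.1 ^ (-((lam + 2) / 4)) := by rw [abs_of_pos h2.1]; exact h2.2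
      nlinarith
  have hbdp : ∀ᵐ p ∂((volume.restrict (Ioo (0 : ℝ) ζ)).prod (nuJ m)),
      |c' p| ≤ B p.1 ∧ |e p| ≤ B p.1 ∧ e p ≤ C * p.1 ^ (lam / 4 - 1 / 2 - 1) := by
    apply fold_ae
    · filter_upwards [ae_rect, D.d_le, D.aWb] with p hp h1 h2
      have := bnd p hp h1 (αW p) h2.1 h2.2
      have h3 := this.1 1 (by simp)
      rw [one_mul] at h3
      rw [c1 p hp, e1 p hp]
      exact ⟨this.2, h3⟩
    · filter_upwards [ae_rect, D.d_le, D.aZb] with p hp h1 h2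
      have := bnd p hp h1 (αZ p) h2.1 h2.2
      have h3 := this.1 (-1) (by simp)
      rw [neg_one_mul] at h3
      rw [c2 p hp, e2 p hp]
      exact ⟨this.2, h3⟩
  have c'abs : ∀ s x, c' (s, x) = c (s, |x|) := by
    intro s x
    simp only [c', rfl2]
    split_ifs with h
    · rw [abs_of_pos h]
    · rw [abs_of_nonpos (not_lt.1 h)]
  have key := evol (ζ := ζ) (m := m) (M := M) (a := lam / 4 - 1 / 2) (L := C) hζ hm (by linarith) hC.le
    (V := V) (c := c') (e := e) (B := B) hBa hB0 hVm hVM hc'm hem ?_ ?_ ?_ ?_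
  · -- conclusion
    have h1 : ∀ᵐ p ∂((volume.restrict (Ioo (0 : ℝ) ζ)).prod (nuJ m)), V p = 0 := by
      rw [Measure.ae_prod_iff_ae_ae (p := fun p => V p = 0)]
      · filter_upwards [key] with s hs
        rw [integral_eq_zero_iff_of_nonneg (fun x => sq_nonneg _)] at hs
        · filter_upwards [hs] with x hx
          simpa using hx
        · apply bdd_integrable (M := M ^ 2)
          · exact ((hVm.comp measurable_prodMk_left).pow_const 2).aestronglyMeasurable
          · refine Eventually.of_forall fun x => ?_
            rw [abs_pow]
            exact pow_le_pow_left₀ (abs_nonneg _) (hVM _) 2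
      · exact hVm (measurableSet_singleton 0)
    obtain ⟨h2, h3⟩ := unfold_ae hm h1
    filter_upwards [ae_rect, h2, h3] with p hp h2 h3
    rw [V1 p hp] at h2
    rw [V2 p hp] at h3
    exact ⟨h2, by linarith⟩
  · exact Measure.ae_ae_of_ae_prod hbdp
  · filter_upwards [D.lip, ae_restrict_mem measurableSet_Ioo] with s hs hs0 x hx y hy
    rw [c'abs, c'abs]
    have h7 : lam / 4 - 1 / 2 - 1 = lam / 4 - 3 / 2 := by ring
    rw [h7]
    exact hs _ ⟨abs_nonneg _, abs_le.2 hx⟩ _ ⟨abs_nonneg _, abs_le.2 hy⟩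
  · intro n f α hα hαc hαs
    obtain ⟨δ, hδ, hδ0⟩ := alpha_low hαc hαs
    set u := uf m n f with hu
    have huc : ContDiff ℝ 1 u := uf_contDiff m n f
    have huc0 := huc.continuous
    have huc1 : Continuous (deriv u) := huc.continuous_deriv (by norm_num)
    have hα1 : ContDiff ℝ 1 α := hα.of_le (by exact_mod_cast le_top)
    have hαd : Continuous (deriv α) := hα1.continuous_deriv (by norm_num)
    have hα0 := hα1.continuous
    let G : ℝ × ℝ → ℝ := fun p => deriv α p.1 * (V p * u p.2) + α p.1 * (V p * (c' p * deriv u p.2 + e p * u p.2))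
    have hGi : Integrable G ((volume.restrict (Ioo (0 : ℝ) ζ)).prod (nuJ m)) := by
      obtain ⟨U, hU⟩ := isCompact_Icc.exists_bound_of_continuousOn (huc0.continuousOn (s := Icc (-m) m))
      obtain ⟨U', hU'⟩ := isCompact_Icc.exists_bound_of_continuousOn (huc1.continuousOn (s := Icc (-m) m))
      obtain ⟨A, hA⟩ := isCompact_Icc.exists_bound_of_continuousOn (hα0.continuousOn (s := Icc 0 ζ))
      obtain ⟨A', hA'⟩ := isCompact_Icc.exists_bound_of_continuousOn (hαd.continuousOn (s := Icc 0 ζ))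
      have hbδ := hB0 δ hδ
      have h0J : (0:ℝ) ∈ Icc (-m) m := ⟨by linarith, hm.le⟩
      have h0I : (0:ℝ) ∈ Icc 0 ζ := ⟨le_rfl, hζ.le⟩
      have hU0 := (norm_nonneg _).trans (hU 0 h0J)
      have hU0' := (norm_nonneg _).trans (hU' 0 h0J)
      have hA0 := (norm_nonneg _).trans (hA 0 h0I)
      have hA0' := (norm_nonneg _).trans (hA' 0 h0I)
      have hms : AEStronglyMeasurable G ((volume.restrict (Ioo (0 : ℝ) ζ)).prod (nuJ m)) := by
        have m1 : AEStronglyMeasurable (fun p : ℝ × ℝ => deriv α p.1) ((volume.restrict (Ioo (0 : ℝ) ζ)).prod (nuJ m)) :=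
          (by fun_prop : Continuous (fun p : ℝ × ℝ => deriv α p.1)).aestronglyMeasurable
        have m2 : AEStronglyMeasurable (fun p : ℝ × ℝ => α p.1) ((volume.restrict (Ioo (0 : ℝ) ζ)).prod (nuJ m)) :=
          (by fun_prop : Continuous (fun p : ℝ × ℝ => α p.1)).aestronglyMeasurable
        have m3 : AEStronglyMeasurable (fun p : ℝ × ℝ => u p.2) ((volume.restrict (Ioo (0 : ℝ) ζ)).prod (nuJ m)) :=
          (by fun_prop : Continuous (fun p : ℝ × ℝ => u p.2)).aestronglyMeasurable
        have m4 : AEStronglyMeasurable (fun p : ℝ × ℝ => deriv u p.2) ((volume.restrict (Ioo (0 : ℝ) ζ)).prod (nuJ m)) :=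
          (by fun_prop : Continuous (fun p : ℝ × ℝ => deriv u p.2)).aestronglyMeasurable
        have m5 : AEStronglyMeasurable V ((volume.restrict (Ioo (0 : ℝ) ζ)).prod (nuJ m)) :=
          hVm.aestronglyMeasurable
        exact (m1.mul (m5.mul m3)).add (m2.mul (m5.mul ((hc'm.mul m4).add (hem.mul m3))))
      refine Integrable.of_bound hms (A' * (M * U) + A * (M * (B δ * U' + B δ * U))) ?_
      have hmem : ∀ᵐ p ∂((volume.restrict (Ioo (0 : ℝ) ζ)).prod (nuJ m)), p ∈ Ioo (0 : ℝ) ζ ×ˢ Ioc (-m) m := by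
        rw [prodJ]; exact ae_restrict_mem (measurableSet_Ioo.prod measurableSet_Ioc)
      filter_upwards [hbdp, hmem] with p hb hp
      have hpI := Ioo_subset_Icc_self hp.1
      have hpJ := Ioc_subset_Icc_self hp.2
      rcases lt_or_ge p.1 δ with h | h
      · have := hδ0 _ h
        simp only [G, this.1, this.2, zero_mul, add_zero, norm_zero]
        positivity
      · have hBB : B p.1 ≤ B δ := hBa hδ hp.1.1 h
        have k1 : ‖c' p‖ ≤ B δ := hb.1.trans hBB
        have k2 : ‖e p‖ ≤ B δ := hb.2.1.trans hBB
        have k3 : ‖V p‖ ≤ M := hVM p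
        have k4 := hU _ hpJ
        have k5 := hU' _ hpJ
        have k6 := hA _ hpI
        have k7 := hA' _ hpI
        simp only [G]
        refine (norm_add_le _ _).trans (add_le_add ?_ ?_)
        · rw [norm_mul, norm_mul]
          gcongr
        · rw [norm_mul, norm_mul]
          gcongr
          refine (norm_add_le _ _).trans (add_le_add ?_ ?_)
          · rw [norm_mul]; gcongr
          · rw [norm_mul]; gcongr
    have hst1 : ∫ s, (deriv α s * (∫ x, V (s,x) * u x ∂(nuJ m)) + α s * ∫ x, V (s,x) * (c' (s,x) * deriv u x + e (s,x) * u x) ∂(nuJ m))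
        = ∫ p, G p ∂((volume.restrict (Ioo (0 : ℝ) ζ)).prod (nuJ m)) := by
      rw [← setIntegral_eq_integral_of_forall_compl_eq_zero (s := Ioo 0 ζ), integral_prod G hGi]
      · apply integral_congr_ae
        filter_upwards [hGi.prod_right_ae] with s hs
        have i1 : Integrable (fun x => deriv α s * (V (s, x) * u x)) (nuJ m) := by
          apply Integrable.const_mul
          apply int_mul_ct _ huc0
          exact bdd_integrable (hVm.comp measurable_prodMk_left).aestronglyMeasurable
            (Eventually.of_forall fun x => hVM _)
        have i2 : Integrable (fun x => α s * (V (s,x) * (c' (s,x) * deriv u x + e (s,x) * u x))) (nuJ m) := by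
          have := hs.sub i1
          refine this.congr (Eventually.of_forall fun x => ?_)
          simp [G]
        simp only [G]
        rw [integral_add i1 i2, integral_const_mul, integral_const_mul]
      · intro s hs
        have h1 : s ∉ tsupport α := fun h => hs (hαs h)
        have h2 : α s = 0 := image_eq_zero_of_notMem_tsupport h1
        have h3 : deriv α s = 0 := image_eq_zero_of_notMem_tsupport fun h' => h1 (tsupport_deriv_subset h')
        rw [h2, h3]; simp
    rw [hst1, fold_int hm hGi]
    have px1 : ∀ p, pdx (fun p : ℝ × ℝ => α p.1 * u p.2) p = deriv α p.1 * u p.2 := fun p =>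
      ((hα1.differentiable (by norm_num) p.1).hasDerivAt.mul_const (u p.2)).deriv
    have py1 : ∀ p, pdy (fun p : ℝ × ℝ => α p.1 * u p.2) p = α p.1 * deriv u p.2 := fun p =>
      ((huc.differentiable (by norm_num) p.2).hasDerivAt.const_mul (α p.1)).deriv
    have px2 : ∀ p, pdx (fun p : ℝ × ℝ => -(α p.1 * u (-p.2))) p = - (deriv α p.1 * u (-p.2)) := fun p =>
      ((hα1.differentiable (by norm_num) p.1).hasDerivAt.mul_const (u (-p.2))).neg.deriv
    have py2 : ∀ p, pdy (fun p : ℝ × ℝ => -(α p.1 * u (-p.2))) p = α p.1 * deriv u (-p.2) := fun p => by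
      have h1 : HasDerivAt (fun y => u (-y)) (deriv u (-p.2) * (-1)) p.2 :=
        (huc.differentiable (by norm_num) (-p.2)).hasDerivAt.comp p.2 (hasDerivAt_neg p.2)
      have := (h1.const_mul (α p.1)).neg.deriv
      simp only [pdy]
      refine this.trans (by ring)
    have hw := hweak (fun p => α p.1 * u p.2) (fun p => - (α p.1 * u (-p.2))) (by fun_prop) (by fun_prop)
      ?_ ?_ ?_
    · rw [← hw]
      congr 1
      · apply setIntegral_congr_fun hMR
        intro p hp
        simp only [G, V1 p hp, c1 p hp, e1 p hp, px1, py1]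
        ring
      · apply setIntegral_congr_fun hMR
        intro p hp
        simp only [G, V2 p hp, c2 p hp, e2 p hp, px2, py2]
        simp only [rfl2]
        ring
    · intro ψ hψ
      have h1 : ζ ∉ tsupport α := fun h => lt_irrefl _ (hαs h).2
      have h2 : α ζ = 0 := image_eq_zero_of_notMem_tsupport h1
      simp [h2]
    · intro φ hφ
      refine ⟨by simp, ?_⟩
      simp only [neg_neg]
      rw [hu, uf_end hm]
    · refine ⟨δ, hδ, fun p hp => ?_⟩
      have := hδ0 _ hp
      rw [px1, px2, py1, py2, this.1, this.2]
      simp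
  · intro ε hε
    obtain ⟨φ0, h0, h⟩ := hvan (Real.sqrt (ε / (2 * m))) (by positivity)
    refine ⟨φ0, h0, ?_⟩
    have h1 : ∀ᵐ p ∂((volume.restrict (Ioo (0 : ℝ) (min φ0 ζ))).prod (nuJ m)),
        |V p| ≤ Real.sqrt (ε / (2 * m)) := by
      have hsub : ∀ p ∈ Ioo (0 : ℝ) (min φ0 ζ) ×ˢ Ioo (0 : ℝ) m, p ∈ R := fun p hp =>
        ⟨⟨hp.1.1, hp.1.2.trans_le (min_le_right _ _)⟩, hp.2⟩
      apply fold_ae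
      · filter_upwards [ae_rect, h] with p hp h
        rw [V1 p (hsub p hp)]; exact h.1
      · filter_upwards [ae_rect, h] with p hp h
        rw [V2 p (hsub p hp), abs_neg]; exact h.2
    filter_upwards [Measure.ae_ae_of_ae_prod h1] with s hs
    have h2 : ∀ᵐ x ∂(nuJ m), |V (s, x) ^ 2| ≤ ε / (2 * m) := by
      filter_upwards [hs] with x hx
      rw [abs_pow]
      calc |V (s, x)| ^ 2 ≤ Real.sqrt (ε / (2 * m)) ^ 2 := pow_le_pow_left₀ (abs_nonneg _) hx 2
        _ = _ := Real.sq_sqrt (by positivity)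
    refine (le_abs_self _).trans ((int_nuJ_le hm h2).trans (le_of_eq ?_))
    field_simp
/-! ### The concrete data -/

lemma lip_of_ae_deriv {g : ℝ → ℝ} {K : NNReal} {m l : ℝ} (hg : LipschitzWith K g)
    (h : ∀ᵐ x ∂(volume.restrict (Ioo 0 m)), |deriv g x| ≤ l) :
    ∀ x ∈ Icc 0 m, ∀ y ∈ Icc 0 m, |g x - g y| ≤ l * |x - y| := by
  intro x hx y hy
  have hac : AbsolutelyContinuousOnInterval g y x :=
    (hg.lipschitzOnWith (s := uIcc y x)).absolutelyContinuousOnInterval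
  rw [← hac.integral_deriv_eq_sub, ← Real.norm_eq_abs (∫ _ in _.._, _)]
  apply intervalIntegral.norm_integral_le_of_norm_le_const_ae
  rw [ae_restrict_iff' measurableSet_Ioo] at h
  have hne : ∀ᵐ t ∂(volume : Measure ℝ), t ≠ m := by simp [ae_iff]
  filter_upwards [h, hne] with t ht htm hyx
  apply ht
  rw [mem_uIoc] at hyx
  rcases hyx with h | h
  · exact ⟨hy.1.trans_lt h.1, lt_of_le_of_ne (h.2.trans hx.2) htm⟩
  · exact ⟨hx.1.trans_lt h.1, lt_of_le_of_ne (h.2.trans hy.2) htm⟩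

lemma measurable_bfun (γ : ℝ) : Measurable (bfun γ) := (measurable_deriv _).neg

lemma measurable_pfun (γ : ℝ) : Measurable (pfun γ) := (measurable_deriv _).neg

lemma sqrtb_deriv {γ s : ℝ} (hγ : 1 < γ) (hs : s < 0) :
    HasDerivAt (fun t => √(bfun γ t)) (1 / 2 * ((√(bfun γ s))⁻¹ * pfun γ s)) s := by
  have h := (hasDerivAt_bfun hγ hs).1.sqrt (bfun_pos hγ hs).ne'
  refine h.congr_deriv ?_
  have : 0 < √(bfun γ s) := Real.sqrt_pos.2 (bfun_pos hγ hs)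
  field_simp

lemma mkCharData {γ lam ζ m μ1 μ2 β1 β2 β3 c0 : ℝ} (hγ : 1 < γ)
    (hlam : 2 < lam) (hζ0 : 0 < ζ) (hζ1 : ζ ≤ 1) (hm : 0 < m)
    (hμ1 : 0 < μ1) (hμ12 : μ1 ≤ μ2) (hβ3 : 0 < β3)
    {Qt : ℝ × ℝ → ℝ} (hQt : QtOK γ lam ζ m μ1 μ2 β1 β2 β3 Qt)
    (hcoeff : ∀ᵐ p ∂(volume.restrict (Ioo (0 : ℝ) ζ ×ˢ Ioo (0 : ℝ) m)),
      (-c0 / p.1 ≤ 1 / 4 * (bfun γ (Qt p))⁻¹ * pfun γ (Qt p) * Wtil γ Qt p ∧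
        1 / 4 * (bfun γ (Qt p))⁻¹ * pfun γ (Qt p) * Wtil γ Qt p ≤ 0) ∧
      (0 ≤ 1 / 4 * (bfun γ (Qt p))⁻¹ * pfun γ (Qt p) * Ztil γ Qt p ∧
        1 / 4 * (bfun γ (Qt p))⁻¹ * pfun γ (Qt p) * Ztil γ Qt p ≤ c0 / p.1)) :
    ∃ C, CharData ζ m lam c0 C (fun p => √(bfun γ (Qt p)))
      (fun p => 1 / 2 * (√(bfun γ (Qt p)))⁻¹ * pfun γ (Qt p) * pdy Qt p)
      (fun p => -(1 / 4 * (bfun γ (Qt p))⁻¹ * pfun γ (Qt p) * Wtil γ Qt p))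
      (fun p => 1 / 4 * (bfun γ (Qt p))⁻¹ * pfun γ (Qt p) * Ztil γ Qt p) := by
  obtain ⟨⟨L, hL⟩, hQb, hQd⟩ := hQt
  obtain ⟨Q, hQL, hQe⟩ := hL.extend_real
  have hQc : Continuous Q := hQL.continuous
  have hR : MeasurableSet (Ioo (0 : ℝ) ζ ×ˢ Ioo (0 : ℝ) m) := measurableSet_Ioo.prod measurableSet_Ioo
  have hsub : Ioo (0 : ℝ) ζ ×ˢ Ioo (0 : ℝ) m ⊆ Icc (0 : ℝ) ζ ×ˢ Icc (0 : ℝ) m :=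
    prod_mono Ioo_subset_Icc_self Ioo_subset_Icc_self
  have ey : ∀ p ∈ Ioo (0 : ℝ) ζ ×ˢ Ioo (0 : ℝ) m, (fun y => Qt (p.1, y)) =ᶠ[nhds p.2] fun y => Q (p.1, y) := by
    intro p hp
    filter_upwards [Ioo_mem_nhds hp.2.1 hp.2.2] with y hy
    exact hQe (hsub ⟨hp.1, hy⟩)
  have ex : ∀ p ∈ Ioo (0 : ℝ) ζ ×ˢ Ioo (0 : ℝ) m, (fun x => Qt (x, p.2)) =ᶠ[nhds p.1] fun x => Q (x, p.2) := by
    intro p hp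
    filter_upwards [Ioo_mem_nhds hp.1.1 hp.1.2] with y hy
    exact hQe (hsub ⟨hy, hp.2⟩)
  have my : AEMeasurable (pdy Qt) (volume.restrict (Ioo (0 : ℝ) ζ ×ˢ Ioo (0 : ℝ) m)) := by
    have h1 : Measurable (fun p : ℝ × ℝ => deriv ((fun x y => Q (x, y)) p.1) p.2) :=
      measurable_deriv_with_param (f := fun x y => Q (x, y)) (by simpa [Function.uncurry_def] using hQc)
    refine ⟨_, h1, ?_⟩
    filter_upwards [ae_restrict_mem hR] with p hp
    exact (ey p hp).deriv_eq
  have mx : AEMeasurable (pdx Qt) (volume.restrict (Ioo (0 : ℝ) ζ ×ˢ Ioo (0 : ℝ) m)) := by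
    have h1 : Measurable (fun p : ℝ × ℝ => deriv ((fun x y => Q (y, x)) p.1) p.2) :=
      measurable_deriv_with_param (f := fun x y => Q (y, x))
        (show Continuous (fun p : ℝ × ℝ => Q (p.2, p.1)) by fun_prop)
    refine ⟨_, h1.comp measurable_swap, ?_⟩
    filter_upwards [ae_restrict_mem hR] with p hp
    exact (ex p hp).deriv_eq
  have mQ : AEMeasurable Qt (volume.restrict (Ioo (0 : ℝ) ζ ×ˢ Ioo (0 : ℝ) m)) := by
    refine ⟨_, hQc.measurable, ?_⟩
    filter_upwards [ae_restrict_mem hR] with p hp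
    exact hQe (hsub hp)
  have mb := (measurable_bfun γ).comp_aemeasurable mQ
  have mp := (measurable_pfun γ).comp_aemeasurable mQ
  have ms := mb.sqrt
  have qb : ∀ φ ∈ Ioo (0 : ℝ) ζ, ∀ x ∈ Icc (0 : ℝ) m,
      Qt (φ, x) ∈ Icc (-μ2 * φ ^ (lam + 2)) (-μ1 * φ ^ (lam + 2)) := by
    intro φ hφ x hx
    rw [hQe ⟨Ioo_subset_Icc_self hφ, hx⟩]
    have hcl : IsClosed {x | Q (φ, x) ∈ Icc (-μ2 * φ ^ (lam + 2)) (-μ1 * φ ^ (lam + 2))} :=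
      isClosed_Icc.preimage (by fun_prop)
    have : closure (Ioo 0 m) ⊆ {x | Q (φ, x) ∈ Icc (-μ2 * φ ^ (lam + 2)) (-μ1 * φ ^ (lam + 2))} := by
      apply closure_minimal _ hcl
      intro y hy
      have := hQb (φ, y) ⟨hφ, hy⟩
      rw [hQe (hsub ⟨hφ, hy⟩)] at this
      exact this
    rw [closure_Ioo hm.ne] at this
    exact this hx
  have qlip : ∀ᵐ φ ∂(volume.restrict (Ioo (0 : ℝ) ζ)), ∀ x ∈ Icc 0 m, ∀ y ∈ Icc 0 m,
      |Qt (φ, x) - Qt (φ, y)| ≤ β3 * φ ^ (3 * lam / 2 + 1) * |x - y| := by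
    filter_upwards [ae_ae_rect hQd, ae_restrict_mem measurableSet_Ioo] with φ h hφ x hx y hy
    rw [hQe ⟨Ioo_subset_Icc_self hφ, hx⟩, hQe ⟨Ioo_subset_Icc_self hφ, hy⟩]
    have hl : LipschitzWith (L * 1) (fun y => Q (φ, y)) :=
      hQL.comp (LipschitzWith.prodMk_left φ)
    refine lip_of_ae_deriv hl ?_ x hx y hy
    filter_upwards [h, ae_restrict_mem measurableSet_Ioo] with t ht htm
    have := ht.2
    rw [pdy, (ey (φ, t) ⟨hφ, htm⟩).deriv_eq] at this
    exact this
  obtain ⟨Cb, hCb, hb⟩ := b_bounds (μ := μ2) hγ (hμ1.trans_le hμ12)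
  have pw0 : ∀ φ ∈ Ioo (0 : ℝ) ζ, 0 < φ ^ (lam + 2) ∧ φ ^ (lam + 2) ≤ 1 := fun φ hφ =>
    ⟨Real.rpow_pos_of_pos hφ.1 _, Real.rpow_le_one hφ.1.le (hφ.2.le.trans hζ1) (by linarith)⟩
  have hbI : ∀ φ ∈ Ioo (0 : ℝ) ζ, ∀ s ∈ Icc (-μ2 * φ ^ (lam + 2)) (-μ1 * φ ^ (lam + 2)),
      s < 0 ∧ 0 < √(bfun γ s) ∧ √(bfun γ s) ≤ Cb * μ1 ^ (-(1 / 4) : ℝ) * φ ^ (-((lam + 2) / 4)) ∧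
      |(√(bfun γ s))⁻¹ * pfun γ s| ≤ Cb * μ1 ^ (-(5 / 4) : ℝ) * φ ^ (-(5 * (lam + 2) / 4)) := by
    intro φ hφ s hs
    obtain ⟨h1, h2⟩ := pw0 φ hφ
    have h3 : 0 < μ1 * φ ^ (lam + 2) := by positivity
    have hs0 : s < 0 := by linarith [hs.2]
    have h4 : -μ2 ≤ s := by nlinarith [hs.1]
    have h5 : μ1 * φ ^ (lam + 2) ≤ -s := by linarith [hs.2]
    have h6 := hb s ⟨h4, hs0⟩
    have e1 : ∀ r : ℝ, r ≤ 0 → (-s) ^ r ≤ μ1 ^ r * φ ^ ((lam + 2) * r) := by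
      intro r hr
      rw [Real.rpow_mul hφ.1.le, ← Real.mul_rpow hμ1.le h1.le]
      exact Real.rpow_le_rpow_of_nonpos h3 h5 hr
    refine ⟨hs0, Real.sqrt_pos.2 (bfun_pos hγ hs0), h6.1.trans ?_, h6.2.trans ?_⟩
    · have := e1 (-(1 / 4)) (by norm_num)
      rw [show (lam + 2) * (-(1 / 4)) = -((lam + 2) / 4) by ring] at this
      rw [mul_assoc]; gcongr
    · have := e1 (-(5 / 4)) (by norm_num)
      rw [show (lam + 2) * (-(5 / 4)) = -(5 * (lam + 2) / 4) by ring] at this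
      rw [mul_assoc]; gcongr
  have hA : 0 < Cb * μ1 ^ (-(1 / 4) : ℝ) := by positivity
  have hA' : 0 < 1 / 2 * (Cb * μ1 ^ (-(5 / 4) : ℝ)) * β3 := by positivity
  refine ⟨Cb * μ1 ^ (-(1 / 4) : ℝ) + 1 / 2 * (Cb * μ1 ^ (-(5 / 4) : ℝ)) * β3, ?_⟩
  refine ⟨ms, ?_, ?_, ?_, by positivity, ?_, ?_, ?_, ?_, ?_⟩
  · exact ((ms.inv.const_mul (1 / 2)).mul mp).mul my
  · exact (((mb.inv.const_mul (1 / 4)).mul mp).mul (mx.sub (ms.mul my))).neg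
  · exact ((mb.inv.const_mul (1 / 4)).mul mp).mul (mx.neg.sub (ms.mul my))
  · filter_upwards [qlip, ae_restrict_mem measurableSet_Ioo] with φ h hφ x hx y hy
    have h1 := (convex_Icc (-μ2 * φ ^ (lam + 2)) (-μ1 * φ ^ (lam + 2))).norm_image_sub_le_of_norm_hasDerivWithin_le
      (f := fun t => √(bfun γ t)) (f' := fun s => 1 / 2 * ((√(bfun γ s))⁻¹ * pfun γ s))
      (C := 1 / 2 * (Cb * μ1 ^ (-(5 / 4) : ℝ) * φ ^ (-(5 * (lam + 2) / 4))))
      (fun s hs => (sqrtb_deriv hγ (hbI φ hφ s hs).1).hasDerivWithinAt)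
      (fun s hs => by
        rw [norm_mul, Real.norm_eq_abs, Real.norm_eq_abs, abs_of_pos (by norm_num : (0:ℝ) < 1 / 2)]
        have := (hbI φ hφ s hs).2.2.2
        gcongr) (qb φ hφ y hy) (qb φ hφ x hx)
    have hφ0 := hφ.1
    refine h1.trans ?_
    have h2 : φ ^ (lam / 4 - 3 / 2) = φ ^ (-(5 * (lam + 2) / 4)) * φ ^ (3 * lam / 2 + 1) := by
      rw [← Real.rpow_add hφ0]; congr 1; ring
    have h3 : 0 < φ ^ (-(5 * (lam + 2) / 4)) := Real.rpow_pos_of_pos hφ0 _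
    have h4 : 0 < φ ^ (3 * lam / 2 + 1) := Real.rpow_pos_of_pos hφ0 _
    calc _ ≤ 1 / 2 * (Cb * μ1 ^ (-(5 / 4) : ℝ) * φ ^ (-(5 * (lam + 2) / 4))) *
          (β3 * φ ^ (3 * lam / 2 + 1) * |x - y|) := by
          have := h x hx y hy
          rw [Real.norm_eq_abs]
          gcongr
      _ = (1 / 2 * (Cb * μ1 ^ (-(5 / 4) : ℝ)) * β3) * φ ^ (lam / 4 - 3 / 2) * |x - y| := by
          rw [h2]; ring
      _ ≤ _ := by gcongr; linarith
  · intro φ hφ x hx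
    have h1 := hbI φ hφ _ (qb φ hφ x hx)
    refine ⟨h1.2.1, h1.2.2.1.trans ?_⟩
    have : 0 < φ ^ (-((lam + 2) / 4)) := Real.rpow_pos_of_pos hφ.1 _
    gcongr
    linarith
  · have hdf : ∀ᵐ p ∂(volume.restrict (Ioo (0 : ℝ) ζ ×ˢ Ioo (0 : ℝ) m)),
        DifferentiableAt ℝ ((fun x y => Q (x, y)) p.1) p.2 := by
      apply ae_restrict_of_ae
      have hms := measurableSet_of_differentiableAt_with_param ℝ (f := fun x y : ℝ => Q (x, y))
        (by simpa [Function.uncurry_def] using hQc)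
      rw [Measure.volume_eq_prod, Measure.ae_prod_iff_ae_ae hms]
      refine Eventually.of_forall fun φ => ?_
      have hl : LipschitzWith (L * 1) (fun y => Q (φ, y)) :=
        hQL.comp (LipschitzWith.prodMk_left φ)
      exact hl.ae_differentiableAt_real
    filter_upwards [hdf, ae_restrict_mem hR] with p h hp
    have h1 : HasDerivAt (fun y => Qt (p.1, y)) (pdy Qt p) p.2 :=
      ((ey p hp).differentiableAt_iff.2 h).hasDerivAt
    have h2 := sqrtb_deriv hγ (hbI p.1 hp.1 _ (qb p.1 hp.1 p.2 (Ioo_subset_Icc_self hp.2))).1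
    have h3 := h2.comp p.2 h1
    refine h3.congr_deriv ?_
    simp only [Prod.mk.eta]
    ring
  · filter_upwards [hcoeff] with p h
    refine ⟨by linarith [h.1.2], ?_⟩
    have := h.1.1
    rw [neg_div] at this
    linarith
  · filter_upwards [hcoeff] with p h
    exact h.2

lemma int_low {ζ m δ A : ℝ} {f g : ℝ × ℝ → ℝ} (hf : AEMeasurable f (muR ζ m))
    (hA : ∀ᵐ p ∂(muR ζ m), δ ≤ p.1 → |f p| ≤ A) (hg : Continuous g) (hg0 : ∀ p : ℝ × ℝ, p.1 < δ → g p = 0) :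
    Integrable (fun p => f p * g p) (muR ζ m) := by
  have hm : MeasurableSet {p : ℝ × ℝ | δ ≤ p.1} := measurableSet_le measurable_const measurable_fst
  have := int_mul_cont (ζ := ζ) (m := m) (f := {p : ℝ × ℝ | δ ≤ p.1}.indicator f) (g := g)
    (hf.indicator hm) |A| (by
      filter_upwards [hA] with p h
      by_cases hp : p ∈ {p : ℝ × ℝ | δ ≤ p.1}
      · rw [indicator_of_mem hp]; exact (h hp).trans (le_abs_self A)
      · rw [indicator_of_notMem hp]; simp) hg
  refine this.congr (Eventually.of_forall fun p => ?_)
  by_cases hp : p ∈ {p : ℝ × ℝ | δ ≤ p.1}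
  · simp only [indicator_of_mem hp]
  · simp only [indicator_of_notMem hp, hg0 p (not_le.1 hp), mul_zero]

lemma CharData.int_test {ζ m lam c0 C : ℝ} {c d αW αZ : ℝ × ℝ → ℝ} (hlam : 2 < lam)
    (hζ1 : ζ ≤ 1) (hc0 : 0 < c0) (D : CharData ζ m lam c0 C c d αW αZ)
    {W z ξ : ℝ × ℝ → ℝ} {M κ δ : ℝ} (hW : Measurable W) (hz : Measurable z)
    (hM : ∀ p ∈ Ioo (0 : ℝ) ζ ×ˢ Ioo (0 : ℝ) m, |W p| ≤ M)
    (hzb : ∀ᵐ p ∂(muR ζ m), |z p| ≤ κ) (hξ : ContDiff ℝ 1 ξ) (hδ : 0 < δ)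
    (hl : ∀ p : ℝ × ℝ, p.1 < δ → ξ p = 0 ∧ pdx ξ p = 0 ∧ pdy ξ p = 0) :
    Integrable (fun p => W p * pdx ξ p) (muR ζ m) ∧ Integrable (fun p => c p * W p * pdy ξ p) (muR ζ m) ∧
    Integrable (fun p => d p * W p * ξ p) (muR ζ m) ∧
    Integrable (fun p => (-αW p * (W p + z p)) * ξ p) (muR ζ m) := by
  have hC := D.C0
  refine ⟨?_, ?_, ?_, ?_⟩
  · refine int_low (δ := δ) (A := M) hW.aemeasurable ?_ (pdx_continuous hξ) fun p hp => (hl p hp).2.1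
    filter_upwards [ae_rect] with p hp _
    exact hM p hp
  · refine int_low (δ := δ) (A := C * δ ^ (-((lam + 2) / 4)) * M) (D.hc.mul hW.aemeasurable) ?_
      (pdy_continuous hξ) fun p hp => (hl p hp).2.2
    filter_upwards [ae_rect] with p hp h
    have h1 := D.bd p.1 hp.1 p.2 (Ioo_subset_Icc_self hp.2)
    have h2 : p.1 ^ (-((lam + 2) / 4)) ≤ δ ^ (-((lam + 2) / 4)) :=
      Real.rpow_le_rpow_of_nonpos hδ h (by linarith)
    simp only [Pi.mul_apply, abs_mul]
    have h3 := hM p hp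
    have h4 : |c p| ≤ C * δ ^ (-((lam + 2) / 4)) := by
      rw [abs_of_pos h1.1]
      exact h1.2.trans (by gcongr)
    gcongr
  · refine int_low (δ := δ) (A := C * δ ^ (-1 : ℝ) * M) (D.hd.mul hW.aemeasurable) ?_
      hξ.continuous fun p hp => (hl p hp).1
    filter_upwards [ae_rect, D.d_le] with p hp h1 h
    have h2 : p.1 ^ (-1 : ℝ) ≤ δ ^ (-1 : ℝ) :=
      Real.rpow_le_rpow_of_nonpos hδ h (by linarith)
    have h5 : p.1 ^ (lam / 4 - 3 / 2) ≤ p.1 ^ (-1 : ℝ) :=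
      Real.rpow_le_rpow_of_exponent_ge hp.1.1 (hp.1.2.le.trans hζ1) (by linarith)
    simp only [Pi.mul_apply, abs_mul]
    have h3 := hM p hp
    have h4 : |d p| ≤ C * δ ^ (-1 : ℝ) := h1.trans (by gcongr; exact h5.trans h2)
    gcongr
  · refine int_low (δ := δ) (A := c0 / δ * (M + κ)) (D.haW.neg.mul (hW.add hz).aemeasurable) ?_
      hξ.continuous fun p hp => (hl p hp).1
    filter_upwards [ae_rect, D.aWb, hzb] with p hp h1 h2 h
    simp only [Pi.mul_apply, Pi.neg_apply, Pi.add_apply, abs_mul, abs_neg]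
    have h3 := hM p hp
    have h4 : |αW p| ≤ c0 / δ := by
      rw [abs_of_nonneg h1.1]
      exact h1.2.trans (by gcongr)
    have h5 : |W p + z p| ≤ M + κ := (abs_add_le _ _).trans (add_le_add h3 h2)
    gcongr
/-- well-posedness of the singular characteristic system with
coupling source terms and homogeneous boundary data (Lemma `lemma-0ann`). -/
theorem stmt_19 (γ : ℝ) (hγ : 1 < γ) (lam ζ m μ1 μ2 β1 β2 β3 : ℝ)
    (hlam : 2 < lam) (hζ0 : 0 < ζ) (hζ1 : ζ ≤ 1) (hm : 0 < m)
    (hμ1 : 0 < μ1) (hμ12 : μ1 ≤ μ2) (hβ1 : 0 < β1) (hβ12 : β1 ≤ β2) (hβ3 : 0 < β3)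
    (Qt : ℝ × ℝ → ℝ) (hQt : QtOK γ lam ζ m μ1 μ2 β1 β2 β3 Qt)
    (c0 : ℝ) (hc0 : 0 < c0)
    (hcoeff : ∀ᵐ p ∂(volume.restrict (Ioo (0 : ℝ) ζ ×ˢ Ioo (0 : ℝ) m)),
      (-c0 / p.1 ≤ 1 / 4 * (bfun γ (Qt p))⁻¹ * pfun γ (Qt p) * Wtil γ Qt p ∧
        1 / 4 * (bfun γ (Qt p))⁻¹ * pfun γ (Qt p) * Wtil γ Qt p ≤ 0) ∧
      (0 ≤ 1 / 4 * (bfun γ (Qt p))⁻¹ * pfun γ (Qt p) * Ztil γ Qt p ∧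
        1 / 4 * (bfun γ (Qt p))⁻¹ * pfun γ (Qt p) * Ztil γ Qt p ≤ c0 / p.1))
    (w z : ℝ × ℝ → ℝ) (hwmeas : Measurable w) (hzmeas : Measurable z)
    (κ : ℝ) (hκ : 0 < κ)
    (hwz : ∀ᵐ p ∂(volume.restrict (Ioo (0 : ℝ) ζ ×ˢ Ioo (0 : ℝ) m)),
      |w p| ≤ κ * p.1 ^ (5 * lam / 4 + 1 / 2) ∧ |z p| ≤ κ * p.1 ^ (5 * lam / 4 + 1 / 2)) :
    ∃ W Z : ℝ × ℝ → ℝ,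
      (Measurable W ∧ Measurable Z ∧
        ∃ M : ℝ, ∀ p ∈ Ioo (0 : ℝ) ζ ×ˢ Ioo (0 : ℝ) m, |W p| ≤ M ∧ |Z p| ≤ M) ∧
      HypWeakSol γ ζ m Qt
        (fun p => 1 / 4 * (bfun γ (Qt p))⁻¹ * pfun γ (Qt p) * Wtil γ Qt p * (W p + z p))
        (fun p => -(1 / 4) * (bfun γ (Qt p))⁻¹ * pfun γ (Qt p) * Ztil γ Qt p * (w p + Z p))
        (fun _ => 0) W Z ∧
      VanishAtSonic ζ m W Z ∧
      (∀ᵐ p ∂(volume.restrict (Ioo (0 : ℝ) ζ ×ˢ Ioo (0 : ℝ) m)),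
        |W p| ≤ 4 * c0 / (5 * lam + 2 + 4 * c0) * κ * p.1 ^ (5 * lam / 4 + 1 / 2) ∧
        |Z p| ≤ 4 * c0 / (5 * lam + 2 + 4 * c0) * κ * p.1 ^ (5 * lam / 4 + 1 / 2)) ∧
      (∀ W' Z' : ℝ × ℝ → ℝ,
        (Measurable W' ∧ Measurable Z' ∧
          ∃ M : ℝ, ∀ p ∈ Ioo (0 : ℝ) ζ ×ˢ Ioo (0 : ℝ) m, |W' p| ≤ M ∧ |Z' p| ≤ M) →
        HypWeakSol γ ζ m Qt
          (fun p => 1 / 4 * (bfun γ (Qt p))⁻¹ * pfun γ (Qt p) * Wtil γ Qt p * (W' p + z p))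
          (fun p => -(1 / 4) * (bfun γ (Qt p))⁻¹ * pfun γ (Qt p) * Ztil γ Qt p * (w p + Z' p))
          (fun _ => 0) W' Z' →
        VanishAtSonic ζ m W' Z' →
        ∀ᵐ p ∂(volume.restrict (Ioo (0 : ℝ) ζ ×ˢ Ioo (0 : ℝ) m)),
          W' p = W p ∧ Z' p = Z p) := by
  obtain ⟨C, D⟩ := mkCharData hγ hlam hζ0 hζ1 hm hμ1 hμ12 hβ3 hQt hcoeff
  obtain ⟨W, Z, hWm, hZm, hWZ, hid⟩ := D.exist hlam hζ0 hζ1 hm hc0 hwmeas hzmeas hκ hwz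
  have hK : 0 < 4 * c0 / (5 * lam + 2 + 4 * c0) * κ := by
    have : 0 < 5 * lam + 2 + 4 * c0 := by linarith
    positivity
  have hpw : ∀ p ∈ Ioo (0 : ℝ) ζ ×ˢ Ioo (0 : ℝ) m, p.1 ^ (5 * lam / 4 + 1 / 2) ≤ p.1 := by
    intro p hp
    calc p.1 ^ (5 * lam / 4 + 1 / 2) ≤ p.1 ^ (1 : ℝ) :=
          Real.rpow_le_rpow_of_exponent_ge hp.1.1 (hp.1.2.le.trans hζ1) (by linarith)
      _ = p.1 := Real.rpow_one _
  have hWZ1 : ∀ p ∈ Ioo (0 : ℝ) ζ ×ˢ Ioo (0 : ℝ) m,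
      |W p| ≤ 4 * c0 / (5 * lam + 2 + 4 * c0) * κ * p.1 ∧
      |Z p| ≤ 4 * c0 / (5 * lam + 2 + 4 * c0) * κ * p.1 := by
    intro p hp
    have h1 := hWZ p hp
    have h2 := hpw p hp
    exact ⟨h1.1.trans (by gcongr), h1.2.trans (by gcongr)⟩
  have hWZM : ∀ p ∈ Ioo (0 : ℝ) ζ ×ˢ Ioo (0 : ℝ) m,
      |W p| ≤ 4 * c0 / (5 * lam + 2 + 4 * c0) * κ ∧ |Z p| ≤ 4 * c0 / (5 * lam + 2 + 4 * c0) * κ := by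
    intro p hp
    have h1 := hWZ1 p hp
    have h2 : p.1 ≤ 1 := hp.1.2.le.trans hζ1
    exact ⟨h1.1.trans (mul_le_of_le_one_right hK.le h2), h1.2.trans (mul_le_of_le_one_right hK.le h2)⟩
  have hVan : VanishAtSonic ζ m W Z := by
    intro η hη
    refine ⟨η / (4 * c0 / (5 * lam + 2 + 4 * c0) * κ), by positivity, ?_⟩
    filter_upwards [ae_rect] with p hp
    have hp1 : p ∈ Ioo (0 : ℝ) ζ ×ˢ Ioo (0 : ℝ) m :=
      ⟨⟨hp.1.1, hp.1.2.trans_le (min_le_right _ _)⟩, hp.2⟩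
    have h1 := hWZ1 p hp1
    have h2 : p.1 ≤ η / (4 * c0 / (5 * lam + 2 + 4 * c0) * κ) := hp.1.2.le.trans (min_le_left _ _)
    rw [le_div_iff₀ hK, mul_comm] at h2
    exact ⟨h1.1.trans h2, h1.2.trans h2⟩
  refine ⟨W, Z, ⟨hWm, hZm, _, hWZM⟩, ?_, hVan, ?_, ?_⟩
  · intro ξ η h1 h2 h3 h4
    have := hid (ξ, η) ⟨h1, h2, h3, h4⟩
    simp only [mul_zero, zero_mul, integral_zero, sub_zero]
    refine Eq.trans ?_ this
    congr 1
    · apply integral_congr_ae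
      refine Eventually.of_forall fun p => ?_
      simp only
      ring
    · apply integral_congr_ae
      refine Eventually.of_forall fun p => ?_
      simp only
      ring
  · filter_upwards [ae_rect] with p hp
    exact hWZ p hp
  · rintro W' Z' ⟨hW'm, hZ'm, M', hM'⟩ hid' hVan'
    have hzb : ∀ᵐ p ∂(muR ζ m), |w p| ≤ κ ∧ |z p| ≤ κ := by
      filter_upwards [ae_rect, hwz] with p hp h
      have h2 : p.1 ^ (5 * lam / 4 + 1 / 2) ≤ 1 := (hpw p hp).trans (hp.1.2.le.trans hζ1)
      exact ⟨h.1.trans (mul_le_of_le_one_right hκ.le h2), h.2.trans (mul_le_of_le_one_right hκ.le h2)⟩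
    have key := D.uniq hlam hζ0 hζ1 hm hc0 (W := fun p => W' p - W p) (Z := fun p => Z' p - Z p)
      (M := M' + 4 * c0 / (5 * lam + 2 + 4 * c0) * κ) (hW'm.sub hWm) (hZ'm.sub hZm) ?_ ?_ ?_
    · filter_upwards [key] with p hp
      exact ⟨sub_eq_zero.1 hp.1, sub_eq_zero.1 hp.2⟩
    · intro p hp
      exact ⟨(abs_sub _ _).trans (add_le_add (hM' p hp).1 (hWZM p hp).1),
        (abs_sub _ _).trans (add_le_add (hM' p hp).2 (hWZM p hp).2)⟩
    · intro η hη
      obtain ⟨a, ha, h1⟩ := hVan (η / 2) (by linarith)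
      obtain ⟨b, hb, h2⟩ := hVan' (η / 2) (by linarith)
      refine ⟨min a b, lt_min ha hb, ?_⟩
      have s1 : Ioo (0 : ℝ) (min (min a b) ζ) ×ˢ Ioo (0 : ℝ) m ⊆ Ioo (0 : ℝ) (min a ζ) ×ˢ Ioo (0 : ℝ) m :=
        prod_mono (Ioo_subset_Ioo_right (min_le_min_right _ (min_le_left _ _))) le_rfl
      have s2 : Ioo (0 : ℝ) (min (min a b) ζ) ×ˢ Ioo (0 : ℝ) m ⊆ Ioo (0 : ℝ) (min b ζ) ×ˢ Ioo (0 : ℝ) m :=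
        prod_mono (Ioo_subset_Ioo_right (min_le_min_right _ (min_le_right _ _))) le_rfl
      filter_upwards [ae_restrict_of_ae_restrict_of_subset s1 h1,
        ae_restrict_of_ae_restrict_of_subset s2 h2] with p h1 h2
      exact ⟨(abs_sub _ _).trans (by linarith [h1.1, h2.1]), (abs_sub _ _).trans (by linarith [h1.2, h2.2])⟩
    · rintro ξ η h1 h2 h3 h4 ⟨δ, hδ, hl⟩
      have k1 := hid (ξ, η) ⟨h1, h2, h3, h4⟩
      have k2 := hid' ξ η h1 h2 h3 h4
      simp only [mul_zero, zero_mul, integral_zero, sub_zero] at k2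
      have hl1 : ∀ p : ℝ × ℝ, p.1 < δ → ξ p = 0 ∧ pdx ξ p = 0 ∧ pdy ξ p = 0 := fun p hp =>
        ⟨(hl p hp).1, (hl p hp).2.2.1, (hl p hp).2.2.2.2.1⟩
      have hl2 : ∀ p : ℝ × ℝ, p.1 < δ → η p = 0 ∧ pdx η p = 0 ∧ pdy η p = 0 := fun p hp =>
        ⟨(hl p hp).2.1, (hl p hp).2.2.2.1, (hl p hp).2.2.2.2.2⟩
      obtain ⟨a1, a2, a3, a4⟩ := D.int_test hlam hζ1 hc0 hWm hzmeas (fun p hp => (hWZM p hp).1)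
        (hzb.mono fun p hp => hp.2) h1 hδ hl1
      obtain ⟨b1, b2, b3, b4⟩ := D.swap.int_test hlam hζ1 hc0 hZm hwmeas (fun p hp => (hWZM p hp).2)
        (hzb.mono fun p hp => hp.1) h2 hδ hl2
      obtain ⟨a1', a2', a3', a4'⟩ := D.int_test hlam hζ1 hc0 hW'm hzmeas (fun p hp => (hM' p hp).1)
        (hzb.mono fun p hp => hp.2) h1 hδ hl1
      obtain ⟨b1', b2', b3', b4'⟩ := D.swap.int_test hlam hζ1 hc0 hZ'm hwmeas (fun p hp => (hM' p hp).2)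
        (hzb.mono fun p hp => hp.1) h2 hδ hl2
      have iA := ((a1.add a2).add a3).add a4
      have iA' := ((a1'.add a2').add a3').add a4'
      have iB := ((b1.sub b2).sub b3).add b4
      have iB' := ((b1'.sub b2').sub b3').add b4'
      have eA := integral_sub iA' iA
      have eB := integral_sub iB' iB
      have e1 := congrArg₂ (· - ·) k2 k1
      simp only [sub_zero] at e1
      rw [← e1, add_sub_add_comm]
      congr 1
      · refine Eq.trans ?_ (eA.trans ?_)
        · apply integral_congr_ae
          refine Eventually.of_forall fun p => ?_
          simp only [Pi.add_apply]
          ring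
        · congr 1
          apply integral_congr_ae
          refine Eventually.of_forall fun p => ?_
          simp only [Pi.add_apply]
          ring
      · refine Eq.trans ?_ (eB.trans ?_)
        · apply integral_congr_ae
          refine Eventually.of_forall fun p => ?_
          simp only [Pi.add_apply, Pi.sub_apply]
          ring
        · congr 1
          · apply integral_congr_ae
            refine Eventually.of_forall fun p => ?_
            simp only [Pi.add_apply, Pi.sub_apply]
            ring
          · apply integral_congr_ae
            refine Eventually.of_forall fun p => ?_
            simp only [Pi.add_apply, Pi.sub_apply]
            ring
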